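/- arXiv:1805.01998 — 3 statements merged into one kernel-verified Lean document; each statement's English description precedes it below -/
import Mathlib

section
/- Let p be an odd prime, and let A, k, n be integers with |A| < p/2, p ∤ A, 1 ≤ k < p−1, gcd(k, p−1) = 1 and 2 ≤ n < p. Suppose d = gcd(k−1, p−1) ≤ 0.006·p^{89/92}. If p > 9·10^{34}·n^{92/3}, then for every pair i, j with 0 ≤ i, j ≤ n−1 one has f(I_i) ⊄ I_j. -/
/-- `Iclass p n j` is the residue class `I_j = {x : 1 ≤ x ≤ p-1, x ≡ j (mod n)}`. -/
def Iclass (p n j : ℕ) : Finset ℕ :=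
  (Finset.Icc 1 (p - 1)).filter fun x => x % n = j

/-- `fmap p A k x` is `A x^k mod p`, the least residue in `{0, …, p-1}`. -/
def fmap (p : ℕ) (A : ℤ) (k : ℕ) (x : ℕ) : ℕ :=
  ((A : ZMod p) * (x : ZMod p) ^ k).val

section Auxiliary

open Finset

/-- Parseval's identity for the additive group of `ZMod p`. -/
theorem parseval_zmod {p : ℕ} [Fact p.Prime] (g : ZMod p → ℂ) :
    ∑ a : ZMod p, ‖∑ x, g x * ZMod.stdAddChar (a * x)‖ ^ 2 = p * ∑ x, ‖g x‖ ^ 2 := by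
  have key : ∑ a : ZMod p, ((∑ x, g x * ZMod.stdAddChar (a * x)) *
      (starRingEnd ℂ) (∑ x, g x * ZMod.stdAddChar (a * x))) =
      p * ∑ x, (g x * (starRingEnd ℂ) (g x)) := by
    have h1 : ∀ a : ZMod p, (∑ x, g x * ZMod.stdAddChar (a * x)) *
        (starRingEnd ℂ) (∑ x, g x * ZMod.stdAddChar (a * x)) =
        ∑ x, ∑ y, g x * (starRingEnd ℂ) (g y) * ZMod.stdAddChar (a * (x - y)) := by
      intro a
      rw [map_sum, sum_mul_sum]
      refine sum_congr rfl fun x _ => sum_congr rfl fun y _ => ?_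
      rw [map_mul (starRingEnd ℂ), ← AddChar.map_neg_eq_conj, mul_sub, sub_eq_add_neg, AddChar.map_add_eq_mul]
      ring
    simp_rw [h1]
    rw [sum_comm]
    rw [mul_sum]
    refine sum_congr rfl fun x _ => ?_
    rw [sum_comm]
    simp_rw [← mul_sum, AddChar.sum_mulShift _ (ZMod.isPrimitive_stdAddChar p)]
    simp [sub_eq_zero, ZMod.card]
    ring
  have : ((∑ a : ZMod p, ‖∑ x, g x * ZMod.stdAddChar (a * x)‖ ^ 2 : ℝ) : ℂ) =
      ((p * ∑ x, ‖g x‖ ^ 2 : ℝ) : ℂ) := by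
    push_cast
    simp_rw [Complex.mul_conj'] at key
    exact key
  exact_mod_cast this

theorem parseval_finset {p : ℕ} [Fact p.Prime] (T : Finset (ZMod p)) :
    ∑ a : ZMod p, ‖∑ x ∈ T, (ZMod.stdAddChar (a * x) : ℂ)‖ ^ 2 = p * #T := by
  have := parseval_zmod (p := p) (fun x => if x ∈ T then 1 else 0)
  simp only [ite_mul, one_mul, zero_mul, sum_ite_mem, univ_inter] at this
  rw [this]
  congr 1
  simp [apply_ite norm, ite_pow]

/-- The binomial exponential sum `∑ x, ψ (a x + b x ^ k)`. -/
noncomputable def binomSum {p : ℕ} [Fact p.Prime] (k : ℕ) (a b : ZMod p) : ℂ :=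
  ∑ x : ZMod p, ZMod.stdAddChar (a * x + b * x ^ k)

theorem binomSum_scale {p : ℕ} [Fact p.Prime] (k : ℕ) (a b : ZMod p) {t : ZMod p} (ht : t ≠ 0) :
    binomSum k (t * a) (t ^ k * b) = binomSum k a b := by
  unfold binomSum
  refine Fintype.sum_equiv (Equiv.mulLeft₀ t ht) _ _ fun x => ?_
  rw [Equiv.mulLeft₀_apply]
  congr 1
  ring

theorem binomSum_zero_left {p : ℕ} [Fact p.Prime] {k : ℕ}
    (hφ : Function.Bijective fun x : ZMod p => x ^ k) {b : ZMod p} (hb : b ≠ 0) :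
    binomSum k 0 b = 0 := by
  unfold binomSum
  have := Fintype.sum_bijective (fun x : ZMod p => x ^ k) hφ
    (fun x => (ZMod.stdAddChar (0 * x + b * x ^ k) : ℂ)) (fun x => ZMod.stdAddChar (x * b))
    (fun x => by congr 1; ring)
  rw [this, AddChar.sum_mulShift _ (ZMod.isPrimitive_stdAddChar p), if_neg hb, Nat.cast_zero]

theorem sum_norm_sq_binomSum {p : ℕ} [Fact p.Prime] {k : ℕ}
    (hφ : Function.Bijective fun x : ZMod p => x ^ k) :
    ∑ b : ZMod p, ‖binomSum k 1 b‖ ^ 2 = (p : ℝ) ^ 2 := by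
  set e := Equiv.ofBijective _ hφ
  have := parseval_zmod (p := p) (fun y => ZMod.stdAddChar (e.symm y))
  simp only [AddChar.norm_apply, one_pow, sum_const, card_univ, ZMod.card, nsmul_eq_mul,
    mul_one] at this
  rw [sq, ← this]
  refine sum_congr rfl fun b _ => ?_
  congr 2
  unfold binomSum
  refine Fintype.sum_equiv e _ _ fun x => ?_
  rw [AddChar.map_add_eq_mul, one_mul, Equiv.symm_apply_apply]
  rfl

/-- Linear amplification along the `(k - 1)`-torsion. -/
theorem card_mul_norm_binomSum_le {p : ℕ} [Fact p.Prime] {k : ℕ} (hk : 1 ≤ k) {l : ZMod p}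
    (hl : l ≠ 0) (H : Finset (ZMod p)) (hH : ∀ x, x ∈ H ↔ x ≠ 0 ∧ x ^ (k - 1) = 1) :
    (#H : ℝ) * ‖binomSum k 1 l‖ ≤ ((#H : ℝ) + 1) * #H + p * √p := by
  have hpow : ∀ x : ZMod p, x ^ k = x ^ (k - 1) * x := fun x => by
    rw [← pow_succ, Nat.sub_add_cancel hk]
  set E : ZMod p → ℂ := fun y => ∑ h ∈ H, ZMod.stdAddChar (y * h) with hE
  have hEb : ∀ y ≠ 0, ‖E y‖ ≤ √p := by
    intro y hy
    by_cases hne : H.Nonempty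
    · have h1 : (#H : ℝ) * ‖E y‖ ^ 2 ≤ p * #H := by
        rw [← parseval_finset H]
        have h2 : ∀ h ∈ H, ‖E (h * y)‖ ^ 2 = ‖E y‖ ^ 2 := by
          intro h hh
          obtain ⟨h0, h1⟩ := (hH h).1 hh
          congr 2
          refine sum_bij' (fun a _ => h * a) (fun a _ => h⁻¹ * a) ?_ ?_ ?_ ?_ ?_
          · intro a ha
            obtain ⟨ha0, ha1⟩ := (hH a).1 ha
            exact (hH _).2 ⟨mul_ne_zero h0 ha0, by rw [mul_pow, h1, ha1, one_mul]⟩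
          · intro a ha
            obtain ⟨ha0, ha1⟩ := (hH a).1 ha
            exact (hH _).2 ⟨mul_ne_zero (inv_ne_zero h0) ha0, by
              rw [mul_pow, inv_pow, h1, ha1, inv_one, one_mul]⟩
          · intro a _
            field_simp
          · intro a _
            field_simp
          · intro a _
            congr 1
            ring
        rw [← nsmul_eq_mul, ← sum_const, ← sum_congr rfl h2]
        rw [← sum_image (s := H) (g := fun h : ZMod p => h * y) (f := fun a => ‖E a‖ ^ 2)
          (fun a _ b _ hab => mul_right_cancel₀ hy hab)]
        exact sum_le_univ_sum_of_nonneg fun _ => by positivity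
      have hpos : (0 : ℝ) < #H := by exact_mod_cast hne.card_pos
      apply Real.le_sqrt_of_sq_le
      nlinarith
    · rw [not_nonempty_iff_eq_empty] at hne
      simp [hE, hne]
  set Z : Finset (ZMod p) := univ.filter fun x => x + l * x ^ k = 0 with hZ
  have hZcard : #Z ≤ #H + 1 := by
    by_cases hex : ∃ x₀ ∈ Z, x₀ ≠ 0
    · obtain ⟨x₀, hx₀, hx₀0⟩ := hex
      have hx₁ : x₀ + l * x₀ ^ k = 0 := by simpa [hZ] using hx₀
      have hsub : Z ⊆ insert 0 (H.image fun h : ZMod p => h * x₀) := by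
        intro x hx
        have hx₁' : x + l * x ^ k = 0 := by simpa [hZ] using hx
        rw [mem_insert]
        by_cases hx0 : x = 0
        · exact Or.inl hx0
        · refine Or.inr (mem_image.2 ⟨x / x₀, (hH _).2 ⟨div_ne_zero hx0 hx₀0, ?_⟩, by
            field_simp⟩)
          rw [hpow] at hx₁ hx₁'
          have e1 : 1 + l * x₀ ^ (k - 1) = 0 := by
            apply mul_right_cancel₀ hx₀0; linear_combination hx₁
          have e2 : 1 + l * x ^ (k - 1) = 0 := by
            apply mul_right_cancel₀ hx0; linear_combination hx₁'
          rw [div_pow, div_eq_one_iff_eq (pow_ne_zero _ hx₀0)]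
          apply mul_left_cancel₀ hl
          linear_combination e2 - e1
      calc #Z ≤ _ := card_le_card hsub
        _ ≤ _ := (card_insert_le _ _).trans (Nat.add_le_add_right card_image_le 1)
    · push Not at hex
      have : Z ⊆ ({0} : Finset (ZMod p)) := fun x hx => by simpa using hex x hx
      calc #Z ≤ 1 := by simpa using card_le_card this
        _ ≤ _ := by omega
  have hsum : (#H : ℂ) * binomSum k 1 l = ∑ x : ZMod p, E (x + l * x ^ k) := by
    rw [hE, sum_comm, ← nsmul_eq_mul, ← sum_const]
    refine sum_congr rfl fun h hh => ?_
    obtain ⟨h0, h1⟩ := (hH h).1 hh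
    rw [← binomSum_scale k 1 l h0, hpow, h1]
    unfold binomSum
    refine sum_congr rfl fun x _ => ?_
    congr 1
    ring
  have hnorm : (#H : ℝ) * ‖binomSum k 1 l‖ = ‖∑ x : ZMod p, E (x + l * x ^ k)‖ := by
    rw [← hsum, norm_mul, Complex.norm_natCast]
  rw [hnorm]
  have hle : ∀ y, ‖E y‖ ≤ #H := fun y => by
    refine (norm_sum_le _ _).trans ?_
    simp
  calc ‖∑ x : ZMod p, E (x + l * x ^ k)‖ ≤ ∑ x : ZMod p, ‖E (x + l * x ^ k)‖ := norm_sum_le _ _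
    _ ≤ ∑ x : ZMod p, ((if x ∈ Z then (#H : ℝ) else 0) + √p) := by
        refine sum_le_sum fun x _ => ?_
        split_ifs with hx
        · linarith [hle (x + l * x ^ k), Real.sqrt_nonneg p]
        · rw [zero_add]
          exact hEb _ (by simpa [hZ] using hx)
    _ = #Z * #H + p * √p := by
        rw [sum_add_distrib]
        simp [ZMod.card]
    _ ≤ _ := by
        gcongr
        exact_mod_cast hZcard

/-- Quadratic amplification along the `(k + 1)`-torsion. -/
theorem card_mul_norm_binomSum_sq_le {p : ℕ} [Fact p.Prime] {k : ℕ}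
    (hφ : Function.Bijective fun x : ZMod p => x ^ k) {l : ZMod p}
    (hl : l ≠ 0) (H : Finset (ZMod p)) (hH : ∀ x ∈ H, x ≠ 0 ∧ x ^ (k + 1) = 1) :
    (#H : ℝ) * ‖binomSum k 1 l‖ ^ 2 ≤ (p : ℝ) ^ 2 + p * √(2 * p ^ 3) := by
  rcases H.eq_empty_or_nonempty with rfl | hne
  · simp; positivity
  have hpos : (0 : ℝ) < #H := by exact_mod_cast hne.card_pos
  have hinv : ∀ h ∈ H, h ^ k = h⁻¹ := fun h hh => by
    obtain ⟨h0, h1⟩ := hH h hh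
    rw [pow_succ] at h1
    exact eq_inv_of_mul_eq_one_left h1
  set E : ZMod p → ℂ := fun x => ∑ h ∈ H, ZMod.stdAddChar (h * x + l * h⁻¹ * x ^ k) with hE
  have hsum : (#H : ℂ) * binomSum k 1 l = ∑ x : ZMod p, E x := by
    rw [hE, sum_comm, ← nsmul_eq_mul, ← sum_const]
    refine sum_congr rfl fun h hh => ?_
    rw [← binomSum_scale k 1 l (hH h hh).1, hinv h hh]
    unfold binomSum
    refine sum_congr rfl fun x _ => ?_
    congr 1
    ring
  have hnorm : (#H : ℝ) * ‖binomSum k 1 l‖ = ‖∑ x : ZMod p, E x‖ := by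
    rw [← hsum, norm_mul, Complex.norm_natCast]
  have hcs : ((#H : ℝ) * ‖binomSum k 1 l‖) ^ 2 ≤ p * ∑ x : ZMod p, ‖E x‖ ^ 2 := by
    rw [hnorm]
    calc ‖∑ x : ZMod p, E x‖ ^ 2 ≤ (∑ x : ZMod p, ‖E x‖) ^ 2 := by
          gcongr; exact norm_sum_le _ _
      _ ≤ _ := by
          have := sq_sum_le_card_mul_sum_sq (s := (univ : Finset (ZMod p))) (f := fun x => ‖E x‖)
          simpa [ZMod.card] using this
  have hexp : ((∑ x : ZMod p, ‖E x‖ ^ 2 : ℝ) : ℂ) =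
      ∑ q ∈ H ×ˢ H, binomSum k (q.1 - q.2) (l * (q.1⁻¹ - q.2⁻¹)) := by
    push_cast
    simp_rw [← Complex.mul_conj', hE, map_sum, sum_mul_sum]
    rw [sum_congr rfl fun x _ => (sum_product' H H _).symm, sum_comm]
    refine sum_congr rfl fun q _ => ?_
    unfold binomSum
    refine sum_congr rfl fun x _ => ?_
    rw [← AddChar.map_neg_eq_conj, ← AddChar.map_add_eq_mul]
    congr 1
    ring
  have hexp' : ∑ x : ZMod p, ‖E x‖ ^ 2 ≤
      ∑ q ∈ H ×ˢ H, ‖binomSum k (q.1 - q.2) (l * (q.1⁻¹ - q.2⁻¹))‖ := by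
    calc ∑ x : ZMod p, ‖E x‖ ^ 2 = ‖((∑ x : ZMod p, ‖E x‖ ^ 2 : ℝ) : ℂ)‖ := by
          rw [Complex.norm_real, Real.norm_of_nonneg (by positivity)]
      _ ≤ _ := by rw [hexp]; exact norm_sum_le _ _
  set P := (H ×ˢ H).filter fun q => q.1 ≠ q.2 with hP
  set r : ZMod p × ZMod p → ZMod p × ZMod p :=
    fun q => (q.1 - q.2, ((q.1 - q.2)⁻¹) ^ k * (l * (q.1⁻¹ - q.2⁻¹))) with hr
  have hoff : ∀ q ∈ P, ‖binomSum k (q.1 - q.2) (l * (q.1⁻¹ - q.2⁻¹))‖ =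
      ‖binomSum k 1 (r q).2‖ := by
    intro q hq
    have h0 : q.1 - q.2 ≠ 0 := sub_ne_zero.2 (mem_filter.1 hq).2
    rw [← binomSum_scale k _ (l * _) (inv_ne_zero h0), inv_mul_cancel₀ h0]
  have hfib : ∀ y, #{q ∈ P | r q = y} ≤ 2 := by
    intro y
    rcases ({q ∈ P | r q = y}).eq_empty_or_nonempty with h | ⟨q₁, hq₁⟩
    · simp [h]
    · have hsub : {q ∈ P | r q = y} ⊆ {q₁, (-q₁.2, -q₁.1)} := by
        intro q hq
        simp only [hP, hr, mem_filter, mem_product] at hq hq₁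
        obtain ⟨⟨⟨ha, hb⟩, hab⟩, rfl⟩ := hq
        obtain ⟨⟨⟨ha₁, hb₁⟩, hab₁⟩, h⟩ := hq₁
        have ha0 := (hH _ ha).1
        have hb0 := (hH _ hb).1
        have ha10 := (hH _ ha₁).1
        have hb10 := (hH _ hb₁).1
        rw [Prod.mk.injEq] at h
        obtain ⟨h1, h2⟩ := h
        have hm : q.1 - q.2 ≠ 0 := sub_ne_zero.2 hab
        rw [h1] at h2
        have h3 := mul_left_cancel₀ hl (mul_left_cancel₀ (pow_ne_zero k (inv_ne_zero hm)) h2)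
        have h4 : q.1 * q.2 = q₁.1 * q₁.2 := by
          field_simp at h3
          have h5 : (q.1 - q.2) * (q.1 * q.2) = (q.1 - q.2) * (q₁.1 * q₁.2) := by
            linear_combination -h3 - (q.1 * q.2) * h1
          exact mul_left_cancel₀ hm h5
        have h5 : (q.1 - q₁.1) * (q.1 + q₁.2) = 0 := by
          linear_combination h4 - q.1 * h1
        simp only [mem_insert, mem_singleton]
        rcases mul_eq_zero.1 h5 with h6 | h6
        · left
          ext1
          · linear_combination h6
          · linear_combination h6 + h1
        · right
          ext1
          · simp only; linear_combination h6
          · simp only; linear_combination h6 + h1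
      exact (card_le_card hsub).trans card_le_two
  have hsq : ∑ q ∈ P, ‖binomSum k 1 (r q).2‖ ^ 2 ≤ 2 * (p : ℝ) ^ 3 := by
    rw [← sum_fiberwise_of_maps_to (t := univ) (g := r) (fun _ _ => mem_univ _)]
    calc ∑ y, ∑ q ∈ P with r q = y, ‖binomSum k 1 (r q).2‖ ^ 2
        = ∑ y, (#{q ∈ P | r q = y} : ℝ) * ‖binomSum k 1 y.2‖ ^ 2 := by
          refine sum_congr rfl fun y _ => ?_
          rw [← nsmul_eq_mul, ← sum_const]
          refine sum_congr rfl fun q hq => ?_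
          rw [(mem_filter.1 hq).2]
      _ ≤ ∑ y : ZMod p × ZMod p, 2 * ‖binomSum k 1 y.2‖ ^ 2 := by
          gcongr with y _
          exact_mod_cast hfib y
      _ = _ := by
          rw [← mul_sum, Fintype.sum_prod_type]
          simp only [sum_norm_sq_binomSum hφ, sum_const, card_univ, ZMod.card, nsmul_eq_mul]
          ring
  have hPs : ∑ q ∈ P, ‖binomSum k 1 (r q).2‖ ≤ #H * √(2 * p ^ 3) := by
    apply le_of_sq_le_sq _ (by positivity)
    rw [mul_pow, Real.sq_sqrt (by positivity)]
    calc (∑ q ∈ P, ‖binomSum k 1 (r q).2‖) ^ 2 ≤ _ := sq_sum_le_card_mul_sum_sq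
      _ ≤ (#H : ℝ) ^ 2 * (2 * p ^ 3) := by
        gcongr
        have : #P ≤ #H ^ 2 := by
          rw [sq, ← card_product]; exact card_filter_le _ _
        exact_mod_cast this
  have hdiag : ∑ q ∈ (H ×ˢ H) with ¬ q.1 ≠ q.2, ‖binomSum k (q.1 - q.2) (l * (q.1⁻¹ - q.2⁻¹))‖
      ≤ #H * p := by
    calc _ ≤ ∑ q ∈ (H ×ˢ H) with ¬ q.1 ≠ q.2, (p : ℝ) := by
          refine sum_le_sum fun q _ => ?_
          unfold binomSum
          refine (norm_sum_le _ _).trans ?_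
          simp [ZMod.card]
      _ ≤ _ := by
          rw [sum_const, nsmul_eq_mul]
          gcongr
          refine card_le_card_of_injOn Prod.fst ?_ ?_
          · intro q hq
            simp at hq
            exact hq.1.1
          · intro q hq q' hq' h
            simp at hq hq'
            ext1
            · exact h
            · rw [← hq.2, ← hq'.2]; exact h
  have htot : ∑ x : ZMod p, ‖E x‖ ^ 2 ≤ #H * √(2 * p ^ 3) + #H * p := by
    refine hexp'.trans ?_
    rw [← sum_filter_add_sum_filter_not (H ×ˢ H) (fun q => q.1 ≠ q.2)]
    refine add_le_add ?_ hdiag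
    rw [sum_congr rfl hoff]
    exact hPs
  have hfin := hcs.trans (mul_le_mul_of_nonneg_left htot (Nat.cast_nonneg p))
  apply le_of_mul_le_mul_left _ hpos
  calc _ = ((#H : ℝ) * ‖binomSum k 1 l‖) ^ 2 := by ring
    _ ≤ _ := hfin
    _ = _ := by ring

theorem exists_norm_sum_add_le {p : ℕ} [Fact p.Prime] (k : ℕ) (b c : ZMod p)
    (T : Finset (ZMod p)) :
    ∃ a, ‖∑ s ∈ T, ∑ t ∈ T, (ZMod.stdAddChar (b * (c + s + t) ^ k) : ℂ)‖ ≤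
      #T * ‖binomSum k a b‖ := by
  have hp : 0 < p := (Fact.out : p.Prime).pos
  obtain ⟨a₀, -, ha₀⟩ := exists_max_image (univ : Finset (ZMod p)) (fun a => ‖binomSum k a b‖)
    univ_nonempty
  refine ⟨a₀, ?_⟩
  have hinv : ∀ y : ZMod p, (p : ℂ) * ZMod.stdAddChar (b * y ^ k) =
      ∑ a : ZMod p, binomSum k (-a) b * ZMod.stdAddChar (a * y) := by
    intro y
    unfold binomSum
    simp_rw [sum_mul]
    rw [sum_comm]
    have : ∀ x a : ZMod p, (ZMod.stdAddChar (-a * x + b * x ^ k) : ℂ) *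
        ZMod.stdAddChar (a * y) = ZMod.stdAddChar (b * x ^ k) *
          ZMod.stdAddChar (a * (y - x)) := by
      intro x a
      rw [← AddChar.map_add_eq_mul, ← AddChar.map_add_eq_mul]
      congr 1
      ring
    simp_rw [this, ← mul_sum, AddChar.sum_mulShift _ (ZMod.isPrimitive_stdAddChar p)]
    simp [sub_eq_zero, ZMod.card, mul_comm]
  have hG : (p : ℂ) * ∑ s ∈ T, ∑ t ∈ T, (ZMod.stdAddChar (b * (c + s + t) ^ k) : ℂ) =
      ∑ a : ZMod p, binomSum k (-a) b * ZMod.stdAddChar (a * c) *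
        (∑ s ∈ T, (ZMod.stdAddChar (a * s) : ℂ)) ^ 2 := by
    simp_rw [mul_sum, hinv, sq, sum_mul_sum, mul_sum]
    rw [sum_congr rfl fun s _ => sum_comm, sum_comm]
    refine sum_congr rfl fun a _ => ?_
    refine sum_congr rfl fun s _ => sum_congr rfl fun t _ => ?_
    rw [mul_assoc, mul_add, mul_add, AddChar.map_add_eq_mul, AddChar.map_add_eq_mul]
    ring
  have hpos : (0 : ℝ) < p := by exact_mod_cast hp
  apply le_of_mul_le_mul_left _ hpos
  calc (p : ℝ) * ‖∑ s ∈ T, ∑ t ∈ T, (ZMod.stdAddChar (b * (c + s + t) ^ k) : ℂ)‖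
      = ‖∑ a : ZMod p, binomSum k (-a) b * ZMod.stdAddChar (a * c) *
        (∑ s ∈ T, (ZMod.stdAddChar (a * s) : ℂ)) ^ 2‖ := by
        rw [← hG, norm_mul, Complex.norm_natCast]
    _ ≤ ∑ a : ZMod p, ‖binomSum k a₀ b‖ * ‖∑ s ∈ T, (ZMod.stdAddChar (a * s) : ℂ)‖ ^ 2 := by
        refine (norm_sum_le _ _).trans (sum_le_sum fun a _ => ?_)
        rw [norm_mul, norm_mul, norm_pow, AddChar.norm_apply, mul_one]
        gcongr
        exact ha₀ _ (mem_univ _)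
    _ = p * (#T * ‖binomSum k a₀ b‖) := by
        rw [← mul_sum, parseval_finset]
        ring

theorem re_stdAddChar_mul_exp {p : ℕ} [Fact p.Prime] (s : ℕ) (c : ℝ) :
    (ZMod.stdAddChar (s : ZMod p) * Complex.exp (-(2 * Real.pi * c / p : ℝ) * Complex.I)).re =
      Real.cos (2 * Real.pi * (s - c) / p) := by
  have := ZMod.stdAddChar_coe (N := p) (s : ℤ)
  rw [Int.cast_natCast] at this
  rw [this, ← Complex.exp_add]
  have e : (2 * Real.pi * Complex.I * ((s : ℤ) : ℂ) / p +
      -(2 * Real.pi * c / p : ℝ) * Complex.I : ℂ) =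
      ((2 * Real.pi * (s - c) / p : ℝ) : ℂ) * Complex.I := by
    push_cast
    ring
  rw [e, Complex.exp_ofReal_mul_I_re]

theorem cos_ge_of_abs_le {p x : ℝ} (hp : 0 < p) (hx : 4 * |x| ≤ p) :
    1 - 4 * |x| / p ≤ Real.cos (2 * Real.pi * x / p) := by
  have h1 : |2 * Real.pi * x / p| = 2 * Real.pi * |x| / p := by
    rw [abs_div, abs_mul, abs_mul, abs_of_pos hp, abs_of_pos Real.pi_pos, abs_two]
  rw [← Real.cos_abs, h1]
  have h2 := Real.one_sub_mul_le_cos (x := 2 * Real.pi * |x| / p) (by positivity) (by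
    rw [div_le_iff₀ hp]
    nlinarith [Real.pi_pos])
  refine le_trans (le_of_eq ?_) h2
  have := Real.pi_ne_zero
  field_simp
  ring

/-- A power map sending a residue class modulo `n` into another one has a large Fourier
coefficient. -/
theorem exists_large_binomSum {p : ℕ} [Fact p.Prime] {k n i j : ℕ} {A : ZMod p} (hA : A ≠ 0)
    (hφ : Function.Bijective fun x : ZMod p => x ^ k) (hn : 2 ≤ n) (hnp : 60 * n ≤ p)
    (hi : i < n)
    (h : ∀ x : ℕ, 1 ≤ x → x ≤ p - 1 → x % n = i → (A * (x : ZMod p) ^ k).val % n = j) :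
    ∃ l : ZMod p, l ≠ 0 ∧ (p : ℝ) / (20 * n) ≤ ‖binomSum k 1 l‖ := by
  have hpp : p.Prime := Fact.out
  have hN : (n : ZMod p) ≠ 0 := by
    rw [Ne, ZMod.natCast_eq_zero_iff]
    exact fun hdvd => by have := Nat.le_of_dvd (by omega) hdvd; omega
  obtain ⟨i₀, hi₀, hi₀n, hi₀i⟩ : ∃ i₀, 1 ≤ i₀ ∧ i₀ ≤ n ∧ i₀ % n = i := by
    by_cases hi0 : i = 0
    · exact ⟨n, by omega, le_rfl, by simp [hi0]⟩
    · exact ⟨i, by omega, by omega, Nat.mod_eq_of_lt hi⟩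
  set m := (p - 1) / (2 * n) with hm
  have hmle : 2 * n * m ≤ p - 1 := Nat.mul_div_le _ _
  have hmge : p ≤ 2 * n * m + 2 * n := by
    have := Nat.lt_mul_div_succ (p - 1) (show 0 < 2 * n by omega)
    rw [← hm, mul_add] at this
    omega
  have hbound : ∀ s, s + 2 ≤ 2 * m → 1 ≤ i₀ + n * s ∧ i₀ + n * s ≤ p - 1 := by
    intro s hs
    refine ⟨by omega, ?_⟩
    have : n * (s + 2) ≤ n * (2 * m) := Nat.mul_le_mul_left _ hs
    nlinarith
  set f : ℕ → ℕ := fun s => (A * ((i₀ + n * s : ℕ) : ZMod p) ^ k).val with hf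
  have hfj : ∀ s, s + 2 ≤ 2 * m → f s = j + n * (f s / n) := by
    intro s hs
    have h1 := h (i₀ + n * s) (hbound s hs).1 (hbound s hs).2 (by simp [hi₀i])
    have h2 := Nat.mod_add_div (f s) n
    rw [show f s % n = j from h1] at h2
    exact h2.symm
  have hfp : ∀ s, f s < p := fun s => ZMod.val_lt _
  have hfinj : ∀ s t, s + 2 ≤ 2 * m → t + 2 ≤ 2 * m → f s / n = f t / n → s = t := by
    intro s t hs ht hst
    have h1 : f s = f t := by rw [hfj s hs, hfj t ht, hst]
    have h2 := hφ.1 (mul_left_cancel₀ hA (ZMod.val_injective p h1))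
    rw [ZMod.natCast_eq_natCast_iff'] at h2
    rw [Nat.mod_eq_of_lt (by have := (hbound s hs).2; omega),
      Nat.mod_eq_of_lt (by have := (hbound t ht).2; omega)] at h2
    have : n * s = n * t := by omega
    exact Nat.eq_of_mul_eq_mul_left (by omega) this
  have hpR : (0 : ℝ) < p := by exact_mod_cast hpp.pos
  have hnR : (2 : ℝ) ≤ n := by exact_mod_cast hn
  set c : ℝ := p / (2 * n) with hc
  have hcn : c * (2 * n) = p := by rw [hc]; field_simp
  have hσ : ∀ s, ((f s / n : ℕ) : ℝ) * n ≤ p := fun s => by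
    have h1 := Nat.div_mul_le_self (f s) n
    have h2 := hfp s
    exact_mod_cast h1.trans h2.le
  have habs : ∀ s, |((f s / n : ℕ) : ℝ) - c| ≤ c := fun s => by
    rw [abs_le]
    constructor
    · have : (0 : ℝ) ≤ ((f s / n : ℕ) : ℝ) := Nat.cast_nonneg _
      linarith
    · have := hσ s
      nlinarith
  have hc4 : 4 * c ≤ p := by
    rw [← hcn]
    have : 0 ≤ c := by positivity
    nlinarith
  set B := (range (2 * m - 1)).filter fun s => 3 * (p : ℝ) < 16 * |((f s / n : ℕ) : ℝ) - c|
    with hB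
  have hcos : ∀ s, s + 2 ≤ 2 * m → s ∉ B →
      1 / 4 ≤ Real.cos (2 * Real.pi * (((f s / n : ℕ) : ℝ) - c) / p) := by
    intro s hs hsB
    refine le_trans ?_ (cos_ge_of_abs_le hpR (by linarith [habs s]))
    have h1 : ¬ 3 * (p : ℝ) < 16 * |((f s / n : ℕ) : ℝ) - c| := fun h1 =>
      hsB (mem_filter.2 ⟨mem_range.2 (by omega), h1⟩)
    rw [le_sub_comm, div_le_iff₀ hpR]
    linarith
  have hcos0 : ∀ s, 0 ≤ Real.cos (2 * Real.pi * (((f s / n : ℕ) : ℝ) - c) / p) := by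
    intro s
    refine le_trans ?_ (cos_ge_of_abs_le hpR (by linarith [habs s]))
    rw [sub_nonneg, div_le_iff₀ hpR]
    linarith [habs s]
  have hBcard : (#B : ℝ) ≤ c / 2 + 2 := by
    rcases hn.eq_or_lt with rfl | hn3
    · have hcp : c = p / 4 := by rw [hc]; norm_num
      have hmaps : ∀ s ∈ B, f s / 2 ∈ range (p / 16 + 1) ∪ Ioc (7 * p / 16) (p / 2) := by
        intro s hs
        have h1 := (mem_filter.1 hs).2
        have h2 := hfp s
        rw [hcp] at h1
        rw [mem_union, mem_range, mem_Ioc]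
        rcases lt_or_ge ((f s / 2 : ℕ) : ℝ) (p / 4) with h3 | h3
        · rw [abs_of_neg (by linarith)] at h1
          have h4 : (16 * (f s / 2) : ℕ) < (p : ℝ) := by push_cast; linarith
          have h5 : 16 * (f s / 2) < p := by exact_mod_cast h4
          omega
        · rw [abs_of_nonneg (by linarith)] at h1
          have h4 : ((7 * p : ℕ) : ℝ) < (16 * (f s / 2) : ℕ) := by push_cast; linarith
          have h5 : 7 * p < 16 * (f s / 2) := by exact_mod_cast h4
          omega
      have h1 : #B ≤ #(range (p / 16 + 1) ∪ Ioc (7 * p / 16) (p / 2)) := by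
        refine card_le_card_of_injOn (fun s => f s / 2) hmaps fun s hs t ht hst => ?_
        have hs' := mem_range.1 (mem_filter.1 (mem_coe.1 hs)).1
        have ht' := mem_range.1 (mem_filter.1 (mem_coe.1 ht)).1
        exact hfinj s t (by omega) (by omega) hst
      have h2 := h1.trans (card_union_le _ _)
      rw [card_range, Nat.card_Ioc] at h2
      have h3 : 8 * #B ≤ p + 16 := by omega
      have h4 : (8 * #B : ℝ) ≤ p + 16 := by exact_mod_cast h3
      rw [hcp]
      linarith
    · have hBe : B = ∅ := by
        rw [hB, filter_eq_empty_iff]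
        intro s _ h1
        have h2 := habs s
        have hn3R : (3 : ℝ) ≤ n := by exact_mod_cast hn3
        have hc0 : 0 ≤ c := by positivity
        nlinarith
      rw [hBe, card_empty]
      have : 0 ≤ c := by positivity
      push_cast
      linarith
  have hGlow : (m : ℝ) * (m - #B) / 4 ≤
      ∑ s ∈ range m, ∑ t ∈ range m,
        Real.cos (2 * Real.pi * (((f (s + t) / n : ℕ) : ℝ) - c) / p) := by
    have h1 : ∀ s ∈ range m, ((m : ℝ) - #B) / 4 ≤ ∑ t ∈ range m,
        Real.cos (2 * Real.pi * (((f (s + t) / n : ℕ) : ℝ) - c) / p) := by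
      intro s hs
      rw [mem_range] at hs
      have h2 : ((m : ℝ) - #B) ≤ #{t ∈ range m | s + t ∉ B} := by
        have h3 : #{t ∈ range m | s + t ∈ B} ≤ #B :=
          card_le_card_of_injOn (fun t => s + t) (fun t ht => (mem_filter.1 ht).2)
            (fun t _ t' _ htt => by simpa using htt)
        have h4 := card_filter_add_card_filter_not (s := range m) (fun t => s + t ∈ B)
        rw [card_range] at h4
        have : m ≤ #{t ∈ range m | s + t ∉ B} + #B := by omega
        have : (m : ℝ) ≤ #{t ∈ range m | s + t ∉ B} + #B := by exact_mod_cast this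
        linarith
      calc ((m : ℝ) - #B) / 4 ≤ ∑ t ∈ range m with s + t ∉ B, (1 / 4 : ℝ) := by
            rw [sum_const, nsmul_eq_mul]; linarith
        _ ≤ ∑ t ∈ range m with s + t ∉ B,
              Real.cos (2 * Real.pi * (((f (s + t) / n : ℕ) : ℝ) - c) / p) := by
            refine sum_le_sum fun t ht => ?_
            rw [mem_filter, mem_range] at ht
            exact hcos _ (by omega) ht.2
        _ ≤ _ := sum_le_sum_of_subset_of_nonneg (filter_subset _ _) fun t _ _ => hcos0 _
    calc (m : ℝ) * (m - #B) / 4 = ∑ s ∈ range m, ((m : ℝ) - #B) / 4 := by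
          rw [sum_const, nsmul_eq_mul, card_range]; ring
      _ ≤ _ := sum_le_sum h1
  set T : Finset (ZMod p) := (range m).image fun s : ℕ => ((n * s : ℕ) : ZMod p) with hT
  have hTinj : Set.InjOn (fun s : ℕ => ((n * s : ℕ) : ZMod p)) (range m) := by
    intro s hs t ht hst
    simp only [coe_range, Set.mem_Iio] at hs ht
    simp only [ZMod.natCast_eq_natCast_iff'] at hst
    have hlt : ∀ s < m, n * s < p := fun s hs => by
      have := Nat.mul_le_mul_left n hs.le
      have : 2 * n * m = 2 * (n * m) := by ring
      have := hpp.pos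
      omega
    rw [Nat.mod_eq_of_lt (hlt s hs), Nat.mod_eq_of_lt (hlt t ht)] at hst
    exact Nat.eq_of_mul_eq_mul_left (by omega) hst
  have hTcard : #T = m := by rw [hT, card_image_of_injOn hTinj, card_range]
  obtain ⟨a, ha⟩ := exists_norm_sum_add_le k ((n : ZMod p)⁻¹ * A) (i₀ : ZMod p) T
  rw [hTcard] at ha
  have hG : ∑ s ∈ T, ∑ t ∈ T,
      (ZMod.stdAddChar ((n : ZMod p)⁻¹ * A * ((i₀ : ZMod p) + s + t) ^ k) : ℂ) =
      ZMod.stdAddChar ((n : ZMod p)⁻¹ * (j : ZMod p)) * ∑ s ∈ range m, ∑ t ∈ range m,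
        (ZMod.stdAddChar ((f (s + t) / n : ℕ) : ZMod p) : ℂ) := by
    rw [hT, sum_image hTinj, mul_sum]
    refine sum_congr rfl fun s hs => ?_
    rw [sum_image hTinj, mul_sum]
    refine sum_congr rfl fun t ht => ?_
    rw [mem_range] at hs ht
    rw [← AddChar.map_add_eq_mul]
    congr 1
    have h1 : A * ((i₀ : ZMod p) + ((n * s : ℕ) : ZMod p) + ((n * t : ℕ) : ZMod p)) ^ k = (f (s + t) : ZMod p) := by
      rw [hf]
      simp only [ZMod.natCast_val, ZMod.cast_id', id]
      push_cast
      ring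
    rw [mul_assoc, h1, hfj (s + t) (by omega)]
    have h2 : (j + n * (f (s + t) / n)) / n = f (s + t) / n := by rw [← hfj (s + t) (by omega)]
    rw [h2]
    push_cast
    field_simp
  have hnorm : (m : ℝ) * (m - #B) / 4 ≤ m * ‖binomSum k a ((n : ZMod p)⁻¹ * A)‖ := by
    refine le_trans ?_ ha
    rw [hG, norm_mul, AddChar.norm_apply, one_mul]
    set G := ∑ s ∈ range m, ∑ t ∈ range m,
        (ZMod.stdAddChar ((f (s + t) / n : ℕ) : ZMod p) : ℂ) with hGdef
    have h1 : ‖G‖ = ‖G * Complex.exp (-(2 * Real.pi * c / p : ℝ) * Complex.I)‖ := by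
      rw [norm_mul, ← Complex.ofReal_neg, Complex.norm_exp_ofReal_mul_I, mul_one]
    rw [h1]
    refine le_trans ?_ (Complex.re_le_norm _)
    rw [hGdef]
    simp_rw [sum_mul, Complex.re_sum, re_stdAddChar_mul_exp]
    exact hGlow
  have hmR : c ≤ m + 1 := by
    have : (p : ℝ) ≤ 2 * n * m + 2 * n := by exact_mod_cast hmge
    rw [hc, div_le_iff₀ (by positivity)]
    linarith
  have hc30 : 30 ≤ c := by
    have : (60 * n : ℝ) ≤ p := by exact_mod_cast hnp
    rw [hc, le_div_iff₀ (by positivity)]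
    linarith
  have hmpos : (0 : ℝ) < m := by linarith
  have hlarge : (p : ℝ) / (20 * n) ≤ ‖binomSum k a ((n : ZMod p)⁻¹ * A)‖ := by
    have h1 : ((m : ℝ) - #B) / 4 ≤ ‖binomSum k a ((n : ZMod p)⁻¹ * A)‖ := by
      apply le_of_mul_le_mul_left _ hmpos
      linarith
    have h2 : (p : ℝ) / (20 * n) = c / 10 := by rw [hc]; field_simp; norm_num
    rw [h2]
    linarith
  have hb : (n : ZMod p)⁻¹ * A ≠ 0 := mul_ne_zero (inv_ne_zero hN) hA
  have ha0 : a ≠ 0 := by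
    rintro rfl
    rw [binomSum_zero_left hφ hb, norm_zero] at hlarge
    have : (0 : ℝ) < p / (20 * n) := by positivity
    linarith
  refine ⟨a⁻¹ ^ k * ((n : ZMod p)⁻¹ * A), mul_ne_zero (pow_ne_zero _ (inv_ne_zero ha0)) hb, ?_⟩
  have := binomSum_scale k a ((n : ZMod p)⁻¹ * A) (inv_ne_zero ha0)
  rw [inv_mul_cancel₀ ha0] at this
  rwa [this]

theorem card_filter_div_mul_ne_le (L M c : ℕ) (hL : 0 < L) :
    #{q ∈ range (M * c) | L * (q / L) / M ≠ q / M} ≤ c * L := by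
  rcases M.eq_zero_or_pos with rfl | hM
  · simp
  have h : #{q ∈ range (M * c) | L * (q / L) / M ≠ q / M} ≤ #(range c ×ˢ range L) := by
    refine card_le_card_of_injOn (fun q => (q / M, q % L)) ?_ ?_
    · intro q hq
      have h1 := mem_range.1 (mem_filter.1 hq).1
      simp only [coe_product, coe_range, Set.mem_prod, Set.mem_Iio]
      exact ⟨Nat.div_lt_of_lt_mul h1, Nat.mod_lt _ hL⟩
    · have key : ∀ q, L * (q / L) / M ≠ q / M → q / L = M * (q / M) / L := by
        intro q hq
        have h1 : L * (q / L) ≤ q := Nat.mul_div_le _ _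
        have h2 : L * (q / L) / M < q / M := lt_of_le_of_ne (Nat.div_le_div_right h1) hq
        have h3 : L * (q / L) < M * (q / M) := by
          rw [Nat.div_lt_iff_lt_mul hM] at h2
          rwa [mul_comm M]
        have h4 : M * (q / M) ≤ q := Nat.mul_div_le _ _
        apply le_antisymm
        · rw [Nat.le_div_iff_mul_le hL, mul_comm]
          exact h3.le
        · exact Nat.div_le_div_right h4
      intro q hq q' hq' h
      have hq₁ := key q (mem_filter.1 hq).2
      have hq₂ := key q' (mem_filter.1 hq').2
      rw [Prod.mk.injEq] at h
      rw [← Nat.div_add_mod q L, ← Nat.div_add_mod q' L, hq₁, hq₂, h.1, h.2]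
  simpa using h

theorem card_filter_range_mul_div (a b : ℕ) (hb : 0 < b) (P : ℕ → Prop) [DecidablePred P] :
    #{q ∈ range (a * b) | P (q / b)} = b * #{z ∈ range a | P z} := by
  have h : #{q ∈ range (a * b) | P (q / b)} = #({z ∈ range a | P z} ×ˢ range b) := by
    symm
    refine card_bij' (fun x _ => x.1 * b + x.2) (fun q _ => (q / b, q % b)) ?_ ?_ ?_ ?_
    all_goals simp only [mem_product, mem_filter, mem_range]
    · rintro ⟨z, r⟩ ⟨⟨hz, hP⟩, hr⟩
      simp only at hz hP hr ⊢
      have : (z * b + r) / b = z := by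
        rw [mul_comm, Nat.mul_add_div hb, Nat.div_eq_of_lt hr, add_zero]
      rw [this]
      refine ⟨?_, hP⟩
      calc z * b + r < z * b + b := by omega
        _ = (z + 1) * b := by ring
        _ ≤ _ := Nat.mul_le_mul_right _ hz
    · rintro q ⟨hq, hP⟩
      exact ⟨⟨Nat.div_lt_of_lt_mul (by rwa [mul_comm]), hP⟩, Nat.mod_lt _ hb⟩
    · rintro ⟨z, r⟩ ⟨⟨hz, hP⟩, hr⟩
      simp only at hz hP hr ⊢
      rw [mul_comm, Nat.mul_add_div hb, Nat.div_eq_of_lt hr, Nat.mul_add_mod, Nat.mod_eq_of_lt hr]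
      simp
    · intro q _
      rw [mul_comm]
      exact Nat.div_add_mod q b
  rw [h, card_product, card_range, mul_comm]

/-- Comparison of a count over `z < p` of a condition on `⌊n v z / p⌋` and `⌊n w z / p⌋` with the
corresponding complete count. -/
theorem abs_card_floor_sub_le (p n v w : ℕ) (hp : 0 < p) (hn : 0 < n) (hv : 0 < v) (hw : 0 < w)
    (P R : ℕ → Prop) [DecidablePred P] [DecidablePred R] :
    |((n * v * w : ℕ) : ℤ) * #{z ∈ range p | P (n * v * z / p) ∧ R (n * w * z / p)} -
      p * #{s ∈ range (n * v * w) | P (s / w) ∧ R (s / v)}| ≤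
      ((n * v * w * (n * (v + w)) : ℕ) : ℤ) := by
  set L := n * v * w with hLdef
  have hL : 0 < L := by positivity
  have e1 := card_filter_range_mul_div p L hL
    (fun z => P (n * v * z / p) ∧ R (n * w * z / p))
  have e2 := card_filter_range_mul_div L p hp (fun s => P (s / w) ∧ R (s / v))
  have b1 := card_filter_div_mul_ne_le L (p * w) (n * v) hL
  have b2 := card_filter_div_mul_ne_le L (p * v) (n * w) hL
  rw [show p * w * (n * v) = p * L by rw [hLdef]; ring] at b1
  rw [show p * v * (n * w) = p * L by rw [hLdef]; ring] at b2
  rw [mul_comm L p] at e2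
  have c1 : ∀ q, L * (q / L) / (p * w) = n * v * (q / L) / p := by
    intro q
    rw [show L * (q / L) = n * v * (q / L) * w by rw [hLdef]; ring, 
      Nat.mul_div_mul_right _ _ hw]
  have c2 : ∀ q, L * (q / L) / (p * v) = n * w * (q / L) / p := by
    intro q
    rw [show L * (q / L) = n * w * (q / L) * v by rw [hLdef]; ring, 
      Nat.mul_div_mul_right _ _ hv]
  simp_rw [c1, ← Nat.div_div_eq_div_mul] at b1
  simp_rw [c2, ← Nat.div_div_eq_div_mul] at b2
  set X1 := {q ∈ range (p * L) | P (n * v * (q / L) / p) ∧ R (n * w * (q / L) / p)} with hX1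
  set X2 := {q ∈ range (p * L) | P (q / p / w) ∧ R (q / p / v)} with hX2
  set Y1 := {q ∈ range (p * L) | n * v * (q / L) / p ≠ q / p / w} with hY1
  set Y2 := {q ∈ range (p * L) | n * w * (q / L) / p ≠ q / p / v} with hY2
  have s1 : X1 ⊆ X2 ∪ (Y1 ∪ Y2) := by
    intro q hq
    simp only [hX1, hX2, hY1, hY2, mem_union, mem_filter] at hq ⊢
    by_cases h1 : n * v * (q / L) / p = q / p / w
    · by_cases h2 : n * w * (q / L) / p = q / p / v
      · left; rw [← h1, ← h2]; exact hq
      · right; right; exact ⟨hq.1, h2⟩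
    · right; left; exact ⟨hq.1, h1⟩
  have s2 : X2 ⊆ X1 ∪ (Y1 ∪ Y2) := by
    intro q hq
    simp only [hX1, hX2, hY1, hY2, mem_union, mem_filter] at hq ⊢
    by_cases h1 : n * v * (q / L) / p = q / p / w
    · by_cases h2 : n * w * (q / L) / p = q / p / v
      · left; rw [h1, h2]; exact hq
      · right; right; exact ⟨hq.1, h2⟩
    · right; left; exact ⟨hq.1, h1⟩
  have t1 := (card_le_card s1).trans (card_union_le _ _)
  have t2 := (card_le_card s2).trans (card_union_le _ _)
  have t3 := card_union_le Y1 Y2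
  have t4 : n * v * L + n * w * L = L * (n * (v + w)) := by ring
  rw [e1] at t1 t2
  rw [e2] at t1 t2
  rw [abs_le]
  zify at t1 t2 t3 t4 b1 b2
  push_cast
  constructor <;> linarith

theorem card_filter_range_modEq (n w c : ℕ) (hn : 0 < n) :
    #{r ∈ range w | r ≡ c [MOD n]} = w / n + if c % n < w % n then 1 else 0 := by
  rw [← Nat.count_eq_card_filter_range]
  exact Nat.count_modEq_card w hn c

/-- The count `#{s < n v w : ⌊s / w⌋ ≡ a, ⌊s / v⌋ ≡ b (mod n)}` is `v w / n` up to an error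
at most `n`. -/
theorem abs_card_complete_sub_le (n v w a b : ℕ) (hn : 0 < n) (hv : 0 < v) (hw : 0 < w)
    (hvw : v.Coprime w) (ha : a < n) (hb : b < n) :
    |(n : ℤ) * #{s ∈ range (n * v * w) | s / w % n = a ∧ s / v % n = b} - v * w| ≤ n ^ 2 := by
  have hmodw : ∀ s, s % (n * w) = w * (s / w % n) + s % w := fun s => by
    rw [mul_comm n w, Nat.mod_mul, add_comm]
  have hmodv : ∀ s, s % (n * v) = v * (s / v % n) + s % v := fun s => by
    rw [mul_comm n v, Nat.mod_mul, add_comm]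
  have hlcm : Nat.lcm (n * v) (n * w) = n * v * w := by
    rw [Nat.lcm_mul_left, hvw.lcm_eq_mul, mul_assoc]
  have hgcd : Nat.gcd (n * v) (n * w) = n := by
    rw [Nat.gcd_mul_left, hvw.gcd_eq_one, mul_one]
  have hcard : #{s ∈ range (n * v * w) | s / w % n = a ∧ s / v % n = b} =
      #{x ∈ range v ×ˢ range w | v * b + x.1 ≡ w * a + x.2 [MOD n]} := by
    refine card_bij (fun s _ => (s % v, s % w)) ?_ ?_ ?_
    · intro s hs
      obtain ⟨hs, h1, h2⟩ := mem_filter.1 hs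
      simp only [mem_filter, mem_product, mem_range]
      refine ⟨⟨Nat.mod_lt _ hv, Nat.mod_lt _ hw⟩, ?_⟩
      rw [← h1, ← h2, ← hmodw, ← hmodv]
      exact ((Nat.mod_modEq s (n * v)).of_mul_right v).trans
        ((Nat.mod_modEq s (n * w)).of_mul_right w).symm
    · intro s hs t ht hst
      obtain ⟨hs, h1, h2⟩ := mem_filter.1 hs
      obtain ⟨ht, h3, h4⟩ := mem_filter.1 ht
      rw [Prod.mk.injEq] at hst
      have e1 : s ≡ t [MOD n * v] := by
        rw [Nat.ModEq, hmodv, hmodv, h2, h4, hst.1]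
      have e2 : s ≡ t [MOD n * w] := by
        rw [Nat.ModEq, hmodw, hmodw, h1, h3, hst.2]
      have e3 : s ≡ t [MOD n * v * w] := by
        rw [← hlcm]
        rw [← Int.natCast_modEq_iff, Int.modEq_iff_dvd] at e1 e2 ⊢
        exact_mod_cast Int.coe_lcm_dvd e1 e2
      exact e3.eq_of_lt_of_lt (mem_range.1 hs) (mem_range.1 ht)
    · rintro ⟨x, y⟩ hxy
      simp only [mem_filter, mem_product, mem_range] at hxy
      obtain ⟨⟨hx, hy⟩, hxy⟩ := hxy
      have hxy' : v * b + x ≡ w * a + y [MOD Nat.gcd (n * v) (n * w)] := by rwa [hgcd]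
      obtain ⟨s, hs1, hs2⟩ := Nat.chineseRemainder' hxy'
      have key : ∀ u z c, 0 < u → z < u → c < n → ∀ s, s ≡ u * c + z [MOD n * u] →
          s % u = z ∧ s / u % n = c := by
        intro u z c hu hz hc s hs
        have h1 : s % (n * u) = u * c + z := by
          rw [hs]
          apply Nat.mod_eq_of_lt
          calc u * c + z < u * c + u := by omega
            _ = u * (c + 1) := by ring
            _ ≤ u * n := Nat.mul_le_mul_left _ hc
            _ = n * u := mul_comm _ _
        constructor
        · rw [← Nat.mod_mul_left_mod s n u, h1, Nat.mul_add_mod, Nat.mod_eq_of_lt hz]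
        · rw [← Nat.mod_mul_right_div_self, mul_comm u n, h1, Nat.mul_add_div hu,
            Nat.div_eq_of_lt hz, add_zero]
      have hL : 0 < n * v * w := by positivity
      have hm : s % (n * v * w) ≡ s [MOD n * v * w] := Nat.mod_modEq _ _
      have k1 := key v x b hv hx hb _ ((hm.of_mul_right w).trans hs1)
      have k2 := key w y a hw hy ha _
        ((hm.of_dvd ⟨v, by ring⟩).trans hs2)
      exact ⟨s % (n * v * w), mem_filter.2 ⟨mem_range.2 (Nat.mod_lt _ hL), k2.2, k1.2⟩,
        Prod.ext k1.1 k2.1⟩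
  set g := v * b + (n - 1) * (w * a) with hg
  have hcond : ∀ x y, v * b + x ≡ w * a + y [MOD n] ↔ y ≡ x + g [MOD n] := by
    intro x y
    have h1 : w * a + (x + g) = v * b + x + n * (w * a) := by
      obtain ⟨m, rfl⟩ : ∃ m, n = m + 1 := ⟨n - 1, by omega⟩
      rw [hg, Nat.add_sub_cancel]
      ring
    have h2 : w * a + (x + g) ≡ v * b + x [MOD n] := by
      rw [h1]
      simp [Nat.ModEq]
    constructor
    · intro h
      exact Nat.ModEq.add_left_cancel' (w * a) (h.symm.trans h2.symm)
    · intro h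
      exact h2.symm.trans (h.symm.add_left _)
  have hsum : #{x ∈ range v ×ˢ range w | v * b + x.1 ≡ w * a + x.2 [MOD n]} =
      v * (w / n) + #{x ∈ range v | (x + g) % n < w % n} := by
    rw [card_filter, sum_product]
    simp_rw [hcond, ← card_filter, card_filter_range_modEq n w _ hn]
    rw [sum_add_distrib, sum_const, card_range, smul_eq_mul, ← card_filter]
  have hE : #{x ∈ range v | (x + g) % n < w % n} =
      ∑ u ∈ range (w % n), #{x ∈ range v | x ≡ u + (n - 1) * g [MOD n]} := by
    rw [card_eq_sum_card_fiberwise (f := fun x => (x + g) % n) (t := range (w % n))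
      (fun x hx => by simpa using (mem_filter.1 hx).2)]
    refine sum_congr rfl fun u hu => ?_
    rw [filter_filter]
    congr 1
    refine filter_congr fun x _ => ?_
    have hu' : u < w % n := mem_range.1 hu
    have hun : u % n = u := Nat.mod_eq_of_lt (hu'.trans (Nat.mod_lt _ hn))
    have h3 : x + g + (n - 1) * g ≡ x [MOD n] := by
      obtain ⟨m, rfl⟩ : ∃ m, n = m + 1 := ⟨n - 1, by omega⟩
      rw [Nat.add_sub_cancel, show x + g + m * g = x + (m + 1) * g by ring]
      simp [Nat.ModEq]
    constructor
    · rintro ⟨-, h⟩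
      have : x + g ≡ u [MOD n] := by rw [Nat.ModEq, h, hun]
      exact h3.symm.trans (this.add_right _)
    · intro h
      have : x + g ≡ u [MOD n] := Nat.ModEq.add_right_cancel' ((n - 1) * g) (h3.trans h)
      rw [Nat.ModEq, hun] at this
      exact ⟨by rwa [this], this⟩
  set E := #{x ∈ range v | (x + g) % n < w % n} with hEdef
  have hE1 : w % n * (v / n) ≤ E := by
    rw [hE]
    refine le_trans (le_of_eq ?_) (card_nsmul_le_sum _ _ (v / n) fun u _ => ?_)
    · simp
    · rw [card_filter_range_modEq n v _ hn]; omega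
  have hE2 : E ≤ w % n * (v / n + 1) := by
    rw [hE]
    refine le_trans (sum_le_card_nsmul _ _ (v / n + 1) fun u _ => ?_) (le_of_eq ?_)
    · rw [card_filter_range_modEq n v _ hn]; split_ifs <;> omega
    · simp
  rw [hcard, hsum]
  have dw := Nat.div_add_mod w n
  have dv := Nat.div_add_mod v n
  have mw := Nat.mod_lt w hn
  have mv := Nat.mod_lt v hn
  generalize w % n = w₀ at *
  generalize v % n = v₀ at *
  generalize w / n = w₁ at *
  generalize v / n = v₁ at *
  have hid : (n : ℤ) * ((v * w₁ + E : ℕ) : ℤ) - v * w = n * E - w₀ * (n * v₁ + v₀) := by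
    rw [← dw]
    nth_rewrite 2 [← dv]
    nth_rewrite 1 [← dv]
    push_cast
    ring
  rw [hid, abs_le]
  have hnw : n * w₀ ≤ n * n := Nat.mul_le_mul_left _ mw.le
  have hvv : w₀ * v₀ ≤ n * n := Nat.mul_le_mul mw.le mv.le
  have i1 := Nat.mul_le_mul_left n hE1
  have i2 := Nat.mul_le_mul_left n hE2
  zify at hnw hvv i1 i2
  have hwv : (0 : ℤ) ≤ w₀ * v₀ := by positivity
  constructor <;> nlinarith

theorem exists_mod_mod_iff_div_mod {n p j : ℕ} (hn : 0 < n) (hpn : p.Coprime n) (hj : j < n) :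
    ∃ l < n, ∀ y, n ∣ y → (y % p % n = j ↔ y / p % n = l) := by
  have : NeZero n := ⟨hn.ne'⟩
  refine ⟨(-(j : ZMod n) * (p : ZMod n)⁻¹).val, ZMod.val_lt _, fun y hy => ?_⟩
  have hu : (p : ZMod n) * (p : ZMod n)⁻¹ = 1 := ZMod.coe_mul_inv_eq_one p hpn
  have h0 : (p : ZMod n) * (y / p : ℕ) + (y % p : ℕ) = 0 := by
    rw [← (ZMod.natCast_eq_zero_iff y n).2 hy]
    exact_mod_cast congrArg (Nat.cast : ℕ → ZMod n) (Nat.div_add_mod y p)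
  have h1 : y % p % n = j ↔ ((y % p : ℕ) : ZMod n) = j := by
    rw [ZMod.natCast_eq_natCast_iff', Nat.mod_eq_of_lt hj]
  have h2 : y / p % n = (-(j : ZMod n) * (p : ZMod n)⁻¹).val ↔
      ((y / p : ℕ) : ZMod n) = -(j : ZMod n) * (p : ZMod n)⁻¹ := by
    rw [← ZMod.val_natCast]
    exact (ZMod.val_injective n).eq_iff
  rw [h1, h2]
  constructor
  · intro h
    rw [h] at h0
    linear_combination (p : ZMod n)⁻¹ * h0 - ((y / p : ℕ) : ZMod n) * hu
  · intro h
    rw [h] at h0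
    linear_combination h0 + (j : ZMod n) * hu

theorem exists_sub_mod_mod_iff_div_mod {n p j : ℕ} (hn : 0 < n) (hp : 0 < p) (hpn : p.Coprime n)
    (hj : j < n) :
    ∃ l < n, ∀ y, n ∣ y → ((p - y % p) % n = j ↔ y / p % n = l) := by
  have : NeZero n := ⟨hn.ne'⟩
  refine ⟨((j : ZMod n) * (p : ZMod n)⁻¹ - 1).val, ZMod.val_lt _, fun y hy => ?_⟩
  have hu : (p : ZMod n) * (p : ZMod n)⁻¹ = 1 := ZMod.coe_mul_inv_eq_one p hpn
  have h0 : (p : ZMod n) * (y / p : ℕ) + (y % p : ℕ) = 0 := by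
    rw [← (ZMod.natCast_eq_zero_iff y n).2 hy]
    exact_mod_cast congrArg (Nat.cast : ℕ → ZMod n) (Nat.div_add_mod y p)
  have hle : y % p ≤ p := (Nat.mod_lt _ hp).le
  have h1 : (p - y % p) % n = j ↔ (p : ZMod n) - ((y % p : ℕ) : ZMod n) = j := by
    rw [← Nat.cast_sub hle, ZMod.natCast_eq_natCast_iff', Nat.mod_eq_of_lt hj]
  have h2 : y / p % n = ((j : ZMod n) * (p : ZMod n)⁻¹ - 1).val ↔
      ((y / p : ℕ) : ZMod n) = (j : ZMod n) * (p : ZMod n)⁻¹ - 1 := by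
    rw [← ZMod.val_natCast]
    exact (ZMod.val_injective n).eq_iff
  rw [h1, h2]
  constructor
  · intro h
    linear_combination (p : ZMod n)⁻¹ * (h0 + h) - (1 + ((y / p : ℕ) : ZMod n)) * hu
  · intro h
    rw [h] at h0
    linear_combination (j : ZMod n) * hu - h0

/-- The number of `x` such that both `x` and `t x` have least positive residue congruent to `j`
modulo `n`. -/
def classCorr (p n j : ℕ) [NeZero p] (t : ZMod p) : ℕ :=
  #{x : ZMod p | (x ≠ 0 ∧ x.val % n = j) ∧ (t * x ≠ 0 ∧ (t * x).val % n = j)}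

theorem classCorr_estimate {p n j v w : ℕ} [Fact p.Prime] (hn : 0 < n) (hnp : n < p) (hj : j < n)
    (hv : 0 < v) (hvp : v < p) (hw : 0 < w) (hwp : w < p) (hvw : v.Coprime w) {t : ZMod p}
    (ht : t * v = w ∨ t * v = -w) :
    ∃ Q : ℤ, |Q| ≤ n ^ 2 ∧ (n : ℤ) ∣ Q + v * w ∧
      |(n ^ 2 * v * w : ℤ) * classCorr p n j t - p * (v * w + Q)| ≤
        n ^ 2 * v * w * (n * (v + w) + 1) := by
  have hpp : p.Prime := Fact.out
  have hcop : p.Coprime n := (hpp.coprime_iff_not_dvd.2 (Nat.not_dvd_of_pos_of_lt hn hnp))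
  have hne : ∀ u, 0 < u → u < p → (u : ZMod p) ≠ 0 := fun u h0 h1 => by
    rw [Ne, ZMod.natCast_eq_zero_iff]
    exact Nat.not_dvd_of_pos_of_lt h0 h1
  have hn0 := hne n hn hnp
  have hv0 := hne v hv hvp
  have hw0 := hne w hw hwp
  have ht0 : t ≠ 0 := by
    rintro rfl
    rw [zero_mul] at ht
    rcases ht with h | h
    · exact hw0 h.symm
    · exact hw0 (neg_eq_zero.1 h.symm)
  obtain ⟨a, ha, hav⟩ := exists_mod_mod_iff_div_mod hn hcop hj
  obtain ⟨b, hb, hbw⟩ : ∃ b < n, ∀ z : ℕ, z ≠ 0 → z < p →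
      ((t * ((n * v * z : ℕ) : ZMod p)).val % n = j ↔ n * w * z / p % n = b) := by
    rcases ht with h | h
    · obtain ⟨b, hb, hbw⟩ := exists_mod_mod_iff_div_mod hn hcop hj
      refine ⟨b, hb, fun z _ _ => ?_⟩
      rw [← hbw _ ⟨w * z, by ring⟩, ← ZMod.val_natCast p (n * w * z)]
      have : t * ((n * v * z : ℕ) : ZMod p) = ((n * w * z : ℕ) : ZMod p) := by
        push_cast
        linear_combination (n * z : ZMod p) * h
      rw [this]
    · obtain ⟨b, hb, hbw⟩ := exists_sub_mod_mod_iff_div_mod hn hpp.pos hcop hj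
      refine ⟨b, hb, fun z hz hzp => ?_⟩
      have hz0 := hne z (Nat.pos_of_ne_zero hz) hzp
      rw [← hbw _ ⟨w * z, by ring⟩, ← ZMod.val_natCast p (n * w * z)]
      have : t * ((n * v * z : ℕ) : ZMod p) = -((n * w * z : ℕ) : ZMod p) := by
        push_cast
        linear_combination (n * z : ZMod p) * h
      have hne : ((n * w * z : ℕ) : ZMod p) ≠ 0 := by
        push_cast
        exact mul_ne_zero (mul_ne_zero hn0 hw0) hz0
      have hnz : NeZero ((n * w * z : ℕ) : ZMod p) := ⟨hne⟩
      rw [this, ZMod.val_neg_of_ne_zero]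
  have hcorr : classCorr p n j t =
      #{z ∈ range p | z ≠ 0 ∧ (n * v * z / p % n = a ∧ n * w * z / p % n = b)} := by
    unfold classCorr
    symm
    have hnz : ∀ z, z < p → z ≠ 0 → ((n * v * z : ℕ) : ZMod p) ≠ 0 := fun z hz hz0 => by
      push_cast
      exact mul_ne_zero (mul_ne_zero hn0 hv0) (hne z (Nat.pos_of_ne_zero hz0) hz)
    refine card_bij (fun z _ => ((n * v * z : ℕ) : ZMod p)) ?_ ?_ ?_
    · intro z hz
      simp only [mem_filter, mem_range] at hz
      obtain ⟨hzp, hz0, h1, h2⟩ := hz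
      simp only [mem_filter, mem_univ, true_and]
      refine ⟨⟨hnz z hzp hz0, ?_⟩, mul_ne_zero ht0 (hnz z hzp hz0), (hbw z hz0 hzp).2 h2⟩
      rw [ZMod.val_natCast]
      exact (hav _ ⟨v * z, by ring⟩).2 h1
    · intro z hz z' hz' h
      simp only [mem_filter, mem_range] at hz hz'
      push_cast at h
      have := mul_left_cancel₀ (mul_ne_zero hn0 hv0) h
      rwa [ZMod.natCast_eq_natCast_iff', Nat.mod_eq_of_lt hz.1, Nat.mod_eq_of_lt hz'.1] at this
    · intro x hx
      simp only [mem_filter, mem_univ, true_and] at hx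
      obtain ⟨⟨hx0, hx1⟩, -, hx2⟩ := hx
      have hxz : ((n * v * (x / (n * v)).val : ℕ) : ZMod p) = x := by
        push_cast
        rw [ZMod.natCast_val, ZMod.cast_id', id]
        field_simp
      have hz0 : (x / (n * v)).val ≠ 0 := by
        intro h
        rw [h] at hxz
        exact hx0 (by simpa using hxz.symm)
      refine ⟨(x / (n * v)).val, ?_, hxz⟩
      simp only [mem_filter, mem_range]
      refine ⟨ZMod.val_lt _, hz0, ?_, ?_⟩
      · rw [← hav _ ⟨v * (x / (n * v)).val, by ring⟩, ← ZMod.val_natCast p (n * v * _), hxz]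
        exact hx1
      · rw [← hbw _ hz0 (ZMod.val_lt _), hxz]
        exact hx2
  set N := #{z ∈ range p | n * v * z / p % n = a ∧ n * w * z / p % n = b} with hN
  have hN1 : classCorr p n j t ≤ N := by
    rw [hcorr]
    exact card_le_card fun z hz => by
      rw [mem_filter] at hz ⊢
      exact ⟨hz.1, hz.2.2⟩
  have hN2 : N ≤ classCorr p n j t + 1 := by
    rw [hcorr, ← card_singleton 0]
    refine (card_le_card fun z hz => ?_).trans (card_union_le _ _)
    rw [mem_filter] at hz
    rw [mem_union, mem_filter, mem_singleton]
    by_cases h0 : z = 0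
    · exact Or.inr h0
    · exact Or.inl ⟨hz.1, h0, hz.2⟩
  have h1 := abs_card_floor_sub_le p n v w hpp.pos hn hv hw (fun s => s % n = a)
    (fun s => s % n = b)
  have h2 := abs_card_complete_sub_le n v w a b hn hv hw hvw ha hb
  set K := #{s ∈ range (n * v * w) | s / w % n = a ∧ s / v % n = b} with hK
  refine ⟨n * K - v * w, h2, ⟨K, by ring⟩, ?_⟩
  generalize classCorr p n j t = C at *
  have hL : (0 : ℤ) < n * (n * v * w) := by positivity
  zify at hN1 hN2
  have h3 : |((n : ℤ) * v * w) * C - p * K| ≤ n * v * w * (n * (v + w)) + n * v * w := by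
    have h4 : ((n : ℤ) * v * w) * C - p * K =
      (((n * v * w : ℕ) : ℤ) * N - p * K) - (n * v * w) * (N - C) := by push_cast; ring
    rw [h4]
    refine (abs_sub _ _).trans (add_le_add ?_ ?_)
    · exact_mod_cast h1
    · have : (0 : ℤ) ≤ n * v * w := by positivity
      rw [abs_of_nonneg (mul_nonneg this (by linarith))]
      nlinarith
  calc |((n : ℤ) ^ 2 * v * w) * C - p * (v * w + (n * K - v * w))|
      = |(n : ℤ) * (((n : ℤ) * v * w) * C - p * K)| := by congr 1; ring
    _ = n * |((n : ℤ) * v * w) * C - p * K| := by rw [abs_mul, Nat.abs_cast]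
    _ ≤ n * (n * v * w * (n * (v + w)) + n * v * w) := by gcongr
    _ = _ := by ring

/-- Thue's lemma. -/
theorem exists_coprime_small_ratio {p : ℕ} [Fact p.Prime] {u : ZMod p} (hu : u ≠ 0) :
    ∃ v w : ℕ, 0 < v ∧ 0 < w ∧ v ≤ p.sqrt ∧ w ≤ p.sqrt ∧ v.Coprime w ∧
      (u * v = w ∨ u * v = -w) := by
  have hpp : p.Prime := Fact.out
  set s := p.sqrt with hs
  have hsp : s < p := Nat.sqrt_lt_self hpp.one_lt
  have hcard : #(univ : Finset (ZMod p)) < #(range (s + 1) ×ˢ range (s + 1)) := by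
    rw [card_univ, ZMod.card, card_product, card_range]
    exact Nat.lt_succ_sqrt p
  obtain ⟨x, hx, y, hy, hxy, h⟩ := exists_ne_map_eq_of_card_lt_of_maps_to hcard
    (f := fun x => u * x.1 - x.2) (fun _ _ => mem_coe.2 (mem_univ _))
  simp only [mem_product, mem_range] at hx hy
  obtain ⟨α, hα⟩ : ∃ α : ℤ, α = x.1 - y.1 := ⟨_, rfl⟩
  obtain ⟨β, hβ⟩ : ∃ β : ℤ, β = x.2 - y.2 := ⟨_, rfl⟩
  have hrel : u * (α : ZMod p) = β := by
    rw [hα, hβ]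
    push_cast
    linear_combination h
  have hsmall : ∀ γ : ℤ, γ.natAbs ≤ s → (γ : ZMod p) = 0 → γ = 0 := by
    intro γ h1 h2
    rw [ZMod.intCast_zmod_eq_zero_iff_dvd] at h2
    exact Int.eq_zero_of_dvd_of_natAbs_lt_natAbs h2 (by simpa using lt_of_le_of_lt h1 hsp)
  have hαs : α.natAbs ≤ s := by omega
  have hβs : β.natAbs ≤ s := by omega
  have hαβ : ¬(α = 0 ∧ β = 0) := fun h0 => hxy (Prod.ext (by omega) (by omega))
  have hα0 : α ≠ 0 := by
    intro h0
    rw [h0, Int.cast_zero, mul_zero] at hrel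
    exact hαβ ⟨h0, hsmall β hβs hrel.symm⟩
  have hβ0 : β ≠ 0 := by
    intro h0
    rw [h0, Int.cast_zero] at hrel
    exact hα0 (hsmall α hαs ((mul_eq_zero.1 hrel).resolve_left hu))
  have hrel' : u * (α.natAbs : ZMod p) = β.natAbs ∨ u * (α.natAbs : ZMod p) = -β.natAbs := by
    have e1 : ((α.natAbs : ℤ) : ZMod p) = α ∨ ((α.natAbs : ℤ) : ZMod p) = -α := by
      rcases Int.natAbs_eq α with h1 | h1
      · left; rw [← h1]
      · right; nth_rewrite 2 [h1]; push_cast; ring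
    have e2 : ((β.natAbs : ℤ) : ZMod p) = β ∨ ((β.natAbs : ℤ) : ZMod p) = -β := by
      rcases Int.natAbs_eq β with h1 | h1
      · left; rw [← h1]
      · right; nth_rewrite 2 [h1]; push_cast; ring
    rw [Int.cast_natCast] at e1 e2
    rcases e1 with e1 | e1 <;> rcases e2 with e2 | e2 <;> rw [e1, e2]
    · exact Or.inl hrel
    · right; rw [neg_neg]; exact hrel
    · right; rw [mul_neg, hrel]
    · left; rw [mul_neg, hrel]
  obtain ⟨g, v, w, hg, hvw, hv, hw⟩ := Nat.exists_coprime' (m := α.natAbs) (n := β.natAbs)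
    (Nat.gcd_pos_of_pos_left _ (Int.natAbs_pos.2 hα0))
  have hα1 := Int.natAbs_pos.2 hα0
  have hβ1 := Int.natAbs_pos.2 hβ0
  rw [hv] at hα1 hrel' hαs
  rw [hw] at hβ1 hrel' hβs
  have hv0 : 0 < v := Nat.pos_of_mul_pos_right hα1
  have hw0 : 0 < w := Nat.pos_of_mul_pos_right hβ1
  have hgs : g ≤ s := (Nat.le_mul_of_pos_left g hv0).trans hαs
  have hg0 : (g : ZMod p) ≠ 0 := by
    rw [Ne, ZMod.natCast_eq_zero_iff]
    exact Nat.not_dvd_of_pos_of_lt hg (by omega)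
  refine ⟨v, w, hv0, hw0, (Nat.le_mul_of_pos_right v hg).trans hαs,
    (Nat.le_mul_of_pos_right w hg).trans hβs, hvw, ?_⟩
  push_cast at hrel'
  rcases hrel' with h1 | h1
  · left; apply mul_right_cancel₀ hg0; linear_combination h1
  · right; apply mul_right_cancel₀ hg0; linear_combination h1

theorem card_class_bounds {p : ℕ} [Fact p.Prime] {n i : ℕ} (hn : 0 < n) (hi : i < n) :
    p / n ≤ #{x : ZMod p | x ≠ 0 ∧ x.val % n = i} + 1 ∧
      #{x : ZMod p | x ≠ 0 ∧ x.val % n = i} ≤ p / n + 1 := by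
  have h1 : #{x : ZMod p | x.val % n = i} = #{r ∈ range p | r ≡ i [MOD n]} := by
    refine card_bij (fun x _ => x.val) ?_ ?_ ?_
    · intro x hx
      simp only [mem_filter, mem_univ, true_and] at hx
      rw [mem_filter, Nat.ModEq, Nat.mod_eq_of_lt hi]
      exact ⟨mem_range.2 (ZMod.val_lt x), hx⟩
    · exact fun x _ y _ h => ZMod.val_injective p h
    · intro r hr
      rw [mem_filter, Nat.ModEq, Nat.mod_eq_of_lt hi, mem_range] at hr
      have : ((r : ℕ) : ZMod p).val = r := ZMod.val_natCast_of_lt hr.1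
      exact ⟨r, by simpa [this] using hr.2, this⟩
  rw [card_filter_range_modEq n p i hn] at h1
  have h2 : #{x : ZMod p | x ≠ 0 ∧ x.val % n = i} ≤ #{x : ZMod p | x.val % n = i} :=
    card_le_card fun x hx => by
      rw [mem_filter] at hx ⊢
      exact ⟨hx.1, hx.2.2⟩
  have h3 : #{x : ZMod p | x.val % n = i} ≤ #{x : ZMod p | x ≠ 0 ∧ x.val % n = i} + 1 := by
    rw [← card_singleton (0 : ZMod p)]
    refine (card_le_card fun z hz => ?_).trans (card_union_le _ _)
    rw [mem_filter] at hz
    rw [mem_union, mem_filter, mem_singleton]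
    by_cases h0 : z = 0
    · exact Or.inr h0
    · exact Or.inl ⟨hz.1, h0, hz.2⟩
  split_ifs at h1 <;> omega

theorem classCorr_le {p : ℕ} [Fact p.Prime] {n i j k : ℕ} {A : ZMod p} (hA : A ≠ 0)
    (hφ : Function.Bijective fun x : ZMod p => x ^ k)
    (h : ∀ x : ZMod p, x ≠ 0 → x.val % n = i → (A * x ^ k).val % n = j) (t : ZMod p) :
    classCorr p n i t ≤ classCorr p n j (t ^ k) := by
  have hinj : Function.Injective fun x : ZMod p => A * x ^ k := fun x y hxy =>
    hφ.1 (mul_left_cancel₀ hA hxy)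
  unfold classCorr
  refine card_le_card_of_injOn (fun x => A * x ^ k) ?_ hinj.injOn
  intro x hx
  simp only [coe_filter, mem_univ, true_and, Set.mem_ofPred_eq] at hx ⊢
  obtain ⟨⟨hx0, hx1⟩, htx0, htx1⟩ := hx
  have e : t ^ k * (A * x ^ k) = A * (t * x) ^ k := by ring
  rw [e]
  exact ⟨⟨mul_ne_zero hA (pow_ne_zero _ hx0), h x hx0 hx1⟩,
    mul_ne_zero hA (pow_ne_zero _ htx0), h _ htx0 htx1⟩

theorem classCorr_pow_le {p : ℕ} [Fact p.Prime] {n i j k : ℕ} {A : ZMod p} (hA : A ≠ 0)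
    (hφ : Function.Bijective fun x : ZMod p => x ^ k) (hn : 0 < n) (hi : i < n) (hj : j < n)
    (h : ∀ x : ZMod p, x ≠ 0 → x.val % n = i → (A * x ^ k).val % n = j) {t : ZMod p}
    (ht : t ≠ 0) :
    classCorr p n j (t ^ k) ≤ classCorr p n i t + 4 := by
  have hinj : Function.Injective fun x : ZMod p => A * x ^ k := fun x y hxy =>
    hφ.1 (mul_left_cancel₀ hA hxy)
  set Ci : Finset (ZMod p) := {x : ZMod p | x ≠ 0 ∧ x.val % n = i} with hCi
  set Cj : Finset (ZMod p) := {x : ZMod p | x ≠ 0 ∧ x.val % n = j} with hCj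
  set I := Ci.image fun x => A * x ^ k with hI
  have hIC : I ⊆ Cj := by
    intro y hy
    obtain ⟨x, hx, rfl⟩ := mem_image.1 hy
    simp only [hCi, hCj, mem_filter, mem_univ, true_and] at hx ⊢
    exact ⟨mul_ne_zero hA (pow_ne_zero _ hx.1), h x hx.1 hx.2⟩
  have hIcard : #I = #Ci := card_image_of_injective _ hinj
  have hdiff : #(Cj \ I) ≤ 2 := by
    have h1 : p / n ≤ #Ci + 1 := (card_class_bounds (p := p) hn hi).1
    have h2 : #Cj ≤ p / n + 1 := (card_class_bounds (p := p) hn hj).2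
    rw [card_sdiff_of_subset hIC, hIcard]
    omega
  have hinj2 : Function.Injective fun y : ZMod p => t ^ k * y := fun x y hxy =>
    mul_left_cancel₀ (pow_ne_zero k ht) hxy
  have hsub : ({x : ZMod p | (x ≠ 0 ∧ x.val % n = j) ∧
      (t ^ k * x ≠ 0 ∧ (t ^ k * x).val % n = j)} : Finset (ZMod p)) ⊆
      (({x : ZMod p | (x ≠ 0 ∧ x.val % n = i) ∧
        (t * x ≠ 0 ∧ (t * x).val % n = i)} : Finset (ZMod p)).image fun x => A * x ^ k) ∪
      ((Cj \ I) ∪ ({y : ZMod p | t ^ k * y ∈ Cj \ I} : Finset (ZMod p))) := by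
    intro y hy
    simp only [mem_filter, mem_univ, true_and] at hy
    have hy1 : y ∈ Cj := by simpa [hCj] using hy.1
    have hy2 : t ^ k * y ∈ Cj := mem_filter.2 ⟨mem_univ _, hy.2⟩
    rw [mem_union, mem_union, mem_filter, mem_sdiff, mem_sdiff]
    by_cases hyI : y ∈ I
    · by_cases htI : t ^ k * y ∈ I
      · left
        obtain ⟨x, hx, rfl⟩ := mem_image.1 hyI
        obtain ⟨x', hx', hxx'⟩ := mem_image.1 htI
        have : x' = t * x := hinj (by simp only [hxx']; ring)
        subst this
        simp only [hCi, mem_filter, mem_univ, true_and] at hx hx'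
        exact mem_image.2 ⟨x, mem_filter.2 ⟨mem_univ _, hx, hx'⟩, rfl⟩
      · right; right; exact ⟨mem_univ _, hy2, htI⟩
    · right; left; exact ⟨hy1, hyI⟩
  have h3 : #({y : ZMod p | t ^ k * y ∈ Cj \ I} : Finset (ZMod p)) ≤ #(Cj \ I) :=
    card_le_card_of_injOn (fun y => t ^ k * y) (fun y hy => by simpa using hy) hinj2.injOn
  unfold classCorr
  refine (card_le_card hsub).trans ((card_union_le _ _).trans ?_)
  refine add_le_add card_image_le ((card_union_le _ _).trans ?_)
  omega

theorem mul_eq_mul_of_estimates {p n r v w s Q Q' N M : ℤ} (hpZ : 0 < p) (hnZ : 0 < n)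
    (hrZ : 0 < r) (hvZ : 0 < v) (hwZ : 0 < w) (hvs' : v ≤ s) (hws' : w ≤ s)
    (hQ1 : 1 ≤ |Q|) (hQ' : |Q'| ≤ n ^ 2) (hc1 : N ≤ M) (hc2 : M ≤ N + 4)
    (hQe : |n ^ 2 * r * N - p * (r + Q)| ≤ n ^ 2 * r * (n * (1 + r) + 1))
    (hQe' : |n ^ 2 * v * w * M - p * (v * w + Q')| ≤ n ^ 2 * v * w * (n * (v + w) + 1))
    (h1 : 2 * n ^ 2 * r * (n * (r + 2 * s + 1) + 6) < p)
    (h2 : 2 * n ^ 4 * r ^ 2 * (n * (r + 2 * r * n ^ 2 + 2) + 6) < p) :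
    v * w * Q = r * Q' := by
  have hmain : (p : ℤ) * |v * w * Q - r * Q'| ≤
      n ^ 2 * r * (v * w) * (n * (r + v + w + 1) + 6) := by
    have e : (p : ℤ) * (v * w * Q - r * Q') =
        r * ((n ^ 2 * v * w : ℤ) * M - p * (v * w + Q')) -
        v * w * ((n ^ 2 * r : ℤ) * N - p * (r + Q)) - n ^ 2 * r * (v * w) * (M - N) := by ring
    have e1 : |(n ^ 2 * r * (v * w) * (M - N) : ℤ)| ≤ n ^ 2 * r * (v * w) * 4 := by
      rw [abs_of_nonneg (mul_nonneg (by positivity) (by linarith))]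
      exact mul_le_mul_of_nonneg_left (by linarith) (by positivity)
    have e2 : |(r : ℤ) * ((n ^ 2 * v * w : ℤ) * M - p * (v * w + Q'))| ≤
        r * (n ^ 2 * v * w * (n * (v + w) + 1)) := by
      rw [abs_mul, abs_of_pos hrZ]
      gcongr
    have e3 : |(v * w : ℤ) * ((n ^ 2 * r : ℤ) * N - p * (r + Q))| ≤
        v * w * (n ^ 2 * r * (n * (1 + r) + 1)) := by
      rw [abs_mul, abs_of_pos (mul_pos hvZ hwZ)]
      gcongr
    calc (p : ℤ) * |v * w * Q - r * Q'| = |(p : ℤ) * (v * w * Q - r * Q')| := by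
          rw [abs_mul, abs_of_pos hpZ]
      _ ≤ r * (n ^ 2 * v * w * (n * (v + w) + 1)) + v * w * (n ^ 2 * r * (n * (1 + r) + 1)) +
          n ^ 2 * r * (v * w) * 4 := by
        rw [e]
        refine (abs_sub _ _).trans (add_le_add ((abs_sub _ _).trans (add_le_add e2 e3)) e1)
      _ = _ := by ring
  have hvwZ : (0 : ℤ) < v * w := mul_pos hvZ hwZ
  have hlow : (v * w : ℤ) - r * n ^ 2 ≤ |v * w * Q - r * Q'| := by
    have e1 : |(v * w : ℤ) * Q| ≤ |v * w * Q - r * Q'| + |(r : ℤ) * Q'| := by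
      have := abs_add_le ((v : ℤ) * w * Q - r * Q') (r * Q')
      rwa [sub_add_cancel] at this
    have hrQ : r * |Q'| ≤ r * n ^ 2 := mul_le_mul_of_nonneg_left hQ' hrZ.le
    have hvQ : v * w * 1 ≤ v * w * |Q| := mul_le_mul_of_nonneg_left hQ1 hvwZ.le
    rw [abs_mul, abs_of_pos hvwZ, abs_mul, abs_of_pos hrZ] at e1
    linarith
  have hvw2 : (v * w : ℤ) ≤ 2 * (r * n ^ 2) := by
    by_contra hcon
    push Not at hcon
    have hz1 : (2 * n ^ 2 * r * (n * (r + 2 * s + 1) + 6) : ℤ) < p := h1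
    have hz2 : (2 * n ^ 2 * r * (n * (r + v + w + 1) + 6) : ℤ) < p := by
      refine lt_of_le_of_lt ?_ hz1
      have : (r + v + w + 1 : ℤ) ≤ r + 2 * s + 1 := by linarith
      gcongr
    have hz3 : (p : ℤ) * (v * w) ≤ p * (2 * |v * w * Q - r * Q'|) :=
      mul_le_mul_of_nonneg_left (by linarith) hpZ.le
    have hz4 : (2 * n ^ 2 * r * (n * (r + v + w + 1) + 6) : ℤ) * (v * w) < p * (v * w) :=
      mul_lt_mul_of_pos_right hz2 hvwZ
    linarith only [hz3, hz4, hmain]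
  have heq : (v * w : ℤ) * Q = r * Q' := by
    have hz1 : (2 * n ^ 4 * r ^ 2 * (n * (r + 2 * r * n ^ 2 + 2) + 6) : ℤ) < p := by
      exact_mod_cast h2
    have hsum : (v + w : ℤ) ≤ v * w + 1 := by
      linarith only [mul_nonneg (sub_nonneg.2 (Int.add_one_le_iff.2 hvZ)) (sub_nonneg.2 (Int.add_one_le_iff.2 hwZ))]
    have hz2 : (n ^ 2 * r * (v * w) * (n * (r + v + w + 1) + 6) : ℤ) < p := by
      refine lt_of_le_of_lt ?_ hz1
      calc (n ^ 2 * r * (v * w) * (n * (r + v + w + 1) + 6) : ℤ) ≤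
          n ^ 2 * r * (2 * (r * n ^ 2)) * (n * (r + 2 * r * n ^ 2 + 2) + 6) := by
            have : (r + v + w + 1 : ℤ) ≤ r + 2 * r * n ^ 2 + 2 := by linarith
            gcongr
        _ = _ := by ring
    have hz3 : (p : ℤ) * |v * w * Q - r * Q'| < p * 1 := by linarith
    have hz4 := lt_of_mul_lt_mul_left hz3 hpZ.le
    rw [Int.abs_lt_one_iff] at hz4
    linarith
  exact heq

/-- A small prime `r` has `r ^ (k - 1)` or `r ^ (k + 1)` equal, up to sign, to a ratio of small
integers. -/
theorem exists_small_ratio_of_class_map {p : ℕ} [Fact p.Prime] {n i j k r : ℕ} {A : ZMod p}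
    (hA : A ≠ 0) (hφ : Function.Bijective fun x : ZMod p => x ^ k) (hk : 1 ≤ k) (hn : 2 ≤ n)
    (hi : i < n) (hj : j < n)
    (h : ∀ x : ZMod p, x ≠ 0 → x.val % n = i → (A * x ^ k).val % n = j)
    (hr : r.Prime) (hnr : n ^ 2 < r) (hrp : r < p)
    (h1 : 2 * n ^ 2 * r * (n * (r + 2 * p.sqrt + 1) + 6) < p)
    (h2 : 2 * n ^ 4 * r ^ 2 * (n * (r + 2 * r * n ^ 2 + 2) + 6) < p) :
    ∃ a b : ℕ, 0 < a ∧ 0 < b ∧ a * b ≤ n ^ 2 ∧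
      (((r : ZMod p) ^ (k - 1) * a = b ∨ (r : ZMod p) ^ (k - 1) * a = -b) ∨
        ((r : ZMod p) ^ (k + 1) * a = b ∨ (r : ZMod p) ^ (k + 1) * a = -b)) := by
  have hpp : p.Prime := Fact.out
  have hr0 : (r : ZMod p) ≠ 0 := by
    rw [Ne, ZMod.natCast_eq_zero_iff]
    exact Nat.not_dvd_of_pos_of_lt hr.pos hrp
  have hnp : n < p := by nlinarith
  obtain ⟨v, w, hv, hw, hvs, hws, hvw, hu⟩ := exists_coprime_small_ratio (pow_ne_zero k hr0)
  have hsp : p.sqrt < p := Nat.sqrt_lt_self hpp.one_lt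
  obtain ⟨Q, hQ, hQd, hQe⟩ := classCorr_estimate (v := 1) (w := r) (t := (r : ZMod p))
    (by omega) hnp hi one_pos hpp.one_lt hr.pos hrp (Nat.coprime_one_left r)
    (Or.inl (by simp))
  obtain ⟨Q', hQ', -, hQe'⟩ := classCorr_estimate (t := (r : ZMod p) ^ k)
    (by omega) hnp hj hv (by omega) hw (by omega) hvw hu
  have hc1 := classCorr_le hA hφ h (r : ZMod p)
  have hc2 := classCorr_pow_le hA hφ (by omega) hi hj h hr0
  set N := classCorr p n i (r : ZMod p)
  set M := classCorr p n j ((r : ZMod p) ^ k)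
  have hQ0 : Q ≠ 0 := by
    rintro rfl
    rw [zero_add, Nat.cast_one, one_mul] at hQd
    have := (Nat.dvd_prime hr).1 (Int.natCast_dvd_natCast.1 hQd)
    rcases this with h3 | h3
    · omega
    · subst h3; nlinarith
  have hQ1 : 1 ≤ |Q| := Int.one_le_abs hQ0
  push_cast at hQe
  simp only [mul_one, one_mul] at hQe
  have hvZ : (0 : ℤ) < v := by exact_mod_cast hv
  have hwZ : (0 : ℤ) < w := by exact_mod_cast hw
  have hrZ : (0 : ℤ) < r := by exact_mod_cast hr.pos
  have hpZ : (0 : ℤ) < p := by exact_mod_cast hpp.pos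
  have hnZ : (2 : ℤ) ≤ n := by exact_mod_cast hn
  zify at hc1 hc2
  have heq : (v * w : ℤ) * Q = r * Q' :=
    mul_eq_mul_of_estimates (s := p.sqrt) hpZ (by linarith) hrZ hvZ hwZ (by exact_mod_cast hvs)
      (by exact_mod_cast hws) hQ1 hQ' hc1 hc2 hQe hQe' (by exact_mod_cast h1)
      (by exact_mod_cast h2)
  have hvwZ : (0 : ℤ) < v * w := mul_pos hvZ hwZ
  have hvwr : v * w ≤ r * n ^ 2 := by
    have e1 : |(v * w : ℤ) * Q| = |(r : ℤ) * Q'| := by rw [heq]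
    rw [abs_mul, abs_of_pos hvwZ, abs_mul, abs_of_pos hrZ] at e1
    have hrQ : (r : ℤ) * |Q'| ≤ r * n ^ 2 := mul_le_mul_of_nonneg_left hQ' hrZ.le
    have hvQ : (v * w : ℤ) * 1 ≤ v * w * |Q| := mul_le_mul_of_nonneg_left hQ1 hvwZ.le
    have : (v * w : ℤ) ≤ r * n ^ 2 := by linarith
    exact_mod_cast this
  have hrvw : r ∣ v * w := by
    have hd : (r : ℤ) ∣ ((v * w : ℕ) : ℤ) * Q := ⟨Q', by push_cast; exact heq⟩
    rcases (Nat.prime_iff_prime_int.1 hr).dvd_or_dvd hd with h3 | h3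
    · exact Int.natCast_dvd_natCast.1 h3
    · exfalso
      have h4 := Int.le_of_dvd (abs_pos.2 hQ0) ((dvd_abs _ _).2 h3)
      have : (n ^ 2 : ℤ) < r := by exact_mod_cast hnr
      linarith
  rcases (Nat.Prime.dvd_mul hr).1 hrvw with ⟨a, rfl⟩ | ⟨b, rfl⟩
  · refine ⟨a, w, Nat.pos_of_mul_pos_left hv, hw, ?_, Or.inr ?_⟩
    · refine Nat.le_of_mul_le_mul_left ?_ hr.pos
      linarith
    · push_cast at hu
      rw [pow_succ, mul_assoc]
      exact hu
  · refine ⟨v, b, hv, Nat.pos_of_mul_pos_left hw, ?_, Or.inl ?_⟩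
    · refine Nat.le_of_mul_le_mul_left ?_ hr.pos
      linarith
    · have hpow : (r : ZMod p) ^ k = r ^ (k - 1) * r := by
        rw [← pow_succ, Nat.sub_add_cancel hk]
      rw [hpow] at hu
      push_cast at hu
      refine hu.imp (fun h3 => ?_) (fun h3 => ?_) <;> apply mul_left_cancel₀ hr0 <;>
        linear_combination h3

theorem choose_four_le_card_pow_eq_one {p : ℕ} [Fact p.Prime] {e T : ℕ} {c : ZMod p}
    (P : Finset ℕ) (hP : ∀ r ∈ P, r.Prime) (hPT : ∀ r ∈ P, r ≤ T) (hT : T ^ 4 < p)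
    (hc : ∀ r ∈ P, (r : ZMod p) ^ e = c) :
    (#P).choose 4 ≤ #{x : ZMod p | x ≠ 0 ∧ x ^ e = 1} := by
  rw [← card_powersetCard]
  rcases (powersetCard 4 P).eq_empty_or_nonempty with h0 | ⟨s₀, hs₀⟩
  · simp [h0]
  have hlt : ∀ s ∈ powersetCard 4 P, ∏ r ∈ s, r < p := fun s hs => by
    obtain ⟨hsP, hs4⟩ := mem_powersetCard.1 hs
    refine lt_of_le_of_lt ?_ hT
    rw [← hs4]
    exact prod_le_pow_card _ _ _ fun r hr => hPT r (hsP hr)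
  have hne : ∀ s ∈ powersetCard 4 P, ((∏ r ∈ s, r : ℕ) : ZMod p) ≠ 0 := fun s hs => by
    rw [Ne, ZMod.natCast_eq_zero_iff]
    exact Nat.not_dvd_of_pos_of_lt
      (prod_pos fun r hr => (hP r ((mem_powersetCard.1 hs).1 hr)).pos) (hlt s hs)
  have hpow : ∀ s ∈ powersetCard 4 P, ((∏ r ∈ s, r : ℕ) : ZMod p) ^ e = c ^ 4 := fun s hs => by
    obtain ⟨hsP, hs4⟩ := mem_powersetCard.1 hs
    rw [Nat.cast_prod, ← prod_pow, prod_congr rfl fun r hr => hc r (hsP hr), prod_const, hs4]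
  refine card_le_card_of_injOn
    (fun s => ((∏ r ∈ s, r : ℕ) : ZMod p) / ((∏ r ∈ s₀, r : ℕ) : ZMod p)) ?_ ?_
  · intro s hs
    rw [mem_coe] at hs
    simp only [coe_filter, mem_univ, true_and, Set.mem_ofPred_eq]
    refine ⟨div_ne_zero (hne s hs) (hne s₀ hs₀), ?_⟩
    rw [div_pow, hpow s hs, ← hpow s₀ hs₀, div_self (pow_ne_zero _ (hne s₀ hs₀))]
  · intro s hs t ht hst
    rw [mem_coe] at hs ht
    have h1 := (div_left_inj' (hne s₀ hs₀)).1 hst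
    have h2 := congrArg ZMod.val h1
    rw [ZMod.val_natCast_of_lt (hlt s hs), ZMod.val_natCast_of_lt (hlt t ht)] at h2
    rw [← Nat.primeFactors_prod fun r hr => hP r ((mem_powersetCard.1 hs).1 hr), h2,
      Nat.primeFactors_prod fun r hr => hP r ((mem_powersetCard.1 ht).1 hr)]

theorem card_filter_mul_le_sq (n : ℕ) :
    #{q ∈ Icc 1 (n ^ 2) ×ˢ Icc 1 (n ^ 2) | q.1 * q.2 ≤ n ^ 2} ≤ 2 * n ^ 3 := by
  have hsub : {q ∈ Icc 1 (n ^ 2) ×ˢ Icc 1 (n ^ 2) | q.1 * q.2 ≤ n ^ 2} ⊆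
      (Icc 1 n ×ˢ Icc 1 (n ^ 2)) ∪ (Icc 1 (n ^ 2) ×ˢ Icc 1 n) := by
    intro q hq
    simp only [mem_filter, mem_product, mem_Icc, mem_union] at hq ⊢
    by_cases h : q.1 ≤ n
    · exact Or.inl ⟨⟨hq.1.1.1, h⟩, hq.1.2⟩
    · refine Or.inr ⟨hq.1.1, hq.1.2.1, ?_⟩
      by_contra h2
      push Not at h h2
      nlinarith [hq.2]
  refine (card_le_card hsub).trans ((card_union_le _ _).trans ?_)
  simp only [card_product, Nat.card_Icc, Nat.add_sub_cancel]
  exact le_of_eq (by ring)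

theorem exists_common_power {p : ℕ} [Fact p.Prime] {n k : ℕ} (hn : 0 < n) (hnp : n ^ 2 < p) {t : ℝ}
    (R : Finset ℕ) (hR : 8 * (n : ℝ) ^ 3 * t ≤ #R) (ht : 0 ≤ t)
    (h : ∀ r ∈ R, ∃ a b : ℕ, 0 < a ∧ 0 < b ∧ a * b ≤ n ^ 2 ∧
      (((r : ZMod p) ^ (k - 1) * a = b ∨ (r : ZMod p) ^ (k - 1) * a = -b) ∨
        ((r : ZMod p) ^ (k + 1) * a = b ∨ (r : ZMod p) ^ (k + 1) * a = -b))) :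
    ∃ P ⊆ R, t ≤ #P ∧ ∃ c : ZMod p,
      (∀ r ∈ P, (r : ZMod p) ^ (k - 1) = c) ∨ (∀ r ∈ P, (r : ZMod p) ^ (k + 1) = c) := by
  classical
  have h' : ∀ r ∈ R, ∃ q : (Bool × Bool) × (ℕ × ℕ), 0 < q.2.1 ∧ 0 < q.2.2 ∧
      q.2.1 * q.2.2 ≤ n ^ 2 ∧
      (r : ZMod p) ^ (bif q.1.1 then k - 1 else k + 1) * q.2.1 =
        bif q.1.2 then (q.2.2 : ZMod p) else -q.2.2 := by
    intro r hr
    obtain ⟨a, b, ha, hb, hab, (h1 | h1) | (h1 | h1)⟩ := h r hr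
    · exact ⟨((true, true), (a, b)), ha, hb, hab, h1⟩
    · exact ⟨((true, false), (a, b)), ha, hb, hab, h1⟩
    · exact ⟨((false, true), (a, b)), ha, hb, hab, h1⟩
    · exact ⟨((false, false), (a, b)), ha, hb, hab, h1⟩
  choose! g hg1 hg2 hg3 hg4 using h'
  set L : Finset ((Bool × Bool) × (ℕ × ℕ)) :=
    univ ×ˢ {q ∈ Icc 1 (n ^ 2) ×ˢ Icc 1 (n ^ 2) | q.1 * q.2 ≤ n ^ 2} with hL
  have hgL : ∀ r ∈ R, g r ∈ L := by
    intro r hr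
    have h1 := hg1 r hr
    have h2 := hg2 r hr
    have h3 := hg3 r hr
    simp only [hL, mem_product, mem_univ, mem_filter, mem_Icc, true_and]
    refine ⟨⟨⟨h1, ?_⟩, h2, ?_⟩, h3⟩ <;> nlinarith
  have hLc : (#L : ℝ) ≤ 8 * (n : ℝ) ^ 3 := by
    have h1 : #L ≤ 8 * n ^ 3 := by
      rw [hL, card_product]
      have := card_filter_mul_le_sq n
      simp only [card_univ, Fintype.card_prod, Fintype.card_bool]
      omega
    exact_mod_cast h1
  have hL0 : L.Nonempty := by
    refine ⟨((true, true), (1, 1)), ?_⟩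
    simp only [hL, mem_product, mem_univ, mem_filter, mem_Icc, true_and]
    have : 1 ≤ n ^ 2 := Nat.one_le_pow _ _ hn
    omega
  obtain ⟨y, hy, hyt⟩ := exists_le_card_fiber_of_nsmul_le_card_of_maps_to hgL hL0 (b := t)
    (by rw [nsmul_eq_mul]; exact (mul_le_mul_of_nonneg_right hLc ht).trans hR)
  refine ⟨_, filter_subset _ _, hyt, (bif y.1.2 then (y.2.2 : ZMod p) else -y.2.2) / y.2.1, ?_⟩
  have hya : (y.2.1 : ZMod p) ≠ 0 := by
    simp only [hL, mem_product, mem_univ, mem_filter, mem_Icc, true_and] at hy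
    rw [Ne, ZMod.natCast_eq_zero_iff]
    exact Nat.not_dvd_of_pos_of_lt (by omega) (by omega)
  have key : ∀ r ∈ ({r ∈ R | g r = y} : Finset ℕ),
      (r : ZMod p) ^ (bif y.1.1 then k - 1 else k + 1) =
        (bif y.1.2 then (y.2.2 : ZMod p) else -y.2.2) / y.2.1 := by
    intro r hr
    obtain ⟨hrR, rfl⟩ := mem_filter.1 hr
    exact (eq_div_iff hya).2 (hg4 r hrR)
  cases hb : y.1.1 <;> simp only [hb, cond_true, cond_false] at key
  · exact Or.inr key
  · exact Or.inl key

theorem exists_rpow_root_bounds {p n : ℕ} (hp : 0 < p)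
    (hbig : (9 * 10 ^ 34 : ℝ) * (n : ℝ) ^ ((92 : ℝ) / 3) < (p : ℝ)) :
    ∃ ν : ℝ, 0 < ν ∧ (p : ℝ) = ν ^ 92 ∧ (p : ℝ) ^ ((89 : ℝ) / 92) = ν ^ 89 ∧ 27 * n ≤ 2 * ν ^ 3 := by
  have hp' : (0 : ℝ) < p := by exact_mod_cast hp
  refine ⟨(p : ℝ) ^ ((1 : ℝ) / 92), by positivity, ?_, ?_, ?_⟩
  · rw [← Real.rpow_mul_natCast hp'.le]; norm_num
  · rw [← Real.rpow_mul_natCast hp'.le]; norm_num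
  rw [← Real.rpow_mul_natCast hp'.le]
  have h1 : ((27 / 2 : ℝ) * n) ^ ((92 : ℝ) / 3) ≤ p := by
    rw [Real.mul_rpow (by norm_num) (by positivity)]
    refine le_trans (mul_le_mul_of_nonneg_right ?_ (by positivity)) hbig.le
    rw [← Real.rpow_le_rpow_iff (z := 3) (by positivity) (by positivity) (by norm_num),
      ← Real.rpow_mul (by norm_num)]
    norm_num
  have h2 := Real.rpow_le_rpow (by positivity) h1 (show (0 : ℝ) ≤ 3 / 92 by norm_num)
  rw [← Real.rpow_mul (by positivity)] at h2
  norm_num at h2 ⊢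
  linarith

theorem sqrt_sqrt_bounds {p : ℕ} (hp : p.Prime) {ν : ℝ} (hν : 0 < ν) (hpν : (p : ℝ) = ν ^ 92) :
    p.sqrt.sqrt ^ 4 < p ∧ (p.sqrt.sqrt : ℝ) ≤ ν ^ 23 ∧ ν ^ 23 < p.sqrt.sqrt + 1 ∧
      (p.sqrt : ℝ) ≤ ν ^ 46 := by
  have h1 : p.sqrt.sqrt ^ 4 ≤ p := by
    calc p.sqrt.sqrt ^ 4 = (p.sqrt.sqrt ^ 2) ^ 2 := by ring
      _ ≤ p.sqrt ^ 2 := Nat.pow_le_pow_left (Nat.sqrt_le' _) 2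
      _ ≤ p := Nat.sqrt_le' _
  have h2 : p < (p.sqrt.sqrt + 1) ^ 4 := by
    calc p < (p.sqrt + 1) ^ 2 := Nat.lt_succ_sqrt' _
      _ ≤ ((p.sqrt.sqrt + 1) ^ 2) ^ 2 := Nat.pow_le_pow_left (Nat.lt_succ_sqrt' _) 2
      _ = (p.sqrt.sqrt + 1) ^ 4 := by ring
  refine ⟨lt_of_le_of_ne h1 fun h => ?_, ?_, ?_, ?_⟩
  · exact Nat.Prime.not_prime_pow (by norm_num) (h ▸ hp)
  · refine le_of_pow_le_pow_left₀ (n := 4) (by norm_num) (by positivity) ?_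
    rw [← pow_mul, ← hpν]
    exact_mod_cast h1
  · refine lt_of_pow_lt_pow_left₀ 4 (by positivity) ?_
    rw [← pow_mul, ← hpν]
    exact_mod_cast h2
  · refine le_of_pow_le_pow_left₀ (n := 2) (by norm_num) (by positivity) ?_
    rw [← pow_mul, ← hpν]
    exact_mod_cast Nat.sqrt_le' p

theorem size_conditions {p n r : ℕ} {ν : ℝ} (hν : 3 ≤ ν) (hpν : (p : ℝ) = ν ^ 92)
    (hn : 1 ≤ n) (hnν : 27 * n ≤ 2 * ν ^ 3) (hr0 : 1 ≤ r) (hr : (r : ℝ) ≤ ν ^ 23)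
    (hs : (p.sqrt : ℝ) ≤ ν ^ 46) :
    2 * n ^ 2 * r * (n * (r + 2 * p.sqrt + 1) + 6) < p ∧
      2 * n ^ 4 * r ^ 2 * (n * (r + 2 * r * n ^ 2 + 2) + 6) < p := by
  have hn' : (1 : ℝ) ≤ n := by exact_mod_cast hn
  have hr0' : (1 : ℝ) ≤ r := by exact_mod_cast hr0
  have hν1 : 1 ≤ ν := by linarith
  have hn3 : (n : ℝ) ≤ 2 / 27 * ν ^ 3 := by linarith
  have h23 : (1 : ℝ) ≤ ν ^ 23 := one_le_pow₀ hν1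
  have h46 : ν ^ 46 = ν ^ 23 * ν ^ 23 := by ring
  have hp0 : 0 < ν ^ 92 := by positivity
  constructor
  · have : (2 : ℝ) * n ^ 2 * r * (n * (r + 2 * p.sqrt + 1) + 6) < p := by
      rw [hpν]
      calc (2 : ℝ) * n ^ 2 * r * (n * (r + 2 * p.sqrt + 1) + 6)
          ≤ 2 * n ^ 2 * ν ^ 23 * (n * (ν ^ 46 + 2 * ν ^ 46 + ν ^ 46) + 6 * (n * ν ^ 46)) := by
            have h1 : (r : ℝ) ≤ ν ^ 46 := by nlinarith
            have h2 : (1 : ℝ) ≤ ν ^ 46 := by nlinarith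
            have h3 : (6 : ℝ) ≤ 6 * (n * ν ^ 46) := by nlinarith
            gcongr
        _ = 20 * (n : ℝ) ^ 3 * ν ^ 69 := by ring
        _ ≤ 20 * (2 / 27 * ν ^ 3) ^ 3 * ν ^ 69 := by gcongr
        _ = 160 / 19683 * ν ^ 78 := by ring
        _ ≤ 160 / 19683 * ν ^ 92 := by
            gcongr
            norm_num
        _ < ν ^ 92 := by linarith
    exact_mod_cast this
  · have : (2 : ℝ) * n ^ 4 * r ^ 2 * (n * (r + 2 * r * n ^ 2 + 2) + 6) < p := by
      rw [hpν]
      calc (2 : ℝ) * n ^ 4 * r ^ 2 * (n * (r + 2 * r * n ^ 2 + 2) + 6)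
          ≤ 2 * n ^ 4 * r ^ 2 * (n * (r * n ^ 2 + 2 * r * n ^ 2 + 2 * (r * n ^ 2)) +
              6 * (r * n ^ 3)) := by
            have h0 : (1 : ℝ) ≤ n ^ 2 := one_le_pow₀ hn'
            have h1 : (r : ℝ) ≤ r * n ^ 2 := by nlinarith
            have h2 : (2 : ℝ) ≤ 2 * (r * n ^ 2) := by nlinarith
            have h4 : (1 : ℝ) ≤ n ^ 3 := one_le_pow₀ hn'
            have h3 : (6 : ℝ) ≤ 6 * (r * n ^ 3) := by nlinarith
            gcongr
        _ = 22 * (n : ℝ) ^ 7 * r ^ 3 := by ring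
        _ ≤ 22 * (2 / 27 * ν ^ 3) ^ 7 * (ν ^ 23) ^ 3 := by gcongr
        _ = 22 * (2 / 27) ^ 7 * ν ^ 90 := by ring
        _ ≤ 22 * (2 / 27) ^ 7 * ν ^ 92 := by
            gcongr
            norm_num
        _ < ν ^ 92 := by nlinarith
    exact_mod_cast this

theorem primes_count {T n : ℕ} {ν : ℝ} (hν : 3 ≤ ν) (hn : 1 ≤ n) (hnν : 27 * n ≤ 2 * ν ^ 3)
    (hT : (T : ℝ) ≤ ν ^ 23) (hT' : ν ^ 23 < T + 1) :
    8 * (n : ℝ) ^ 3 * (5 * ν ^ 13) ≤ #{r ∈ Ioc (n ^ 2) T | r.Prime} := by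
  have hν1 : 1 ≤ ν := by linarith
  have hn3 : (n : ℝ) ≤ 2 / 27 * ν ^ 3 := by linarith
  have h22 : (1000 : ℝ) ≤ ν ^ 22 := by
    calc (1000 : ℝ) ≤ 3 ^ 22 := by norm_num
      _ ≤ ν ^ 22 := by gcongr
  have h23 : ν ^ 23 = ν * ν ^ 22 := by ring
  have hT0 : (2999 : ℝ) < T := by nlinarith
  have hlogT : Real.log T ≤ 23 / 2 * ν := by
    calc Real.log T ≤ Real.log (ν ^ 23) := Real.log_le_log (by linarith) hT
      _ = 23 * Real.log ν := by rw [Real.log_pow]; norm_num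
      _ ≤ 23 / 2 * ν := by
        have h1 := Real.log_le_sub_one_of_pos (show 0 < ν / 2 by linarith)
        rw [Real.log_div (by linarith) (by norm_num)] at h1
        have h2 := Real.log_two_lt_d9
        linarith
  have hlogT0 : 0 < Real.log T := Real.log_pos (by linarith)
  have hlogT1 : Real.log (T + 1) ≤ 0.05 * T := by
    have h1 := Real.log_le_sub_one_of_pos (show (0 : ℝ) < (T + 1) / 32 by linarith)
    rw [Real.log_div (by linarith) (by norm_num),
      show (32 : ℝ) = 2 ^ 5 by norm_num, Real.log_pow] at h1
    have h2 := Real.log_two_lt_d9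
    push_cast at h1
    linarith
  have hpi : 0.05 * ν ^ 22 ≤ (Nat.primeCounting T : ℝ) := by
    refine le_trans ?_ (Chebyshev.pi_ge T)
    rw [le_div_iff₀ hlogT0]
    have h2 := Real.log_two_gt_d9
    calc 0.05 * ν ^ 22 * Real.log T ≤ 0.05 * ν ^ 22 * (23 / 2 * ν) := by gcongr
      _ = 0.575 * ν ^ 23 := by ring
      _ ≤ T * Real.log 2 - Real.log (T + 1) := by nlinarith
  have hcount : (Nat.primeCounting T : ℝ) ≤ #{r ∈ Ioc (n ^ 2) T | r.Prime} + (n : ℝ) ^ 2 := by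
    have h1 : Nat.primeCounting T ≤ #{r ∈ Ioc (n ^ 2) T | r.Prime} + n ^ 2 := by
      rw [← Nat.primesLE_card_eq_primeCounting]
      have hsub : Nat.primesLE T ⊆ {r ∈ Ioc (n ^ 2) T | r.Prime} ∪ Icc 1 (n ^ 2) := by
        intro r hr
        obtain ⟨hrT, hrp⟩ := Nat.mem_primesLE.1 hr
        have := hrp.pos
        simp only [mem_union, mem_filter, mem_Ioc, mem_Icc]
        by_cases h : r ≤ n ^ 2
        · exact Or.inr ⟨this, h⟩
        · exact Or.inl ⟨⟨by omega, hrT⟩, hrp⟩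
      refine (card_le_card hsub).trans ((card_union_le _ _).trans ?_)
      simp
    exact_mod_cast h1
  have h2 : 8 * (n : ℝ) ^ 3 * (5 * ν ^ 13) ≤ 0.017 * ν ^ 22 := by
    calc 8 * (n : ℝ) ^ 3 * (5 * ν ^ 13) ≤ 8 * (2 / 27 * ν ^ 3) ^ 3 * (5 * ν ^ 13) := by gcongr
      _ = 320 / 19683 * ν ^ 22 := by ring
      _ ≤ 0.017 * ν ^ 22 := by gcongr; norm_num
  have h3 : (n : ℝ) ^ 2 ≤ 0.01 * ν ^ 22 := by
    calc (n : ℝ) ^ 2 ≤ (2 / 27 * ν ^ 3) ^ 2 := by gcongr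
      _ = 4 / 729 * ν ^ 6 := by ring
      _ ≤ 0.01 * ν ^ 22 := by
        gcongr
        · norm_num
        · norm_num
  linarith

theorem le_choose_four {ν : ℝ} {m N : ℕ} (hν : 3 ≤ ν) (hm : 27 * m ≤ 2 * ν ^ 3)
    (hN : 5 * ν ^ 13 ≤ N) : 1000 * (m : ℝ) ^ 2 * ν ^ 46 ≤ N.choose 4 := by
  have hm3 : (m : ℝ) ≤ 2 / 27 * ν ^ 3 := by linarith
  have h13 : (100 : ℝ) ≤ ν ^ 13 := by
    calc (100 : ℝ) ≤ 3 ^ 13 := by norm_num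
      _ ≤ ν ^ 13 := by gcongr
  have h1 : 4.5 * ν ^ 13 ≤ ((N + 1 - 4 : ℕ) : ℝ) := by
    have h4 : 4 ≤ N + 1 := by
      have : (4 : ℝ) ≤ N + 1 := by linarith
      exact_mod_cast this
    rw [Nat.cast_sub h4]
    push_cast
    linarith
  refine le_trans ?_ (Nat.pow_le_choose (α := ℝ) 4 N)
  rw [le_div_iff₀ (by positivity)]
  calc 1000 * (m : ℝ) ^ 2 * ν ^ 46 * (Nat.factorial 4 : ℕ)
      ≤ 1000 * (2 / 27 * ν ^ 3) ^ 2 * ν ^ 46 * (Nat.factorial 4 : ℕ) := by gcongr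
    _ = 1000 * 24 * 4 / 729 * ν ^ 52 := by norm_num [Nat.factorial]; ring
    _ ≤ 4.5 ^ 4 * ν ^ 52 := by gcongr; norm_num
    _ = (4.5 * ν ^ 13) ^ 4 := by ring
    _ ≤ _ := by gcongr

theorem false_of_card_pow_sub_one {p n : ℕ} {ν D S : ℝ} (hν : 3 ≤ ν) (hpν : (p : ℝ) = ν ^ 92)
    (hn : 2 ≤ n) (hnν : 27 * n ≤ 2 * ν ^ 3) (hS : (p : ℝ) / (20 * n) ≤ S)
    (hD : 1000 * (n : ℝ) ^ 2 * ν ^ 46 ≤ D) (hDle : D ≤ 0.006 * ν ^ 89)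
    (h : D * S ≤ (D + 1) * D + p * √p) : False := by
  have hn' : (2 : ℝ) ≤ n := by exact_mod_cast hn
  have hsq : √(p : ℝ) = ν ^ 46 := by
    rw [hpν, show ν ^ 92 = (ν ^ 46) ^ 2 by ring, Real.sqrt_sq (by positivity)]
  have hD0 : 0 < D := lt_of_lt_of_le (by positivity) hD
  rw [hsq] at h
  have h1 : D * (p : ℝ) ≤ 20 * n * ((D + 1) * D + p * ν ^ 46) := by
    have : (p : ℝ) ≤ 20 * n * S := by
      rw [div_le_iff₀ (by positivity)] at hS; linarith
    calc D * (p : ℝ) ≤ D * (20 * n * S) := by gcongr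
      _ = 20 * n * (D * S) := by ring
      _ ≤ _ := by gcongr
  have hp0 : 0 < (p : ℝ) := by rw [hpν]; positivity
  have h2 : 20 * n * (p * ν ^ 46) ≤ 0.01 * (D * p) := by
    have : 20 * (n : ℝ) * ν ^ 46 ≤ 0.01 * D := by nlinarith [show 0 < ν ^ 46 by positivity]
    nlinarith
  have h3 : 20 * n * (D + 1) ≤ 0.1 * (p : ℝ) := by
    have hD1 : 1 ≤ ν ^ 89 := one_le_pow₀ (by linarith)
    rw [hpν]
    calc 20 * n * (D + 1) ≤ 20 * n * (2 * D) := by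
          have : 1 ≤ D := by
            refine le_trans ?_ hD
            have : 1 ≤ ν ^ 46 := one_le_pow₀ (by linarith)
            nlinarith
          gcongr
          linarith
      _ ≤ 20 * (2 / 27 * ν ^ 3) * (2 * (0.006 * ν ^ 89)) := by
          gcongr
          linarith
      _ = 20 * 2 / 27 * 2 * 0.006 * ν ^ 92 := by ring
      _ ≤ 0.1 * ν ^ 92 := by gcongr; norm_num
  nlinarith [mul_pos hD0 hp0, mul_le_mul_of_nonneg_right h3 hD0.le]

theorem false_of_card_pow_add_one {p n : ℕ} {ν D S : ℝ} (hν : 3 ≤ ν) (hpν : (p : ℝ) = ν ^ 92)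
    (hn : 2 ≤ n) (hS : (p : ℝ) / (20 * n) ≤ S)
    (hD : 1000 * (n : ℝ) ^ 2 * ν ^ 46 ≤ D)
    (h : D * S ^ 2 ≤ (p : ℝ) ^ 2 + p * √(2 * p ^ 3)) : False := by
  have hn' : (2 : ℝ) ≤ n := by exact_mod_cast hn
  have hp0 : 0 < (p : ℝ) := by rw [hpν]; positivity
  have h46 : 1 ≤ ν ^ 46 := one_le_pow₀ (by linarith)
  have hsq : √(2 * (p : ℝ) ^ 3) ≤ 1.5 * (p * ν ^ 46) := by
    rw [Real.sqrt_le_left (by positivity)]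
    have : (1.5 * (p * ν ^ 46)) ^ 2 = 2.25 * (p : ℝ) ^ 3 := by rw [hpν]; ring
    rw [this]
    nlinarith [pow_pos hp0 3]
  have hD0 : 0 ≤ D := le_trans (by positivity) hD
  have h1 : 2.5 * ν ^ 46 * (p : ℝ) ^ 2 ≤ D * S ^ 2 := by
    calc 2.5 * ν ^ 46 * (p : ℝ) ^ 2 = 1000 * (n : ℝ) ^ 2 * ν ^ 46 * (p / (20 * n)) ^ 2 := by
          field_simp
          norm_num
      _ ≤ D * S ^ 2 := by gcongr
  have h2 : (p : ℝ) * √(2 * p ^ 3) ≤ 1.5 * ν ^ 46 * (p : ℝ) ^ 2 := by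
    calc (p : ℝ) * √(2 * p ^ 3) ≤ p * (1.5 * (p * ν ^ 46)) := by gcongr
      _ = _ := by ring
  have h46' : 1 < ν ^ 46 := one_lt_pow₀ (by linarith) (by norm_num)
  nlinarith [pow_pos hp0 2]

theorem card_pow_eq_one_le_gcd {p : ℕ} [Fact p.Prime] (e : ℕ) :
    #{x : ZMod p | x ≠ 0 ∧ x ^ e = 1} ≤ Nat.gcd e (p - 1) := by
  have hp2 : 2 ≤ p := (Fact.out : p.Prime).two_le
  have hg : 0 < Nat.gcd e (p - 1) := Nat.gcd_pos_of_pos_right _ (by omega)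
  have hsub : ({x : ZMod p | x ≠ 0 ∧ x ^ e = 1} : Finset (ZMod p)) ⊆
      (Polynomial.nthRoots (Nat.gcd e (p - 1)) (1 : ZMod p)).toFinset := by
    intro x hx
    obtain ⟨hx0, hx1⟩ := (mem_filter.1 hx).2
    rw [Multiset.mem_toFinset, Polynomial.mem_nthRoots hg]
    exact pow_gcd_eq_one.2 ⟨hx1, ZMod.pow_card_sub_one_eq_one hx0⟩
  exact (card_le_card hsub).trans
    ((Multiset.toFinset_card_le _).trans (Polynomial.card_nthRoots _ _))

theorem bijective_pow_zmod {p k : ℕ} [Fact p.Prime] (hk : 1 ≤ k) (h : Nat.gcd k (p - 1) = 1) :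
    Function.Bijective fun x : ZMod p => x ^ k := by
  refine Finite.injective_iff_bijective.1 fun x y hxy => ?_
  change x ^ k = y ^ k at hxy
  have hk0 : k ≠ 0 := by omega
  by_cases hy : y = 0
  · rw [hy, zero_pow hk0] at hxy
    rw [hy, eq_zero_of_pow_eq_zero hxy]
  by_cases hx : x = 0
  · rw [hx, zero_pow hk0] at hxy
    exact absurd (eq_zero_of_pow_eq_zero hxy.symm) hy
  have h1 : (x / y) ^ k = 1 := by rw [div_pow, hxy, div_self (pow_ne_zero _ hy)]
  have h2 := pow_gcd_eq_one.2 ⟨h1, ZMod.pow_card_sub_one_eq_one (div_ne_zero hx hy)⟩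
  rw [h, pow_one] at h2
  exact (div_eq_one_iff_eq hy).1 h2

theorem false_of_class_map {p n k i j : ℕ} [Fact p.Prime] {A : ZMod p} (hA : A ≠ 0)
    (hk : 1 ≤ k) (hkp : Nat.gcd k (p - 1) = 1) (hn : 2 ≤ n) (hi : i < n) (hj : j < n)
    (hd : (Nat.gcd (k - 1) (p - 1) : ℝ) ≤ 0.006 * (p : ℝ) ^ ((89 : ℝ) / 92))
    (hbig : (9 * 10 ^ 34 : ℝ) * (n : ℝ) ^ ((92 : ℝ) / 3) < (p : ℝ))
    (h : ∀ x : ℕ, 1 ≤ x → x ≤ p - 1 → x % n = i → (A * (x : ZMod p) ^ k).val % n = j) :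
    False := by
  have hpp : p.Prime := Fact.out
  obtain ⟨ν, hν0, hpν, hpd, hnν⟩ := exists_rpow_root_bounds hpp.pos hbig
  have hn' : (2 : ℝ) ≤ n := by exact_mod_cast hn
  have hν : 3 ≤ ν := by
    by_contra hlt
    push Not at hlt
    have : ν ^ 3 < 3 ^ 3 := by gcongr
    linarith
  have hφ := bijective_pow_zmod hk hkp
  obtain ⟨hT4, hT, hT', hs⟩ := sqrt_sqrt_bounds hpp hν0 hpν
  have hTp : p.sqrt.sqrt < p := lt_of_le_of_lt (Nat.le_self_pow (by norm_num) _) hT4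
  have hnp : 60 * n ≤ p ∧ n ^ 2 < p := by
    have h1 : (1 : ℝ) ≤ ν ^ 3 := one_le_pow₀ (by linarith)
    have h2 : (60 : ℝ) * n ≤ p := by
      rw [hpν]
      calc (60 : ℝ) * n ≤ 60 * ν ^ 3 := by linarith
        _ ≤ 3 ^ 89 * ν ^ 3 := by gcongr; norm_num
        _ ≤ ν ^ 89 * ν ^ 3 := by gcongr
        _ = ν ^ 92 := by ring
    have h3 : (n : ℝ) ^ 2 < p := by
      rw [hpν]
      calc (n : ℝ) ^ 2 ≤ (ν ^ 3) ^ 2 := by gcongr; linarith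
        _ = ν ^ 6 := by ring
        _ < ν ^ 92 := pow_lt_pow_right₀ (by linarith) (by norm_num)
    exact ⟨by exact_mod_cast h2, by exact_mod_cast h3⟩
  have hz : ∀ x : ZMod p, x ≠ 0 → x.val % n = i → (A * x ^ k).val % n = j := by
    intro x hx hxi
    have h1 := h x.val (Nat.pos_of_ne_zero ((ZMod.val_ne_zero x).2 hx))
      (Nat.le_sub_one_of_lt (ZMod.val_lt x)) hxi
    rwa [ZMod.natCast_zmod_val] at h1
  obtain ⟨l, hl, hS⟩ := exists_large_binomSum hA hφ hn hnp.1 hi h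
  obtain ⟨P, hPR, hPt, c, hc⟩ := exists_common_power (k := k) (by omega) hnp.2
    {r ∈ Ioc (n ^ 2) p.sqrt.sqrt | r.Prime} (primes_count hν (by omega) hnν hT hT')
    (by positivity) fun r hr => by
      obtain ⟨hr1, hr2⟩ := mem_filter.1 hr
      obtain ⟨hr3, hr4⟩ := mem_Ioc.1 hr1
      have hrT : (r : ℝ) ≤ ν ^ 23 := le_trans (by exact_mod_cast hr4) hT
      obtain ⟨h1, h2⟩ := size_conditions hν hpν (by omega) hnν hr2.pos hrT hs
      exact exists_small_ratio_of_class_map hA hφ hk hn hi hj hz hr2 hr3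
        (lt_of_le_of_lt hr4 hTp) h1 h2
  have hPp : ∀ r ∈ P, r.Prime := fun r hr => (mem_filter.1 (hPR hr)).2
  have hPT : ∀ r ∈ P, r ≤ p.sqrt.sqrt := fun r hr => (mem_Ioc.1 (mem_filter.1 (hPR hr)).1).2
  have hch := le_choose_four hν hnν hPt
  rcases hc with hc | hc
  · have hD := choose_four_le_card_pow_eq_one P hPp hPT hT4 hc
    refine false_of_card_pow_sub_one hν hpν hn hnν hS (hch.trans (Nat.cast_le.2 hD)) ?_
      (card_mul_norm_binomSum_le hk hl _ fun x => by simp)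
    rw [← hpd]
    exact (Nat.cast_le.2 (card_pow_eq_one_le_gcd _)).trans hd
  · have hD := choose_four_le_card_pow_eq_one P hPp hPT hT4 hc
    exact false_of_card_pow_add_one hν hpν hn hS (hch.trans (Nat.cast_le.2 hD))
      (card_mul_norm_binomSum_sq_le hφ hl _ fun x hx => (mem_filter.1 hx).2)

end Auxiliary

theorem stmt_16 (p n k : ℕ) (A : ℤ) (hp : p.Prime) (hodd : Odd p)
    (hA : 2 * |A| < (p : ℤ)) (hA0 : ¬ (p : ℤ) ∣ A)
    (hk1 : 1 ≤ k) (hk2 : k < p - 1) (hk3 : Nat.gcd k (p - 1) = 1)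
    (hn : 2 ≤ n) (hnp : n < p)
    (hd : (Nat.gcd (k - 1) (p - 1) : ℝ) ≤ 0.006 * (p : ℝ) ^ ((89 : ℝ) / 92))
    (hbig : (9 * 10 ^ 34 : ℝ) * (n : ℝ) ^ ((92 : ℝ) / 3) < (p : ℝ)) :
    ∀ i j : ℕ, i ≤ n - 1 → j ≤ n - 1 →
      ¬ ((Iclass p n i).image (fmap p A k) ⊆ Iclass p n j) := by
  intro i j hi hj hsub
  have : Fact p.Prime := ⟨hp⟩
  have hA' : (A : ZMod p) ≠ 0 := by rwa [Ne, ZMod.intCast_zmod_eq_zero_iff_dvd]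
  refine false_of_class_map (i := i) (j := j) hA' hk1 hk3 hn (by omega) (by omega) hd hbig fun x hx1 hxp hxi => ?_
  have hx : x ∈ Iclass p n i := Finset.mem_filter.2 ⟨Finset.mem_Icc.2 ⟨hx1, hxp⟩, hxi⟩
  exact (Finset.mem_filter.1 (hsub (Finset.mem_image_of_mem (fmap p A k) hx))).2
end

section
/- Let p be an odd prime, n ≥ 2 an integer, and A, k integers with |A| < p/2, p ∤ A, 1 ≤ k < p−1 and gcd(k, p−1) = 1; set d = gcd(k−1, p−1). Suppose that (A, k) is not of the form (±1, 1) when n is even, and not of the form (±1, 1) or (±1, (p+1)/2) when n is odd. If p > 10^6 and d ≥ 0.66·n·p^{1/2}·(log p)², then for every pair i, j with 0 ≤ i, j ≤ n−1 one has f(I_i) ∩ (I ∖ I_j) ≠ ∅. The same conclusion holds if p ≥ 7 and d > 3·n·√p·(log p)². -/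
/-- Each nonzero point of the affine plane lies on exactly `|F|` of the lines `l.1 X + l.2 Y = c`. -/
lemma card_lines_through {F : Type*} [Field F] [Fintype F] [DecidableEq F] (c : F) {x : F × F}
    (hx : x ≠ 0) :
    (Finset.univ.filter fun l : F × F => l.1 * x.1 + l.2 * x.2 = c).card = Fintype.card F := by
  rw [← Finset.card_univ]
  by_cases h1 : x.1 = 0
  · have h2 : x.2 ≠ 0 := fun h2 => hx (Prod.ext h1 h2)
    refine Finset.card_bij' (fun l _ => l.1) (fun t _ => (t, c / x.2)) ?_ ?_ ?_ ?_
    · simp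
    · intro t _
      simp [h1, h2]
    · rintro ⟨l1, l2⟩ hl
      simp only [h1, Finset.mem_filter, Finset.mem_univ, true_and, mul_zero, zero_add] at hl
      simp [← hl, h2]
    · simp
  · refine Finset.card_bij' (fun l _ => l.2) (fun t _ => ((c - t * x.2) / x.1, t)) ?_ ?_ ?_ ?_
    · simp
    · intro t _
      simp [h1]
    · rintro ⟨l1, l2⟩ hl
      simp only [Finset.mem_filter, Finset.mem_univ, true_and] at hl
      simp [← hl, h1]
    · simp

/-- Two distinct points lie on at most one common line `l.1 X + l.2 Y = c`, if `c ≠ 0`. -/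
lemma card_lines_through_pair_le {F : Type*} [Field F] [Fintype F] [DecidableEq F] {c : F}
    (hc : c ≠ 0) {x y : F × F} (hxy : x ≠ y) :
    (Finset.univ.filter fun l : F × F =>
      l.1 * x.1 + l.2 * x.2 = c ∧ l.1 * y.1 + l.2 * y.2 = c).card ≤ 1 := by
  rw [Finset.card_le_one]
  rintro ⟨l1, l2⟩ hl ⟨m1, m2⟩ hm
  obtain ⟨x1, x2⟩ := x
  obtain ⟨y1, y2⟩ := y
  simp only [Finset.mem_filter, Finset.mem_univ, true_and] at hl hm
  obtain ⟨e1, e2⟩ := hl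
  obtain ⟨e3, e4⟩ := hm
  by_cases hD : x1 * y2 - x2 * y1 = 0
  · exfalso
    apply hxy
    have h1 : c * (x1 - y1) = 0 := by linear_combination (-x1) * e2 + y1 * e1 + l2 * hD
    have h2 : c * (x2 - y2) = 0 := by linear_combination (-x2) * e2 + y2 * e1 - l1 * hD
    simp only [mul_eq_zero, hc, false_or, sub_eq_zero] at h1 h2
    rw [h1, h2]
  · have h1 : (x1 * y2 - x2 * y1) * (l1 - m1) = 0 := by
      linear_combination y2 * e1 - x2 * e2 - y2 * e3 + x2 * e4
    have h2 : (x1 * y2 - x2 * y1) * (l2 - m2) = 0 := by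
      linear_combination -y1 * e1 + x1 * e2 + y1 * e3 - x1 * e4
    simp only [mul_eq_zero, hD, false_or, sub_eq_zero] at h1 h2
    rw [h1, h2]

/-- Large sets of points and lines in the plane over a finite field have an incidence. -/
lemma exists_incidence {F : Type*} [Field F] [Fintype F] [DecidableEq F] {c : F} (hc : c ≠ 0)
    (P L : Finset (F × F)) (hP : ∀ x ∈ P, x ≠ 0)
    (hcard : Fintype.card F ^ 3 < P.card * L.card) :
    ∃ x ∈ P, ∃ l ∈ L, l.1 * x.1 + l.2 * x.2 = c := by
  by_contra! hno
  set q := Fintype.card F with hq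
  let N : F × F → ℕ := fun l => (P.filter fun x => l.1 * x.1 + l.2 * x.2 = c).card
  have hN : ∀ l, N l = ∑ x ∈ P, if l.1 * x.1 + l.2 * x.2 = c then 1 else 0 := fun l => by
    simp [N]
  have hsum : ∑ l, N l = P.card * q := by
    simp_rw [hN]
    rw [Finset.sum_comm, Finset.sum_congr rfl (g := fun _ => q), Finset.sum_const, smul_eq_mul]
    intro x hx
    rw [hq, ← card_lines_through c (hP x hx)]
    simp
  have hsq : ∑ l, N l ^ 2 ≤ P.card * q + P.card ^ 2 := by
    have h1 : ∀ l, N l ^ 2 = ∑ x ∈ P, ∑ y ∈ P,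
        if l.1 * x.1 + l.2 * x.2 = c ∧ l.1 * y.1 + l.2 * y.2 = c then 1 else 0 := by
      intro l
      rw [sq, hN, Finset.sum_mul_sum]
      refine Finset.sum_congr rfl fun x _ => Finset.sum_congr rfl fun y _ => ?_
      split_ifs <;> simp_all
    simp_rw [h1]
    rw [Finset.sum_comm]
    have h2 : ∀ x ∈ P, ∑ l : F × F, ∑ y ∈ P,
        (if l.1 * x.1 + l.2 * x.2 = c ∧ l.1 * y.1 + l.2 * y.2 = c then 1 else 0)
          ≤ q + P.card := by
      intro x hx
      rw [Finset.sum_comm]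
      calc _ ≤ ∑ y ∈ P, ((if y = x then q else 0) + 1) := by
            refine Finset.sum_le_sum fun y hy => ?_
            rw [← Finset.card_filter]
            split_ifs with h
            · subst h
              simp only [and_self]
              rw [card_lines_through c (hP y hy)]
              omega
            · have := card_lines_through_pair_le hc (Ne.symm h)
              omega
        _ = q + P.card := by
            rw [Finset.sum_add_distrib]
            simp [hx]
    refine (Finset.sum_le_sum h2).trans ?_
    rw [Finset.sum_const, smul_eq_mul]
    exact le_of_eq (by ring)
  have hzero : ∀ l ∈ L, N l = 0 := by
    intro l hl
    simp only [N, Finset.card_eq_zero, Finset.filter_eq_empty_iff]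
    exact fun x hx => hno x hx l hl
  have hsum' : ∑ l ∈ Lᶜ, N l = P.card * q := by
    rw [← hsum, ← Finset.sum_add_sum_compl L N, Finset.sum_eq_zero hzero, zero_add]
  have hcs : (P.card * q) ^ 2 ≤ Lᶜ.card * (P.card * q + P.card ^ 2) := by
    calc (P.card * q) ^ 2 = (∑ l ∈ Lᶜ, N l) ^ 2 := by rw [hsum']
      _ ≤ _ := sq_sum_le_card_mul_sum_sq
      _ ≤ _ := Nat.mul_le_mul_left _ ?_
    exact (Finset.sum_le_sum_of_subset (Finset.subset_univ _)).trans hsq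
  have hL : Lᶜ.card + L.card = q ^ 2 := by
    rw [Finset.card_compl_add_card, Fintype.card_prod, sq]
  have hPpos : 0 < P.card := by
    rcases Nat.eq_zero_or_pos P.card with h | h
    · simp [h] at hcard
    · exact h
  have h3 : P.card * q ^ 2 ≤ Lᶜ.card * (q + P.card) := by
    refine Nat.le_of_mul_le_mul_left ?_ hPpos
    calc P.card * (P.card * q ^ 2) = (P.card * q) ^ 2 := by ring
      _ ≤ _ := hcs
      _ = _ := by ring
  zify at h3 hL hcard
  have : (Lᶜ.card : ℤ) = q ^ 2 - L.card := by linarith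
  rw [this] at h3
  nlinarith [mul_nonneg (Int.natCast_nonneg L.card) (Int.natCast_nonneg q)]

/-- A sumset of large sets meets every coset of a large multiplicative subgroup. -/
lemma exists_mul_add_eq {F : Type*} [Field F] [Fintype F] [DecidableEq F] {c : F} (hc : c ≠ 0)
    (H U V : Finset F) (hH0 : ∀ h ∈ H, h ≠ 0) (hH : ∀ g ∈ H, ∀ h ∈ H, g * h ∈ H)
    (hcard : Fintype.card F ^ 3 < H.card ^ 2 * (U.card * V.card)) :
    ∃ u ∈ U, ∃ v ∈ V, ∃ h ∈ H, h * (u + v) = c := by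
  let P := (H ×ˢ V).image fun z : F × F => (z.1, z.1 * z.2)
  let L := (H ×ˢ U).image fun z : F × F => (z.1 * z.2, z.1)
  have hPc : P.card = H.card * V.card := by
    rw [Finset.card_image_of_injOn, Finset.card_product]
    rintro ⟨a, b⟩ hab ⟨a', b'⟩ _ h
    simp only [Finset.coe_product, Set.mem_prod, Finset.mem_coe] at hab
    simp only [Prod.mk.injEq] at h
    obtain ⟨rfl, h⟩ := h
    rw [mul_left_cancel₀ (hH0 _ hab.1) h]
  have hLc : L.card = H.card * U.card := by
    rw [Finset.card_image_of_injOn, Finset.card_product]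
    rintro ⟨a, b⟩ hab ⟨a', b'⟩ _ h
    simp only [Finset.coe_product, Set.mem_prod, Finset.mem_coe] at hab
    simp only [Prod.mk.injEq] at h
    obtain ⟨h, rfl⟩ := h
    rw [mul_left_cancel₀ (hH0 _ hab.1) h]
  obtain ⟨x, hx, l, hl, h⟩ := exists_incidence hc P L (by
      intro x hx h0
      simp only [P, Finset.mem_image, Finset.mem_product] at hx
      obtain ⟨z, hz, rfl⟩ := hx
      exact hH0 _ hz.1 (congrArg Prod.fst h0)) (by
      rw [hPc, hLc]
      refine hcard.trans_eq ?_
      ring)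
  simp only [P, L, Finset.mem_image, Finset.mem_product] at hx hl
  obtain ⟨⟨g, v⟩, ⟨hg, hv⟩, rfl⟩ := hx
  obtain ⟨⟨g', u⟩, ⟨hg', hu⟩, rfl⟩ := hl
  refine ⟨u, hu, v, hv, g' * g, hH _ hg' _ hg, ?_⟩
  rw [← h]
  ring

/-- A progression modulo `p` which stays in an arc and whose step is shorter than the complementary
gap does not wind around the circle. -/
lemma exists_common_lift {p X c lo hi S : ℤ} (hc : |c| < p - (hi - lo))
    (h : ∀ σ, 0 ≤ σ → σ ≤ S → ∃ s, lo ≤ s ∧ s ≤ hi ∧ p ∣ X + c * σ - s) :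
    ∃ k, ∀ σ, 0 ≤ σ → σ ≤ S → lo ≤ X + c * σ - p * k ∧ X + c * σ - p * k ≤ hi := by
  rcases lt_or_ge S 0 with hS | hS
  · exact ⟨0, fun σ h0 h1 => by omega⟩
  obtain ⟨s, h1, h2, k, hk⟩ := h 0 le_rfl hS
  refine ⟨k, fun σ h0 => ?_⟩
  induction σ, h0 using Int.leInduction with
  | base =>
    intro _
    constructor <;> linarith
  | succ σ h0 ih =>
    intro hσ
    obtain ⟨i1, i2⟩ := ih (by omega)
    obtain ⟨s', h1', h2', k', hk'⟩ := h (σ + 1) (by omega) hσ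
    obtain ⟨c1, c2⟩ := abs_lt.1 hc
    have hkk : k' = k := by
      have hp : 0 < p := by linarith [abs_nonneg c]
      have e : p * (k' - k) = (X + c * σ - p * k) + c - s' := by linear_combination -hk'
      have l1 : p * (k' - k) < p * 1 := by linarith
      have l2 : p * (-1) < p * (k' - k) := by linarith
      have := lt_of_mul_lt_mul_left l1 hp.le
      have := lt_of_mul_lt_mul_left l2 hp.le
      omega
    subst hkk
    constructor <;> linarith

/-- `HitsArc p N a β` : for every set `U` of at least `(N + 1) / 125` integers and every translate
`w + U - U` inside `[1, N - 1]`, the map `t ↦ a t + β` sends some element of it to the arc `[0, N]`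
modulo `p`. -/
def HitsArc (p N a β : ℤ) : Prop :=
  ∀ (U : Finset ℤ) (w : ℤ), (∀ u ∈ U, ∀ u' ∈ U, 1 ≤ w + u - u' ∧ w + u - u' ≤ N - 1) →
    N + 1 ≤ 125 * (U.card : ℤ) →
    ∃ u ∈ U, ∃ u' ∈ U, ∃ s, 0 ≤ s ∧ s ≤ N ∧ p ∣ a * (w + u - u') + β - s

lemma HitsArc.neg {p N a β : ℤ} (h : HitsArc p N a β) : HitsArc p N (-a) (N - β) := by
  intro U w hw hU
  obtain ⟨u, hu, u', hu', s, h0, h1, hs⟩ := h U w hw hU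
  refine ⟨u, hu, u', hu', N - s, by omega, by omega, ?_⟩
  rw [show -a * (w + u - u') + (N - β) - (N - s) = -(a * (w + u - u') + β - s) by ring, dvd_neg]
  exact hs

lemma HitsArc.mem_wide_arc {p N a β : ℤ} (hp : 0 < p) (hN : 15900 ≤ N) (h : HitsArc p N a β)
    {w : ℤ} (hw1 : N / 4 ≤ w) (hw2 : w ≤ N - N / 4) :
    ∃ s, -(p / 31) ≤ s ∧ s ≤ N + p / 31 ∧ p ∣ a * w + β - s := by
  have hmaps : ∀ u ∈ Finset.Ico 0 (N / 4), 31 * (a * u % p) / p ∈ Finset.Ico (0 : ℤ) 31 := by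
    intro u _
    have h1 := Int.emod_nonneg (a * u) hp.ne'
    have h2 := Int.emod_lt_of_pos (a * u) hp
    rw [Finset.mem_Ico]
    exact ⟨Int.ediv_nonneg (by omega) hp.le, Int.ediv_lt_of_lt_mul hp (by omega)⟩
  obtain ⟨y, -, hy⟩ := Finset.exists_le_card_fiber_of_mul_le_card_of_maps_to (n := (N / 124).toNat)
    hmaps ⟨0, by simp⟩ (by
      rw [Int.card_Ico, Int.card_Ico, show (31 - 0 : ℤ).toNat = 31 from rfl]
      omega)
  obtain ⟨u, hu, u', hu', s, h0, h1, hs⟩ :=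
    h ((Finset.Ico 0 (N / 4)).filter fun u => 31 * (a * u % p) / p = y) w (by
    intro u hu u' hu'
    simp only [Finset.mem_filter, Finset.mem_Ico] at hu hu'
    omega) (by
    refine le_trans ?_ (mul_le_mul_of_nonneg_left (Int.ofNat_le.2 hy) (by norm_num))
    omega)
  simp only [Finset.mem_filter] at hu hu'
  have d1 : |a * u % p - a * u' % p| ≤ p / 31 := by
    have m1 := Int.mul_ediv_add_emod (31 * (a * u % p)) p
    have m2 := Int.mul_ediv_add_emod (31 * (a * u' % p)) p
    have m3 := Int.emod_nonneg (31 * (a * u % p)) hp.ne'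
    have m4 := Int.emod_nonneg (31 * (a * u' % p)) hp.ne'
    have m5 := Int.emod_lt_of_pos (31 * (a * u % p)) hp
    have m6 := Int.emod_lt_of_pos (31 * (a * u' % p)) hp
    rw [hu.2] at m1
    rw [hu'.2] at m2
    rw [abs_le]
    omega
  obtain ⟨d2, d3⟩ := abs_le.1 d1
  refine ⟨s - (a * u % p - a * u' % p), by omega, by omega, ?_⟩
  have e1 := Int.mul_ediv_add_emod (a * u) p
  have e2 := Int.mul_ediv_add_emod (a * u') p
  have : a * w + β - (s - (a * u % p - a * u' % p)) =
      (a * (w + u - u') + β - s) - p * (a * u / p - a * u' / p) := by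
    linear_combination e1 - e2
  rw [this]
  exact dvd_sub hs (dvd_mul_right _ _)

lemma HitsArc.exists_near {p N a β q : ℤ} (hq1 : 1 ≤ q) (hq2 : q ≤ 2) (hN : 0 ≤ N)
    (h : HitsArc p N a β) {w : ℤ} (hw1 : 2 * (N / 125) + 1 ≤ w)
    (hw2 : w ≤ N - (2 * (N / 125) + 1)) :
    ∃ σ s, -(N / 125) ≤ σ ∧ σ ≤ N / 125 ∧ 0 ≤ s ∧ s ≤ N ∧ p ∣ a * (w + q * σ) + β - s := by
  have hinj : Function.Injective fun s : ℤ => q * s :=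
    fun x y hxy => mul_left_cancel₀ (by omega : q ≠ 0) hxy
  obtain ⟨u, hu, u', hu', s, h0, h1, hs⟩ :=
    h ((Finset.Icc 0 (N / 125)).image fun s : ℤ => q * s) w (by
      intro u hu u' hu'
      simp only [Finset.mem_image, Finset.mem_Icc] at hu hu'
      obtain ⟨x, hx, rfl⟩ := hu
      obtain ⟨y, hy, rfl⟩ := hu'
      obtain rfl | rfl : q = 1 ∨ q = 2 := by omega
      all_goals omega) (by
      rw [Finset.card_image_of_injective _ hinj, Int.card_Icc]
      omega)
  simp only [Finset.mem_image, Finset.mem_Icc] at hu hu'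
  obtain ⟨x, hx, rfl⟩ := hu
  obtain ⟨y, hy, rfl⟩ := hu'
  refine ⟨x - y, s, by omega, by omega, h0, h1, ?_⟩
  convert hs using 1
  ring

lemma HitsArc.false_of_two_le {p N a β : ℤ} (hN : 15900 ≤ N) (hNp : 2 * N < p)
    (h : HitsArc p N a β) (ha : 2 ≤ a) (hap : a < p - (N + 2 * (p / 31))) : False := by
  have hwide : a * (N - 2 * (N / 4)) ≤ N + 2 * (p / 31) := by
    obtain ⟨k, hk⟩ := exists_common_lift (p := p) (X := a * (N / 4) + β) (c := a)
      (lo := -(p / 31)) (hi := N + p / 31) (S := N - 2 * (N / 4))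
      (by rw [abs_of_nonneg (by omega)]; omega) (by
        intro σ h0 h1
        obtain ⟨s, s1, s2, hs⟩ := h.mem_wide_arc (by omega) hN (w := N / 4 + σ) (by omega) (by omega)
        refine ⟨s, s1, s2, ?_⟩
        convert hs using 1
        ring)
    have k1 := hk 0 le_rfl (by omega)
    have k2 := hk (N - 2 * (N / 4)) (by omega) le_rfl
    linarith [k1.1, k2.2]
  have e0 : 2 * (N - 2 * (N / 4)) ≥ N := by omega
  have hp31 : 31 * (p / 31) ≤ p := by omega
  have hG : 125 * (N / 125) ≤ N := by omega
  have haN : a * N ≤ 2 * N + 4 * (p / 31) := by nlinarith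
  have haG : 125 * (a * (N / 125)) ≤ a * N := by nlinarith
  have haN' : 15900 * a ≤ a * N := by nlinarith
  have haG0 : 0 ≤ a * (N / 125) := by positivity
  have hnear : a * (N - 2 * (2 * (N / 125) + 1)) ≤ N + 2 * (a * (N / 125)) := by
    obtain ⟨k, hk⟩ := exists_common_lift (p := p) (X := a * (2 * (N / 125) + 1) + β) (c := a)
      (lo := -(a * (N / 125))) (hi := N + a * (N / 125)) (S := N - 2 * (2 * (N / 125) + 1))
      (by rw [abs_of_nonneg (by omega)]; omega) (by
        intro σ h0 h1
        obtain ⟨τ, s, t1, t2, s1, s2, hs⟩ := h.exists_near (q := 1) le_rfl (by norm_num) (by omega)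
          (w := 2 * (N / 125) + 1 + σ) (by omega) (by omega)
        refine ⟨s - a * τ, by nlinarith, by nlinarith, ?_⟩
        convert hs using 1
        ring)
    have k1 := hk 0 le_rfl (by omega)
    have k2 := hk (N - 2 * (2 * (N / 125) + 1)) (by omega) le_rfl
    linarith [k1.1, k2.2]
  have : 2 * (N - 6 * (N / 125) - 2) ≤ a * (N - 6 * (N / 125) - 2) :=
    mul_le_mul_of_nonneg_right ha (by omega)
  have : a * (N - 6 * (N / 125) - 2) ≤ N := by linarith
  omega

lemma HitsArc.false_of_near_half {p N a β : ℤ} (hN : 15900 ≤ N) (hNp : 2 * N < p)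
    (h : HitsArc p N a β) (hap : p - (N + 2 * (p / 31)) ≤ a) (hap2 : 2 * a < p) : False := by
  obtain ⟨b, hb⟩ : ∃ b, b = p - 2 * a := ⟨_, rfl⟩
  have hb1 : 1 ≤ b := by omega
  have habs : |-b| = b := by rw [abs_neg, abs_of_nonneg (by omega)]
  have hb5 : b ≤ 5 := by
    obtain ⟨k, hk⟩ := exists_common_lift (p := p) (X := a * (N / 4) + β) (c := -b)
      (lo := -(p / 31)) (hi := N + p / 31) (S := N / 4)
      (by rw [habs]; omega) (by
        intro σ h0 h1
        obtain ⟨s, s1, s2, hs⟩ :=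
          h.mem_wide_arc (by omega) hN (w := N / 4 + 2 * σ) (by omega) (by omega)
        refine ⟨s, s1, s2, ?_⟩
        rw [show a * (N / 4) + β + -b * σ - s = (a * (N / 4 + 2 * σ) + β - s) - p * σ by
          rw [hb]; ring]
        exact dvd_sub hs (dvd_mul_right _ _))
    have k1 := hk 0 le_rfl (by omega)
    have k2 := hk (N / 4) (by omega) le_rfl
    have k3 : b * (N / 4) ≤ N + 2 * (p / 31) := by linarith [k1.2, k2.1]
    by_contra! hb6
    have : 6 * (N / 4) ≤ b * (N / 4) := mul_le_mul_of_nonneg_right (by omega) (by omega)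
    omega
  obtain ⟨G, hG⟩ : ∃ G, G = N / 125 := ⟨_, rfl⟩
  have hbG1 : b * G ≤ 5 * G := mul_le_mul_of_nonneg_right hb5 (by omega)
  have hbG0 : 1 * G ≤ b * G := mul_le_mul_of_nonneg_right hb1 (by omega)
  have key : ∀ e, 0 ≤ e → e ≤ 1 → ∃ k, ∀ σ, 0 ≤ σ → σ ≤ N / 4 →
      -(b * G) ≤ a * (2 * G + 1 + e) + β + -b * σ - p * k ∧
      a * (2 * G + 1 + e) + β + -b * σ - p * k ≤ N + b * G := by
    intro e he0 he1
    refine exists_common_lift (by rw [habs]; omega) ?_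
    intro σ h0 h1
    obtain ⟨τ, s, t1, t2, s1, s2, hs⟩ := h.exists_near (q := 2) (by norm_num) le_rfl (by omega)
      (w := 2 * G + 1 + e + 2 * σ) (by omega) (by omega)
    rw [← hG] at t1 t2
    refine ⟨s + b * τ, by nlinarith, by nlinarith, ?_⟩
    rw [show a * (2 * G + 1 + e) + β + -b * σ - (s + b * τ) =
      (a * (2 * G + 1 + e + 2 * σ + 2 * τ) + β - s) - p * (σ + τ) by rw [hb]; ring]
    exact dvd_sub hs (dvd_mul_right _ _)
  obtain ⟨k, hk⟩ := key 0 le_rfl (by norm_num)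
  obtain ⟨l, hl⟩ := key 1 (by norm_num) le_rfl
  have k0 := hk 0 le_rfl (by omega)
  have kS := hk (N / 4) (by omega) le_rfl
  have l0 := hl 0 le_rfl (by omega)
  have lS := hl (N / 4) (by omega) le_rfl
  have hS : b * (20 * G) ≤ b * (N / 4) := mul_le_mul_of_nonneg_left (by omega) (by omega)
  rcases lt_trichotomy k l with hkl | rfl | hkl
  · have : p * (k + 1) ≤ p * l := mul_le_mul_of_nonneg_left (by omega) (by omega)
    linarith [k0.2, lS.1]
  · have hG127 : 127 ≤ G := by omega
    linarith [kS.1, l0.2]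
  · have : p * (l + 1) ≤ p * k := mul_le_mul_of_nonneg_left (by omega) (by omega)
    linarith [k0.1, l0.2]

lemma HitsArc.abs_le_one {p N a β : ℤ} (hN : 15900 ≤ N) (hNp : 2 * N < p)
    (h : HitsArc p N a β) (hap : 2 * |a| < p) : |a| ≤ 1 := by
  by_contra! ha
  have h' : ∃ β', HitsArc p N |a| β' := by
    rcases abs_choice a with e | e <;> rw [e]
    · exact ⟨β, h⟩
    · exact ⟨_, h.neg⟩
  obtain ⟨β', h'⟩ := h'
  rcases lt_or_ge |a| (p - (N + 2 * (p / 31))) with h1 | h1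
  · exact h'.false_of_two_le hN hNp ha h1
  · exact h'.false_of_near_half hN hNp h1 hap

lemma log_lower_bound {p m : ℕ} (h : 2 ^ m ≤ p) : 0.693 * (m : ℝ) ≤ Real.log p := by
  have h1 : Real.log ((2 : ℝ) ^ m) ≤ Real.log p :=
    Real.log_le_log (by positivity) (by exact_mod_cast h)
  rw [Real.log_pow] at h1
  nlinarith [Real.log_two_gt_d9, Nat.cast_nonneg (α := ℝ) m]

lemma log_sq_lower_bound {p : ℕ} (h : 10 ^ 6 < p) : 190 ≤ Real.log p ^ 2 := by
  have h0 : Real.log ((10 : ℝ) ^ 6) ≤ Real.log p :=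
    Real.log_le_log (by positivity) (by exact_mod_cast h.le)
  have h1 : Real.log ((2 : ℝ) ^ 93) ≤ Real.log ((10 : ℝ) ^ 28) :=
    Real.log_le_log (by positivity) (by norm_num)
  rw [Real.log_pow] at h0
  rw [Real.log_pow, Real.log_pow] at h1
  push_cast at h0 h1
  have h2 := Real.log_two_gt_d9
  have h3 : (13.8 : ℝ) ≤ Real.log p := by linarith
  nlinarith

lemma gcd_sq_lower_bound {p n d : ℕ} (hn : 2 ≤ n) (hd : d ≤ p)
    (hcond : (10 ^ 6 < p ∧ (0.66 : ℝ) * (n : ℝ) * Real.sqrt p * Real.log p ^ 2 ≤ (d : ℝ)) ∨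
      (7 ≤ p ∧ 3 * (n : ℝ) * Real.sqrt p * Real.log p ^ 2 < (d : ℝ))) :
    15625 * n ^ 2 * p ≤ d ^ 2 := by
  have hs : 0 ≤ Real.sqrt p := Real.sqrt_nonneg _
  have hss : Real.sqrt p * Real.sqrt p = p := Real.mul_self_sqrt (by positivity)
  have hnR : (2 : ℝ) ≤ n := by exact_mod_cast hn
  have hdR : (d : ℝ) ≤ p := by exact_mod_cast hd
  have key : 125 * ((n : ℝ) * Real.sqrt p) ≤ d := by
    have hns : 0 ≤ (n : ℝ) * Real.sqrt p := by positivity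
    rcases hcond with ⟨hp, h⟩ | ⟨hp, h⟩
    · have := log_sq_lower_bound hp
      nlinarith
    · have hspos : 0 < Real.sqrt p := by
        apply Real.sqrt_pos.2
        have : 0 < p := by omega
        exact_mod_cast this
      have h1 : 6 * Real.log p ^ 2 ≤ Real.sqrt p := by
        have : 6 * Real.log p ^ 2 * Real.sqrt p ≤ Real.sqrt p * Real.sqrt p := by
          nlinarith [mul_nonneg hs (sq_nonneg (Real.log p))]
        exact le_of_mul_le_mul_right this hspos
      have step : ∀ (m m' : ℕ), 2 ^ m ≤ p →
          ((2 : ℝ) ^ m' ≤ (6 * (0.693 * (m : ℝ)) ^ 2) ^ 2) → 2 ^ m' ≤ p := by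
        intro m m' hm hm'
        have h2 := log_lower_bound hm
        have h3 : (0.693 * (m : ℝ)) ^ 2 ≤ Real.log p ^ 2 :=
          pow_le_pow_left₀ (by positivity) h2 2
        have h4 : (6 * (0.693 * (m : ℝ)) ^ 2) ^ 2 ≤ Real.sqrt p ^ 2 :=
          pow_le_pow_left₀ (by positivity) (by linarith) 2
        rw [sq (Real.sqrt p), hss] at h4
        exact_mod_cast hm'.trans h4
      have h7 := step 2 7 (by omega) (by norm_num)
      have h14 := step 7 14 h7 (by norm_num)
      have h2 := log_lower_bound h14
      have h3 : (42 : ℝ) ≤ Real.log p ^ 2 := by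
        push_cast at h2
        nlinarith
      nlinarith
  have h2 : (125 * ((n : ℝ) * Real.sqrt p)) ^ 2 ≤ (d : ℝ) ^ 2 :=
    pow_le_pow_left₀ (by positivity) key 2
  have h3 : (125 * ((n : ℝ) * Real.sqrt p)) ^ 2 = 15625 * (n : ℝ) ^ 2 * p := by
    linear_combination 15625 * (n : ℝ) ^ 2 * hss
  rw [h3] at h2
  exact_mod_cast h2

/-- The solutions of `x ^ m = 1` in `ZMod p`, coming from units. -/
def powKernel (p m : ℕ) [Fact p.Prime] : Finset (ZMod p) :=
  (Finset.univ.filter fun x : (ZMod p)ˣ => x ^ m = 1).image fun x : (ZMod p)ˣ => (x : ZMod p)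

lemma card_powKernel (p m : ℕ) [Fact p.Prime] : (powKernel p m).card = Nat.gcd m (p - 1) := by
  rw [powKernel, Finset.card_image_of_injective _ fun x y h => Units.ext h, Nat.gcd_comm,
    ← ZMod.card_units p, ← Nat.card_eq_fintype_card, ← IsCyclic.card_powMonoidHom_ker,
    Nat.card_eq_fintype_card, Fintype.card_subtype]
  simp [MonoidHom.mem_ker]

lemma exists_mem_Iclass_pow_eq {p n m i : ℕ} [Fact p.Prime] (hn : 0 < n) (hi : i < n) (hnp : n < p)
    (hd : 15625 * n ^ 2 * p ≤ Nat.gcd m (p - 1) ^ 2) {c : ZMod p} (hc : c ≠ 0) (U : Finset ℤ) (w : ℤ)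
    (hw : ∀ u ∈ U, ∀ u' ∈ U, 1 ≤ w + u - u' ∧ w + u - u' ≤ ((p / n : ℕ) : ℤ) - 1)
    (hU : ((p / n : ℕ) : ℤ) + 1 ≤ 125 * (U.card : ℤ)) :
    ∃ u ∈ U, ∃ u' ∈ U, ∃ x ∈ Iclass p n i,
      (x : ℤ) = i + n * (w + u - u') ∧ (x : ZMod p) ^ m = c ^ m := by
  have hp : p.Prime := Fact.out
  have hn0 : (n : ZMod p) ≠ 0 := by
    rw [Ne, ZMod.natCast_eq_zero_iff]
    exact Nat.not_dvd_of_pos_of_lt hn hnp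
  have hNp : p / n ≤ p := Nat.div_le_self _ _
  have hinj : ∀ u ∈ U, ∀ u' ∈ U, (u : ZMod p) = u' → u = u' := by
    intro u hu u' hu' h
    have h1 := hw u hu u' hu'
    have h2 := hw u' hu' u hu
    rw [ZMod.intCast_eq_intCast_iff_dvd_sub] at h
    have := Int.eq_zero_of_abs_lt_dvd h (by rw [abs_lt]; omega)
    omega
  have hU1 : (U.image fun u : ℤ => (n : ZMod p) * u).card = U.card :=
    Finset.card_image_of_injOn fun u hu u' hu' h => hinj u hu u' hu' (mul_left_cancel₀ hn0 h)
  have hV1 : (U.image fun u : ℤ => (i : ZMod p) + n * (w - u)).card = U.card :=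
    Finset.card_image_of_injOn fun u hu u' hu' h =>
      hinj u hu u' hu' (sub_right_injective (mul_left_cancel₀ hn0 (add_left_cancel h)))
  have hcard : Fintype.card (ZMod p) ^ 3 < (powKernel p m).card ^ 2 *
      ((U.image fun u : ℤ => (n : ZMod p) * u).card *
        (U.image fun u : ℤ => (i : ZMod p) + n * (w - u)).card) := by
    rw [hU1, hV1, card_powKernel, ZMod.card]
    have h1 : p < n * (p / n + 1) := Nat.lt_mul_div_succ p hn
    have h2 : p < n * (125 * U.card) := h1.trans_le (Nat.mul_le_mul_left _ (by exact_mod_cast hU))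
    calc p ^ 3 = p ^ 2 * p := by ring
      _ < (n * (125 * U.card)) ^ 2 * p :=
        Nat.mul_lt_mul_of_pos_right (Nat.pow_lt_pow_left h2 (by norm_num)) hp.pos
      _ = 15625 * n ^ 2 * p * (U.card * U.card) := by ring
      _ ≤ _ := Nat.mul_le_mul_right _ hd
  obtain ⟨y, hy, z, hz, h, hh, e⟩ := exists_mul_add_eq hc (powKernel p m) _ _ (by
      intro h hh
      simp only [powKernel, Finset.mem_image] at hh
      obtain ⟨g, -, rfl⟩ := hh
      exact g.ne_zero) (by
      intro g hg h hh
      simp only [powKernel, Finset.mem_image, Finset.mem_filter, Finset.mem_univ, true_and] at *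
      obtain ⟨g, hg, rfl⟩ := hg
      obtain ⟨h, hh, rfl⟩ := hh
      exact ⟨g * h, by rw [mul_pow, hg, hh, one_mul], by push_cast; rfl⟩) hcard
  simp only [Finset.mem_image] at hy hz
  obtain ⟨u, hu, rfl⟩ := hy
  obtain ⟨u', hu', rfl⟩ := hz
  have hhm : h ^ m = 1 := by
    simp only [powKernel, Finset.mem_image, Finset.mem_filter, Finset.mem_univ, true_and] at hh
    obtain ⟨g, hg, rfl⟩ := hh
    rw [← Units.val_pow_eq_pow_val, hg, Units.val_one]
  obtain ⟨t1, t2⟩ := hw u hu u' hu'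
  obtain ⟨t, ht⟩ := Int.eq_ofNat_of_zero_le (show 0 ≤ w + u - u' by omega)
  rw [ht] at t1 t2
  have hle : n * (t + 1) ≤ p :=
    (Nat.mul_le_mul_left n (by omega)).trans (Nat.mul_div_le p n)
  refine ⟨u, hu, u', hu', i + n * t, ?_, ?_, ?_⟩
  · rw [Iclass, Finset.mem_filter, Finset.mem_Icc, Nat.add_mul_mod_self_left, Nat.mod_eq_of_lt hi]
    have : n * 1 ≤ n * t := Nat.mul_le_mul_left n (by omega)
    rw [Nat.mul_add, Nat.mul_one] at hle
    omega
  · rw [ht]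
    push_cast
    ring
  · rw [← e, mul_pow, hhm, one_mul]
    have : ((w + u - u' : ℤ) : ZMod p) = ((t : ℤ) : ZMod p) := by rw [ht]
    push_cast at this
    push_cast
    rw [← this]
    ring

lemma hitsArc_of_fmap_mem {p n k i j : ℕ} [Fact p.Prime] {A a β : ℤ} (hn : 0 < n) (hi : i < n)
    (hnp : n < p) (hk : 1 ≤ k) (hd : 15625 * n ^ 2 * p ≤ Nat.gcd (k - 1) (p - 1) ^ 2)
    (hf : ∀ x ∈ Iclass p n i, fmap p A k x ∈ Iclass p n j)
    {c : ZMod p} (hc : c ≠ 0) (ha : (a : ZMod p) = A * c ^ (k - 1))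
    (hβ : (n : ZMod p) * β = a * i - j) : HitsArc p (p / n : ℕ) a β := by
  intro U w hw hU
  obtain ⟨u, hu, u', hu', x, hx, hxt, hxc⟩ := exists_mem_Iclass_pow_eq hn hi hnp hd hc U w hw hU
  have hn0 : (n : ZMod p) ≠ 0 := by
    rw [Ne, ZMod.natCast_eq_zero_iff]
    exact Nat.not_dvd_of_pos_of_lt hn hnp
  have hy := hf x hx
  have hyval : ((fmap p A k x : ℕ) : ZMod p) = a * x := by
    rw [fmap, ZMod.natCast_zmod_val, ha, ← hxc, mul_assoc, ← pow_succ, Nat.sub_add_cancel hk]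
  generalize fmap p A k x = y at hy hyval
  rw [Iclass, Finset.mem_filter, Finset.mem_Icc] at hy
  refine ⟨u, hu, u', hu', (y / n : ℕ), Int.natCast_nonneg _,
    Int.ofNat_le.2 (Nat.div_le_div_right (by omega)), ?_⟩
  rw [← ZMod.intCast_zmod_eq_zero_iff_dvd]
  refine (mul_eq_zero.1 (?_ : (n : ZMod p) * _ = 0)).resolve_left hn0
  have h1 : (y : ZMod p) = n * (y / n : ℕ) + j := by
    have := Nat.div_add_mod y n
    rw [hy.2] at this
    exact_mod_cast congrArg (Nat.cast (R := ZMod p)) this.symm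
  have h2 : (x : ZMod p) = i + n * (w + u - u') := by
    exact_mod_cast congrArg (Int.cast (R := ZMod p)) hxt
  rw [h1, h2] at hyval
  simp only [Int.cast_sub, Int.cast_add, Int.cast_mul, Int.cast_natCast]
  linear_combination hβ - hyval

/-- If `f` maps `I_i` into `I_j`, every multiplier `A c ^ (k - 1)` is `1` (and then `i = j`) or `-1`
(and then `i + j ≡ p` modulo `n`). -/
lemma multiplier_of_fmap_mem {p n k i j : ℕ} [Fact p.Prime] (hodd : Odd p) {A : ℤ} (hn : 2 ≤ n)
    (hi : i < n) (hA0 : (A : ZMod p) ≠ 0) (hk : 1 ≤ k) (hpn : 15625 * n ^ 2 < p)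
    (hd : 15625 * n ^ 2 * p ≤ Nat.gcd (k - 1) (p - 1) ^ 2)
    (hf : ∀ x ∈ Iclass p n i, fmap p A k x ∈ Iclass p n j) {c : ZMod p} (hc : c ≠ 0) :
    (A * c ^ (k - 1) = 1 ∧ i = j) ∨ (A * c ^ (k - 1) = -1 ∧ p % n = (i + j) % n) := by
  have hp : p.Prime := Fact.out
  have hnp : n < p := by nlinarith
  have hN : 15900 ≤ p / n := by
    rw [Nat.le_div_iff_mul_le (by omega)]
    nlinarith
  have hNp : 2 * (p / n) < p := by
    have h1 : 2 * (p / n) ≤ n * (p / n) := Nat.mul_le_mul_right _ hn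
    have h2 := Nat.mul_div_le p n
    obtain ⟨q, hq⟩ := hodd
    omega
  have hn0 : (n : ZMod p) ≠ 0 := by
    rw [Ne, ZMod.natCast_eq_zero_iff]
    exact Nat.not_dvd_of_pos_of_lt (by omega) hnp
  obtain ⟨a, ha⟩ : ∃ a, a = (A * c ^ (k - 1) : ZMod p).valMinAbs := ⟨_, rfl⟩
  have hac : (a : ZMod p) = A * c ^ (k - 1) := by rw [ha, ZMod.coe_valMinAbs]
  have ha2 : 2 * |a| < p := by
    have h1 := ZMod.natAbs_valMinAbs_le (A * c ^ (k - 1) : ZMod p)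
    rw [← ha] at h1
    rw [Int.abs_eq_natAbs]
    obtain ⟨q, hq⟩ := hodd
    omega
  obtain ⟨β, hβ⟩ := ZMod.intCast_surjective ((n : ZMod p)⁻¹ * (a * i - j) : ZMod p)
  have harc : HitsArc p (p / n : ℕ) a β :=
    hitsArc_of_fmap_mem (by omega) hi hnp hk hd hf hc hac (by
      rw [hβ, mul_inv_cancel_left₀ hn0])
  have ha1 := harc.abs_le_one (by omega) (by omega) ha2
  have ha0 : a ≠ 0 := by
    rintro rfl
    rw [Int.cast_zero] at hac
    exact mul_ne_zero hA0 (pow_ne_zero _ hc) hac.symm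
  obtain ⟨u, -, u', -, x, hx, -, hxc⟩ := exists_mem_Iclass_pow_eq (by omega) hi hnp hd hc
    (Finset.Ico 0 ((p / n : ℕ) / 4 : ℤ)) ((p / n : ℕ) / 2) (by
      intro u hu u' hu'
      rw [Finset.mem_Ico] at hu hu'
      omega) (by
      rw [Int.card_Ico]
      omega)
  have hy := hf x hx
  have hyval : ((fmap p A k x : ℕ) : ZMod p) = a * x := by
    rw [fmap, ZMod.natCast_zmod_val, hac, ← hxc, mul_assoc, ← pow_succ, Nat.sub_add_cancel hk]
  generalize fmap p A k x = y at hy hyval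
  rw [Iclass, Finset.mem_filter, Finset.mem_Icc] at hx hy
  rw [← hac]
  have haa : a = 1 ∨ a = -1 := by
    rw [abs_le] at ha1
    omega
  rcases haa with rfl | rfl
  · refine Or.inl ⟨Int.cast_one, ?_⟩
    rw [Int.cast_one, one_mul, ZMod.natCast_eq_natCast_iff', Nat.mod_eq_of_lt (by omega),
      Nat.mod_eq_of_lt (by omega)] at hyval
    rw [← hx.2, ← hy.2, hyval]
  · refine Or.inr ⟨by push_cast; rfl, ?_⟩
    have h0 : ((x + y : ℕ) : ZMod p) = 0 := by
      push_cast at hyval ⊢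
      rw [hyval]
      ring
    rw [ZMod.natCast_eq_zero_iff] at h0
    obtain ⟨q, hq⟩ := h0
    have hq1 : q = 1 := by
      have h1 : q < 2 := by
        by_contra! h
        have : p * 2 ≤ p * q := Nat.mul_le_mul_left _ h
        omega
      have h2 : q ≠ 0 := by
        rintro rfl
        omega
      omega
    rw [hq1, mul_one] at hq
    rw [← hq, ← hx.2, ← hy.2, ← Nat.add_mod]

theorem stmt_17 (p n k : ℕ) (A : ℤ) (hp : p.Prime) (hodd : Odd p) (hn : 2 ≤ n)
    (hA : 2 * |A| < (p : ℤ)) (hA0 : ¬ (p : ℤ) ∣ A)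
    (hk1 : 1 ≤ k) (hk2 : k < p - 1) (hk3 : Nat.gcd k (p - 1) = 1)
    (hex : (Even n ∧ ¬ ((A = 1 ∨ A = -1) ∧ k = 1)) ∨
           (Odd n ∧ ¬ ((A = 1 ∨ A = -1) ∧ (k = 1 ∨ k = (p + 1) / 2))))
    (hcond : (10 ^ 6 < p ∧
        (0.66 : ℝ) * (n : ℝ) * Real.sqrt p * Real.log p ^ 2 ≤
          (Nat.gcd (k - 1) (p - 1) : ℝ)) ∨
      (7 ≤ p ∧
        3 * (n : ℝ) * Real.sqrt p * Real.log p ^ 2 < (Nat.gcd (k - 1) (p - 1) : ℝ))) :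
    ∀ i j : ℕ, i ≤ n - 1 → j ≤ n - 1 →
      ((Iclass p n i).image (fmap p A k) ∩
        (Finset.Icc 1 (p - 1) \ Iclass p n j)).Nonempty := by
  intro i j hi hj
  have : Fact p.Prime := ⟨hp⟩
  have hp2 := hp.two_le
  have hdvd := Nat.gcd_dvd_right (k - 1) (p - 1)
  have hdle : Nat.gcd (k - 1) (p - 1) ≤ p - 1 := Nat.le_of_dvd (by omega) hdvd
  have hd := gcd_sq_lower_bound hn (hdle.trans (Nat.sub_le _ _)) hcond
  have hpn : 15625 * n ^ 2 < p := by
    have h1 : Nat.gcd (k - 1) (p - 1) ^ 2 < p ^ 2 := Nat.pow_lt_pow_left (by omega) (by norm_num)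
    rw [sq p] at h1
    exact Nat.lt_of_mul_lt_mul_right (hd.trans_lt h1)
  have hA0' : (A : ZMod p) ≠ 0 := by rwa [Ne, ZMod.intCast_zmod_eq_zero_iff_dvd]
  by_contra hempty
  have hf : ∀ x ∈ Iclass p n i, fmap p A k x ∈ Iclass p n j := by
    intro x hx
    by_contra hxj
    refine hempty ⟨fmap p A k x, ?_⟩
    rw [Finset.mem_inter, Finset.mem_sdiff]
    refine ⟨Finset.mem_image_of_mem _ hx, ?_, hxj⟩
    rw [Iclass, Finset.mem_filter, Finset.mem_Icc] at hx
    have hx0 : (x : ZMod p) ≠ 0 := by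
      rw [Ne, ZMod.natCast_eq_zero_iff]
      exact Nat.not_dvd_of_pos_of_lt (by omega) (by omega)
    have h1 : fmap p A k x ≠ 0 := by
      rw [fmap, Ne, ZMod.val_eq_zero]
      exact mul_ne_zero hA0' (pow_ne_zero _ hx0)
    have h2 : fmap p A k x < p := ZMod.val_lt _
    rw [Finset.mem_Icc]
    omega
  have hmul := fun (c : ZMod p) (hc : c ≠ 0) =>
    multiplier_of_fmap_mem hodd hn (by omega : i < n) hA0' hk1 hpn hd hf hc
  have hA1 : A = 1 ∨ A = -1 := by
    have h1 := hmul 1 one_ne_zero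
    rw [one_pow, mul_one] at h1
    have hA3 : 3 ≤ p := by omega
    have hAb := abs_lt.1 (show |A| < p - 1 by omega)
    rcases h1 with ⟨h1, -⟩ | ⟨h1, -⟩
    · left
      have : ((A - 1 : ℤ) : ZMod p) = 0 := by push_cast; rw [h1, sub_self]
      rw [ZMod.intCast_zmod_eq_zero_iff_dvd] at this
      have := Int.eq_zero_of_abs_lt_dvd this (by rw [abs_lt]; omega)
      omega
    · right
      have : ((A + 1 : ℤ) : ZMod p) = 0 := by push_cast; rw [h1, neg_add_cancel]
      rw [ZMod.intCast_zmod_eq_zero_iff_dvd] at this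
      have := Int.eq_zero_of_abs_lt_dvd this (by rw [abs_lt]; omega)
      omega
  have hk1' : k ≠ 1 := by
    rintro rfl
    rcases hex with ⟨-, h⟩ | ⟨-, h⟩
    · exact h ⟨hA1, rfl⟩
    · exact h ⟨hA1, Or.inl rfl⟩
  have hAsq : (A : ZMod p) ^ 2 = 1 := by
    rcases hA1 with rfl | rfl <;> simp
  obtain ⟨g, hg⟩ := IsCyclic.exists_generator (α := (ZMod p)ˣ)
  have hord : orderOf g = p - 1 := by
    rw [orderOf_eq_card_of_forall_mem_zpowers hg, Nat.card_eq_fintype_card, ZMod.card_units]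
  have hgk : g ^ (k - 1) ≠ 1 := by
    rw [Ne, ← orderOf_dvd_iff_pow_eq_one, hord]
    exact Nat.not_dvd_of_pos_of_lt (by omega) (by omega)
  have hgk' : (g : ZMod p) ^ (k - 1) ≠ 1 := by
    intro h
    exact hgk (Units.ext (by rw [Units.val_pow_eq_pow_val, h, Units.val_one]))
  rcases hex with ⟨hne, -⟩ | ⟨-, h⟩
  · have hparity : ¬ (i = j ∧ p % n = (i + j) % n) := by
      rintro ⟨rfl, h⟩
      obtain ⟨m, hm⟩ := hne
      have h2 : p ≡ i + i [MOD 2] := (show p ≡ i + i [MOD n] from h).of_dvd ⟨m, by omega⟩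
      obtain ⟨q, hq⟩ := hodd
      unfold Nat.ModEq at h2
      omega
    have h1 := hmul 1 one_ne_zero
    have h2 := hmul g g.ne_zero
    rw [one_pow, mul_one] at h1
    rcases h1 with ⟨h1, e1⟩ | ⟨h1, e1⟩ <;> rcases h2 with ⟨h2, e2⟩ | ⟨h2, e2⟩
    · rw [h1, one_mul] at h2
      exact hgk' h2
    · exact hparity ⟨e1, e2⟩
    · exact hparity ⟨e2, e1⟩
    · rw [h1, neg_one_mul, neg_inj] at h2
      exact hgk' h2
  · refine h ⟨hA1, Or.inr ?_⟩
    have h2 : (g : ZMod p) ^ ((k - 1) * 2) = 1 := by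
      have h3 : (A * (g : ZMod p) ^ (k - 1)) ^ 2 = 1 := by
        rcases hmul g g.ne_zero with ⟨h4, -⟩ | ⟨h4, -⟩ <;> rw [h4] <;> ring
      rwa [mul_pow, hAsq, one_mul, ← pow_mul] at h3
    have h5 : g ^ ((k - 1) * 2) = 1 :=
      Units.ext (by rw [Units.val_pow_eq_pow_val, h2, Units.val_one])
    rw [← orderOf_dvd_iff_pow_eq_one, hord] at h5
    obtain ⟨q, hq⟩ := h5
    have hq1 : q = 1 := by
      have h1 : q < 2 := by
        by_contra! h
        have : (p - 1) * 2 ≤ (p - 1) * q := Nat.mul_le_mul_left _ h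
        omega
      have h2 : q ≠ 0 := by
        rintro rfl
        omega
      omega
    rw [hq1, mul_one] at hq
    omega
end

section
/- Let p be a prime with p ≡ 1 (mod 4), n ≥ 2 an integer, and A an integer with 0 < |A| < p/2 and A ≠ ±1; let A^{−1} denote the integer of absolute value less than p/2 with A·A^{−1} ≡ 1 (mod p), and set C := min{|A|, |A^{−1}|}. If p > (2Cn + 1)², then the map f(x) = (A x^{(p+1)/2} mod p) is not of Type (iii): there are no indices i, j with 0 ≤ i, j ≤ n−1 and f(I_i) ⊆ I_j. -/
/-- A quadratic non-residue of size comparable to `L`, as soon as `4 * p ≤ L ^ 2`. -/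
theorem exists_nonresidue_near (p L : ℕ) [Fact p.Prime] (hp2 : p ≠ 2) (hL : 4 * p ≤ L ^ 2) :
    ∃ q : ℕ, q ≤ L ∧ L < 4 * q ∧ quadraticChar (ZMod p) (q : ZMod p) = -1 := by
  have hp : p.Prime := Fact.out
  have hch : ringChar (ZMod p) ≠ 2 := by rwa [ZMod.ringChar_zmod_n]
  have hex : ∃ q : ℕ, quadraticChar (ZMod p) (q : ZMod p) = -1 := by
    obtain ⟨a, ha⟩ := quadraticChar_exists_neg_one hch
    exact ⟨a.val, by rwa [ZMod.natCast_zmod_val]⟩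
  classical
  obtain ⟨q₀, hq₀, hmin⟩ : ∃ q : ℕ, quadraticChar (ZMod p) (q : ZMod p) = -1 ∧
      ∀ r < q, quadraticChar (ZMod p) (r : ZMod p) ≠ -1 :=
    ⟨Nat.find hex, Nat.find_spec hex, fun r hr => Nat.find_min hex hr⟩
  have hq₀0 : 0 < q₀ := by
    rcases Nat.eq_zero_or_pos q₀ with h | h
    · subst h; simp at hq₀
    · exact h
  have hq₀1 : q₀ ≠ 1 := by
    rintro rfl
    simp at hq₀
  have hq₀L : q₀ ≤ L := by
    by_contra! hlt
    have hmod : 0 < p % q₀ := by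
      rcases Nat.eq_zero_or_pos (p % q₀) with h | h
      · rcases (Nat.dvd_prime hp).1 (Nat.dvd_of_mod_eq_zero h) with h | h
        · exact absurd h hq₀1
        · subst h; simp at hq₀
      · exact h
    have hlt' := Nat.mod_lt p hq₀0
    have hdm := Nat.div_add_mod p q₀
    have hdL : p / q₀ + 1 < q₀ := by
      by_contra! hge
      nlinarith
    have hr := hmin (q₀ - p % q₀) (by omega)
    have hm := hmin (p / q₀ + 1) hdL
    have hprod : ((q₀ - p % q₀ : ℕ) : ZMod p) = (q₀ : ZMod p) * ((p / q₀ + 1 : ℕ) : ZMod p) := by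
      have h : q₀ - p % q₀ + p = q₀ * (p / q₀ + 1) := by
        rw [mul_add, mul_one]; omega
      have := congrArg (Nat.cast : ℕ → ZMod p) h
      rw [Nat.cast_add, Nat.cast_mul, ZMod.natCast_self, add_zero] at this
      exact this
    have hm0 : ((p / q₀ + 1 : ℕ) : ZMod p) ≠ 0 := by
      intro h0
      have := Nat.le_of_dvd (Nat.succ_pos _) ((ZMod.natCast_eq_zero_iff _ _).1 h0)
      have := Nat.div_le_div_left (a := p) (show 2 ≤ q₀ by omega) two_pos
      have := hp.two_le
      omega
    rw [hprod, map_mul, hq₀] at hr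
    rcases quadraticChar_dichotomy hm0 with h | h
    · rw [h] at hr; simp at hr
    · exact hm h
  let P : ℕ → Prop := fun q => quadraticChar (ZMod p) (q : ZMod p) = -1
  have hP : P (Nat.findGreatest P L) := Nat.findGreatest_spec (P := P) hq₀L hq₀
  refine ⟨Nat.findGreatest P L, Nat.findGreatest_le L, ?_, hP⟩
  by_contra! hle
  have hpos : q₀ ≤ Nat.findGreatest P L := Nat.le_findGreatest hq₀L hq₀
  have h4 : P (4 * Nat.findGreatest P L) := by
    have h20 : (2 : ZMod p) ≠ 0 := Ring.two_ne_zero hch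
    have h : ((4 * Nat.findGreatest P L : ℕ) : ZMod p)
        = 2 ^ 2 * ((Nat.findGreatest P L : ℕ) : ZMod p) := by push_cast; ring
    change quadraticChar (ZMod p) ((4 * Nat.findGreatest P L : ℕ) : ZMod p) = -1
    rw [h, map_mul, quadraticChar_sq_one' h20, one_mul]
    exact hP
  have := Nat.le_findGreatest (P := P) hle h4
  omega

/-- The quadratic character is not constant on an arithmetic progression
of length at least `2 * √p`. -/
theorem quadraticChar_not_const_on_progression (p L a n : ℕ) (e : ℤ) [Fact p.Prime] (hp2 : p ≠ 2)
    (hL : 4 * p ≤ L ^ 2) (hn : (n : ZMod p) ≠ 0) (he : e ≠ 0)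
    (h : ∀ m < L, quadraticChar (ZMod p) ((a + n * m : ℕ) : ZMod p) = e) : False := by
  obtain ⟨q, hqL, hLq, hq⟩ := exists_nonresidue_near p L hp2 hL
  set c : ZMod p := a / n
  set d : ℕ := (c - q * c).val with hd
  have hdp : d < p := ZMod.val_lt _
  have hq0 : 0 < q := by omega
  set m := (d + q - 1) / q with hm
  have hm1 : q * m ≤ d + q - 1 := Nat.mul_div_le _ _
  have hm2 : d ≤ q * m := by
    have := Nat.lt_mul_div_succ (d + q - 1) hq0
    rw [← hm, mul_add, mul_one] at this
    omega
  have hmL : m < L := by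
    by_contra! hge
    have h1 : q * L ≤ q * m := Nat.mul_le_mul_left q hge
    have h2 : (L + 1) * (L - 1) ≤ 4 * q * (L - 1) := Nat.mul_le_mul_right _ hLq
    obtain ⟨K, rfl⟩ : ∃ K, L = K + 1 := ⟨L - 1, by omega⟩
    simp only [Nat.add_sub_cancel] at h2
    have h3 : q * (K + 1) + 1 ≤ p - 1 + q := by omega
    have hp1 : 1 ≤ p := by omega
    zify [hp1] at *
    nlinarith
  have hcast : ((q * m - d : ℕ) : ZMod p) = q * m - (c - q * c) := by
    rw [Nat.cast_sub hm2, hd, ZMod.natCast_zmod_val, Nat.cast_mul]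
  have hc : (n : ZMod p) * c = a := mul_div_cancel₀ _ hn
  have hrel : ((a + n * (q * m - d) : ℕ) : ZMod p) = q * ((a + n * m : ℕ) : ZMod p) := by
    rw [Nat.cast_add, Nat.cast_mul, hcast, Nat.cast_add, Nat.cast_mul, ← hc]
    ring
  have h1 := h (q * m - d) (by omega)
  rw [hrel, map_mul, hq, h m hmL] at h1
  omega

theorem exists_mod_eq_in_window (n i s : ℕ) (hi : i < n) : ∃ a, s < a ∧ a ≤ s + n ∧ a % n = i := by
  have hn : 0 < n := by omega
  have hdm := Nat.div_add_mod s n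
  have hlt := Nat.mod_lt s hn
  rcases lt_or_ge (s % n) i with h | h
  · exact ⟨n * (s / n) + i, by omega, by omega, by rw [Nat.mul_add_mod, Nat.mod_eq_of_lt hi]⟩
  · refine ⟨n * (s / n + 1) + i, ?_, ?_, by rw [Nat.mul_add_mod, Nat.mod_eq_of_lt hi]⟩ <;>
      rw [mul_add, mul_one] <;> omega

/-- If `x` lies in `(k * p / C, (k + 1) * p / C)`, a representative in `[0, p)` of `τ * C * x`
with `τ = ± 1` is `C * x - k * p` or `(k + 1) * p - C * x`. -/
theorem residue_eq_of_mem_interval (p : ℕ) (C x y k τ : ℤ) (hy0 : 0 ≤ y) (hyp : y < p)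
    (hx1 : k * p < C * x) (hx2 : C * x < (k + 1) * p) (hτ : τ = 1 ∨ τ = -1)
    (hd : (p : ℤ) ∣ y - τ * (C * x)) :
    y = τ * (C * x) - (if τ = 1 then k else -(k + 1)) * p := by
  obtain ⟨t, ht⟩ := hd
  have hp : (0 : ℤ) < p := by omega
  rcases hτ with rfl | rfl
  · have h1 : t < -k + 1 := by nlinarith
    have h2 : -k - 1 < t := by nlinarith
    have : t = -k := by omega
    subst this
    simp; linarith
  · have h1 : t < k + 1 + 1 := by nlinarith
    have h2 : k < t := by nlinarith
    have : t = k + 1 := by omega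
    subst this
    norm_num; linarith

/-- The map `x ↦ A * χ(x) * x` cannot send a residue class modulo `n`, with at most one point
removed, into a single residue class modulo `n` when `p` is large. -/
theorem twisted_mul_not_class_to_class (p n : ℕ) (A : ℤ) (i j y₀ : ℕ) [Fact p.Prime] (hp2 : p ≠ 2)
    (hn : 2 ≤ n) (hA : 2 ≤ |A|) (hbig : (2 * |A| * (n : ℤ) + 1) ^ 2 < (p : ℤ)) (hi : i < n)
    (h : ∀ x, 0 < x → x < p → x % n = i → x ≠ y₀ → ∃ y : ℕ, y < p ∧ y % n = j ∧
      (y : ZMod p) = A * (quadraticChar (ZMod p) (x : ZMod p) : ℤ) * x) : False := by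
  have hp : p.Prime := Fact.out
  obtain ⟨C, hC⟩ : ∃ C : ℕ, (C : ℤ) = |A| := ⟨A.natAbs, by simp⟩
  rw [← hC] at hA hbig
  have hC2 : 2 ≤ C := by exact_mod_cast hA
  have hbig' : (2 * (C * n) + 1) ^ 2 < p := by
    have : (2 * (C : ℤ) * n + 1) ^ 2 < p := hbig
    rw [← mul_assoc]
    exact_mod_cast this
  have hCn : n ≤ C * n ∧ C ≤ C * n := ⟨by nlinarith, by nlinarith⟩
  have hDp : C * n < p := by nlinarith
  have hnp : n < p := by omega
  have hCp : C < p := by omega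
  set L := p / (C * n) with hL
  set u := p / C with hu
  have hCu : C * u < p := by
    refine lt_of_le_of_ne (Nat.mul_div_le _ _) fun he => ?_
    rcases (Nat.dvd_prime hp).1 (Dvd.intro _ he) with h | h <;> omega
  have hCu' : p < C * (u + 1) := Nat.lt_mul_div_succ p (by omega)
  have hLu : n * L ≤ u := by
    rw [hL, hu, ← Nat.div_div_eq_div_mul]
    exact Nat.mul_div_le _ _
  have hL4 : 4 * (C * n) + 4 ≤ L := by
    have := Nat.lt_mul_div_succ p (show 0 < C * n by omega)
    rw [← hL] at this
    by_contra! hlt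
    nlinarith
  have hLsq : 4 * p ≤ L ^ 2 := by
    have := Nat.lt_mul_div_succ p (show 0 < C * n by omega)
    rw [← hL] at this
    nlinarith
  have hu2 : 2 * u < p := by nlinarith
  have hcast0 : ∀ x : ℕ, 0 < x → x < p → (x : ZMod p) ≠ 0 := fun x h0 hx hz =>
    absurd (Nat.le_of_dvd h0 ((ZMod.natCast_eq_zero_iff _ _).1 hz)) (by omega)
  have hndvd : ¬ ((n : ℤ) ∣ p) := by
    intro hd
    rcases (Nat.dvd_prime hp).1 (Int.natCast_dvd_natCast.1 hd) with h | h <;> omega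
  obtain ⟨σ, hσ, hAσ⟩ : ∃ σ : ℤ, (σ = 1 ∨ σ = -1) ∧ A = σ * C := by
    rcases abs_choice A with h | h
    · exact ⟨1, Or.inl rfl, by omega⟩
    · exact ⟨-1, Or.inr rfl, by omega⟩
  have hval : ∀ (x k : ℕ), 0 < x → x < p → x % n = i → x ≠ y₀ → k * p < C * x →
      C * x < (k + 1) * p → ∃ y τ : ℤ, y % n = j ∧
      τ = quadraticChar (ZMod p) (x : ZMod p) * σ ∧
      y = τ * (C * x) - (if τ = 1 then (k : ℤ) else -(k + 1)) * p := by
    intro x k hx0 hxp hxi hxy h1 h2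
    obtain ⟨y, hyp, hyj, hy⟩ := h x hx0 hxp hxi hxy
    have hτ : quadraticChar (ZMod p) (x : ZMod p) * σ = 1 ∨
        quadraticChar (ZMod p) (x : ZMod p) * σ = -1 := by
      rcases quadraticChar_dichotomy (hcast0 x hx0 hxp) with h | h <;> rcases hσ with h' | h' <;>
        rw [h, h'] <;> simp
    refine ⟨y, _, by exact_mod_cast hyj, rfl, ?_⟩
    refine residue_eq_of_mem_interval p C x y k _ (by positivity) (by exact_mod_cast hyp)
      (by exact_mod_cast h1) (by exact_mod_cast h2) hτ ?_
    rw [← ZMod.intCast_zmod_eq_zero_iff_dvd]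
    push_cast
    rw [hy, hAσ]
    push_cast
    ring
  have hopp : ∀ x z : ℕ, 0 < x → x ≤ u → x % n = i → x ≠ y₀ → u < z → z ≤ 2 * u → z % n = i →
      z ≠ y₀ →
      quadraticChar (ZMod p) (x : ZMod p) = - quadraticChar (ZMod p) (z : ZMod p) := by
    intro x z hx0 hxu hxi hxy hzu hz2 hzi hzy
    by_contra hne
    have heq : quadraticChar (ZMod p) (x : ZMod p) = quadraticChar (ZMod p) (z : ZMod p) := by
      rcases quadraticChar_dichotomy (hcast0 x hx0 (by omega)) with h | h <;>
      rcases quadraticChar_dichotomy (hcast0 z (by omega) (by omega)) with h' | h' <;>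
        rw [h, h'] at hne ⊢ <;> simp at hne
    have hCx : C * x ≤ C * u := Nat.mul_le_mul_left C hxu
    have hCx0 : 0 < C * x := Nat.mul_pos (by omega) hx0
    have hCz : C * (u + 1) ≤ C * z := Nat.mul_le_mul_left C hzu
    have hCz2 : C * z ≤ 2 * (C * u) := by
      rw [mul_left_comm]; exact Nat.mul_le_mul_left C hz2
    obtain ⟨y, τ, hyj, hτ, hy⟩ := hval x 0 hx0 (by omega) hxi hxy (by omega) (by omega)
    obtain ⟨w, τ', hwj, hτ', hw⟩ := hval z 1 (by omega) (by omega) hzi hzy (by omega) (by omega)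
    rw [heq, ← hτ'] at hτ
    subst hτ
    have hd1 : (n : ℤ) ∣ y - w := Int.ModEq.dvd (hwj.trans hyj.symm)
    have hd2 : (n : ℤ) ∣ (x : ℤ) - z :=
      Int.ModEq.dvd (show (z : ℤ) % n = x % n by exact_mod_cast hzi.trans hxi.symm)
    apply hndvd
    have hd3 := dvd_sub hd1 (hd2.mul_left (τ * C))
    by_cases h1 : τ = 1
    · rw [if_pos h1] at hy hw
      rwa [show y - w - τ * C * ((x : ℤ) - z) = p by rw [hy, hw]; push_cast; ring] at hd3
    · rw [if_neg h1] at hy hw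
      rw [show y - w - τ * C * ((x : ℤ) - z) = -p by rw [hy, hw]; push_cast; ring] at hd3
      exact (dvd_neg).1 hd3
  have hn0 : (n : ZMod p) ≠ 0 := hcast0 n (by omega) hnp
  obtain ⟨a, ha0, han, hai⟩ := exists_mod_eq_in_window n i 0 hi
  obtain ⟨b, hb0, hbn, hbi⟩ := exists_mod_eq_in_window n i u hi
  have hstep : ∀ m < L, n * m + n ≤ u := fun m hm =>
    le_trans (by rw [← Nat.mul_succ]; exact Nat.mul_le_mul_left n hm) hLu
  have hne0 : ∀ z : ℕ, 0 < z → z < p → -quadraticChar (ZMod p) (z : ZMod p) ≠ 0 := by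
    intro z hz hzp
    rw [neg_ne_zero]
    exact fun h0 => hcast0 z hz hzp (quadraticChar_eq_zero_iff.1 h0)
  have h2n : 2 * n ≤ u := by
    have := hstep 1 (by omega)
    omega
  by_cases hy : y₀ ≤ u
  · obtain ⟨z, hz0, hzu, hzi, hzy⟩ : ∃ z, 0 < z ∧ z ≤ u ∧ z % n = i ∧ z ≠ y₀ := by
      by_cases h : a = y₀
      · exact ⟨a + n, by omega, by omega, by rwa [Nat.add_mod_right], by omega⟩
      · exact ⟨a, by omega, by omega, hai, h⟩
    refine quadraticChar_not_const_on_progression p L b n _ hp2 hLsq hn0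
      (hne0 z hz0 (by omega)) fun m hm => ?_
    have := hstep m hm
    rw [hopp z (b + n * m) hz0 hzu hzi hzy (by omega) (by omega)
      (by rwa [Nat.add_mul_mod_self_left]) (by omega), neg_neg]
  · obtain ⟨z, hz0, hzu, hzi, hzy⟩ : ∃ z, u < z ∧ z ≤ 2 * u ∧ z % n = i ∧ z ≠ y₀ := by
      by_cases h : b = y₀
      · exact ⟨b + n, by omega, by omega, by rwa [Nat.add_mod_right], by omega⟩
      · exact ⟨b, by omega, by omega, hbi, h⟩
    refine quadraticChar_not_const_on_progression p L a n _ hp2 hLsq hn0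
      (hne0 z (by omega) (by omega)) fun m hm => ?_
    have := hstep m hm
    exact hopp (a + n * m) z (by omega) (by omega)
      (by rwa [Nat.add_mul_mod_self_left]) (by omega) hz0 hzu hzi hzy

theorem fmap_cast (p : ℕ) (A : ℤ) (x : ℕ) [Fact p.Prime] (hp2 : p ≠ 2) :
    (fmap p A ((p + 1) / 2) x : ZMod p)
      = A * (quadraticChar (ZMod p) (x : ZMod p) : ℤ) * x := by
  have hodd : p % 2 = 1 := (Nat.Prime.eq_two_or_odd Fact.out).resolve_left hp2
  rw [fmap, ZMod.natCast_zmod_val, quadraticChar_eq_pow_of_char_ne_two' (by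
    rwa [ZMod.ringChar_zmod_n]), ZMod.card, show (p + 1) / 2 = p / 2 + 1 by omega, pow_succ]
  ring

theorem mem_Iclass {p n j x : ℕ} : x ∈ Iclass p n j ↔ (1 ≤ x ∧ x ≤ p - 1) ∧ x % n = j := by
  simp [Iclass]

/-- Two residue classes differ in size by at most one. -/
theorem card_Iclass_le (p n i j : ℕ) (hi : i < n) :
    (Iclass p n j).card ≤ (Iclass p n i).card + 1 := by
  by_cases hj : j < n
  swap
  · have : Iclass p n j = ∅ := by
      refine Finset.eq_empty_of_forall_notMem fun x hx => hj ?_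
      rw [← (mem_Iclass.1 hx).2]
      exact Nat.mod_lt _ (by omega)
    simp [this]
  rw [← Finset.card_filter_add_card_filter_not (s := Iclass p n j) (fun x => x + n ≤ p - 1)]
  refine add_le_add ?_ ?_
  · refine Finset.card_le_card_of_injOn (fun x => x + (i + n - j) % n) ?_ ?_
    · intro x hx
      obtain ⟨hx, hxn⟩ := Finset.mem_filter.1 hx
      obtain ⟨hx1, hx2⟩ := mem_Iclass.1 hx
      have hlt := Nat.mod_lt (i + n - j) (show 0 < n by omega)
      change x + (i + n - j) % n ∈ Iclass p n i
      refine mem_Iclass.2 ⟨by omega, ?_⟩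
      rw [Nat.add_mod_mod, Nat.add_mod, hx2, Nat.add_mod_mod, show j + (i + n - j) = i + n by omega,
        Nat.add_mod_right, Nat.mod_eq_of_lt hi]
    · intro x _ y _ hxy
      simpa using hxy
  · refine Finset.card_le_one.2 fun x hx y hy => ?_
    obtain ⟨hx, hx'⟩ := Finset.mem_filter.1 hx
    obtain ⟨hy, hy'⟩ := Finset.mem_filter.1 hy
    obtain ⟨hx1, hx2⟩ := mem_Iclass.1 hx
    obtain ⟨hy1, hy2⟩ := mem_Iclass.1 hy
    have hxy : (x : ℤ) % n = y % n := by exact_mod_cast hx2.trans hy2.symm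
    have := Int.eq_zero_of_abs_lt_dvd (Int.ModEq.dvd hxy) (by rw [abs_lt]; omega)
    omega

/-- For `p ≡ 1 (mod 4)`, the map `y ↦ χ(B) * B * χ(y) * y` inverts `x ↦ A * χ(x) * x`. -/
theorem twisted_mul_inverse (p : ℕ) (A B x : ZMod p) [Fact p.Prime] (hp4 : p % 4 = 1)
    (hAB : A * B = 1) (hx : x ≠ 0) :
    x = ((quadraticChar (ZMod p) B : ℤ) : ZMod p) * B *
      (quadraticChar (ZMod p) (A * (quadraticChar (ZMod p) x : ℤ) * x) : ℤ) *
      (A * (quadraticChar (ZMod p) x : ℤ) * x) := by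
  have hneg : quadraticChar (ZMod p) (-1) = 1 := by
    rw [quadraticChar_one_iff_isSquare (neg_ne_zero.2 one_ne_zero), ZMod.exists_sq_eq_neg_one_iff]
    omega
  have hχ : quadraticChar (ZMod p) A * quadraticChar (ZMod p) B = 1 := by
    rw [← map_mul, hAB, map_one]
  have hχ' : ((quadraticChar (ZMod p) A : ℤ) : ZMod p) * (quadraticChar (ZMod p) B : ℤ) = 1 := by
    exact_mod_cast congrArg (Int.cast : ℤ → ZMod p) hχ
  rcases quadraticChar_dichotomy hx with h | h
  · simp only [h, map_mul, Int.cast_one, mul_one]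
    linear_combination (-x) * hχ' - (quadraticChar (ZMod p) A : ZMod p) *
      (quadraticChar (ZMod p) B : ZMod p) * x * hAB
  · simp only [h, map_mul, Int.cast_neg, Int.cast_one, hneg, mul_one, Int.cast_mul]
    linear_combination (-x) * hχ' - (quadraticChar (ZMod p) A : ZMod p) *
      (quadraticChar (ZMod p) B : ZMod p) * x * hAB

theorem stmt_18 (p n : ℕ) (A B : ℤ) (hp : p.Prime) (hp4 : p % 4 = 1) (hn : 2 ≤ n)
    (hA : 2 * |A| < (p : ℤ)) (hA0 : A ≠ 0) (hA1 : A ≠ 1) (hA1' : A ≠ -1)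
    -- `B` is the representative of `A⁻¹ mod p` of absolute value less than `p/2`
    (hB : 2 * |B| < (p : ℤ)) (hAB : (p : ℤ) ∣ (A * B - 1))
    -- `p > (2Cn+1)²` where `C = min{|A|, |A⁻¹|}`
    (hbig : (2 * min |A| |B| * (n : ℤ) + 1) ^ 2 < (p : ℤ)) :
    ∀ i j : ℕ, i ≤ n - 1 → j ≤ n - 1 →
      ¬ ((Iclass p n i).image (fmap p A ((p + 1) / 2)) ⊆ Iclass p n j) := by
  intro i j hi hj hsub
  have : Fact p.Prime := ⟨hp⟩
  have hp2 : p ≠ 2 := by omega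
  have hmap : ∀ x, 0 < x → x < p → x % n = i → fmap p A ((p + 1) / 2) x ∈ Iclass p n j :=
    fun x h0 hx hxi => hsub (Finset.mem_image_of_mem _ (mem_Iclass.2 ⟨by omega, hxi⟩))
  have hp1 := hp.one_lt
  rcases le_or_gt |A| |B| with hle | hlt
  · rw [min_eq_left hle] at hbig
    refine twisted_mul_not_class_to_class p n A i j 0 hp2 hn ?_ hbig (by omega) ?_
    · rcases abs_cases A with h | h <;> omega
    intro x h0 hx hxi _
    have := mem_Iclass.1 (hmap x h0 hx hxi)
    exact ⟨_, by omega, this.2, fmap_cast p A x hp2⟩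
  · rw [min_eq_right hlt.le] at hbig
    have hB2 : 2 ≤ |B| := by
      by_contra! hB1
      have : B = 0 ∨ B = 1 ∨ B = -1 := by rcases abs_cases B with h | h <;> omega
      rcases this with rfl | rfl | rfl
      all_goals
        have := Int.eq_zero_of_abs_lt_dvd hAB (by
          rw [abs_lt]; rcases abs_cases A with h | h <;> omega)
        omega
    have hABz : (A : ZMod p) * (B : ZMod p) = 1 := by
      have := (ZMod.intCast_zmod_eq_zero_iff_dvd _ _).2 hAB
      push_cast at this
      exact sub_eq_zero.1 this
    have hB0 : (B : ZMod p) ≠ 0 := right_ne_zero_of_mul_eq_one hABz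
    have hinv : ∀ x, x ∈ Iclass p n i → (x : ZMod p) =
        ((quadraticChar (ZMod p) (B : ZMod p) : ℤ) : ZMod p) * B *
        (quadraticChar (ZMod p) (fmap p A ((p + 1) / 2) x : ZMod p) : ℤ) *
        (fmap p A ((p + 1) / 2) x : ZMod p) := by
      intro x hx
      have hx := mem_Iclass.1 hx
      rw [fmap_cast p A x hp2]
      refine twisted_mul_inverse p A B x hp4 hABz fun h0 => ?_
      have := Nat.le_of_dvd (by omega) ((ZMod.natCast_eq_zero_iff _ _).1 h0)
      omega
    have hinj : Set.InjOn (fmap p A ((p + 1) / 2)) (Iclass p n i) := by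
      intro x hx x' hx' he
      have h1 := hinv x hx
      rw [he, ← hinv x' hx', ZMod.natCast_eq_natCast_iff'] at h1
      have hx := mem_Iclass.1 hx
      have hx' := mem_Iclass.1 hx'
      rwa [Nat.mod_eq_of_lt (by omega), Nat.mod_eq_of_lt (by omega)] at h1
    have hcard : (Iclass p n j \ (Iclass p n i).image (fmap p A ((p + 1) / 2))).card ≤ 1 := by
      rw [Finset.card_sdiff_of_subset hsub, Finset.card_image_of_injOn hinj]
      have := card_Iclass_le p n i j (by omega)
      omega
    obtain ⟨y₀, hy₀⟩ := Finset.card_le_one_iff_subset_singleton.1 hcard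
    have habs : |quadraticChar (ZMod p) (B : ZMod p) * B| = |B| := by
      rcases quadraticChar_dichotomy hB0 with h | h <;> rw [h] <;> simp
    refine twisted_mul_not_class_to_class p n (quadraticChar (ZMod p) (B : ZMod p) * B) j i y₀ hp2
      hn (by rwa [habs]) (by rwa [habs]) (by omega) ?_
    intro y h0 hy hyj hyy
    have hmem : y ∈ (Iclass p n i).image (fmap p A ((p + 1) / 2)) := by
      by_contra hnot
      exact hyy (Finset.mem_singleton.1 (hy₀ (Finset.mem_sdiff.2
        ⟨mem_Iclass.2 ⟨by omega, hyj⟩, hnot⟩)))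
    obtain ⟨x, hx, rfl⟩ := Finset.mem_image.1 hmem
    have hx' := mem_Iclass.1 hx
    refine ⟨x, by omega, hx'.2, ?_⟩
    rw [Int.cast_mul]
    exact hinv x hx
end
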